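/- Assume hypothesis (****) and that both K and L have supporting spheres at all of their boundary points (for S^d of radii less than π/2). Then each of conditions (5) and (6) of Theorem 7 implies that the boundaries bd K and bd L are, at each of their boundary points, locally relatively open subsets of spherical surfaces of some fixed sectional curvature κ, with κ > 0 for S^d and ℝ^d and κ > 1 for H^d; for X = S^d the radius of these spherical surfaces is less than π/2. -/

import Mathlib

open Metric Set Filter

namespace BallChar

/-- `X` is (isometric to) the `d`-dimensional round sphere of radius 1,
with the intrinsic (great-circle) metric. -/
def IsSphereSpace (X : Type*) [MetricSpace X] (d : ℕ) : Prop :=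
  ∃ e : X → EuclideanSpace ℝ (Fin (d + 1)),
    Function.Injective e ∧
    Set.range e = Metric.sphere (0 : EuclideanSpace ℝ (Fin (d + 1))) 1 ∧
    ∀ x y : X, dist x y = Real.arccos (@inner ℝ _ _ (e x) (e y))

/-- `X` is (isometric to) the `d`-dimensional Euclidean space. -/
def IsEuclideanSpaceForm (X : Type*) [MetricSpace X] (d : ℕ) : Prop :=
  Nonempty (X ≃ᵢ EuclideanSpace ℝ (Fin d))

/-- The Minkowski bilinear form on `ℝ^d × ℝ`. -/
noncomputable def mink (d : ℕ) (u v : EuclideanSpace ℝ (Fin d) × ℝ) : ℝ :=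
  @inner ℝ _ _ u.1 v.1 - u.2 * v.2

/-- `X` is (isometric to) the `d`-dimensional hyperbolic space of curvature `-1`
(the hyperboloid model). -/
def IsHyperbolicSpace (X : Type*) [MetricSpace X] (d : ℕ) : Prop :=
  ∃ e : X → EuclideanSpace ℝ (Fin d) × ℝ,
    Function.Injective e ∧
    Set.range e = {u | mink d u u = -1 ∧ 0 < u.2} ∧
    ∀ x y : X, Real.cosh (dist x y) = - mink d (e x) (e y)

/-- `X` is `S^d`, `ℝ^d` or `H^d`. -/
def IsSpaceForm (X : Type*) [MetricSpace X] (d : ℕ) : Prop :=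
  IsSphereSpace X d ∨ IsEuclideanSpaceForm X d ∨ IsHyperbolicSpace X d

variable {X : Type*} [MetricSpace X]

/-- Metric betweenness: `z` lies on a shortest geodesic from `x` to `y`. -/
def Btw (x z y : X) : Prop := dist x z + dist z y = dist x y

/-- `z` is the unique point between `x` and `y` at its distance from `x`. -/
def UniqueBtwPt (x z y : X) : Prop :=
  Btw x z y ∧ ∀ w, Btw x w y → dist x w = dist x z → w = z

/-- Geodesic convexity (for two antipodal points of a sphere no condition is imposed). -/
def GConvex (K : Set X) : Prop :=
  ∀ x ∈ K, ∀ y ∈ K, ∀ z, UniqueBtwPt x z y → z ∈ K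

/-- `p` is a (metric) midpoint of `x` and `y`. -/
def IsMidpoint (p x y : X) : Prop := Btw x p y ∧ dist x p = dist p y

/-- A reflection in a hyperplane: a non-trivial involutive isometry whose
non-fixed locus is disconnected (by the mirror hyperplane). -/
def IsReflection (σ : X ≃ᵢ X) : Prop :=
  σ.trans σ = IsometryEquiv.refl X ∧ σ ≠ IsometryEquiv.refl X ∧
    ¬ IsPreconnected {x : X | σ x ≠ x}

/-- An orientation preserving congruence: a product of an even number of reflections. -/
def OrientationPreserving (f : X ≃ᵢ X) : Prop :=
  ∃ l : List (X ≃ᵢ X), (∀ σ ∈ l, IsReflection σ) ∧ Even l.length ∧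
    f = l.foldr IsometryEquiv.trans (IsometryEquiv.refl X)

/-- Two subsets are congruent if some isometry of the space maps one onto the other. -/
def Congruent (A B : Set X) : Prop := ∃ f : X ≃ᵢ X, ⇑f '' A = B

/-- `S` admits some non-trivial congruence. -/
def AdmitsNontrivialCongruence (S : Set X) : Prop :=
  ∃ f : X ≃ᵢ X, f ≠ IsometryEquiv.refl X ∧ ⇑f '' S = S

/-- `S` is axially symmetric (symmetric with respect to some reflection). -/
def AxiallySymmetric (S : Set X) : Prop :=
  ∃ σ : X ≃ᵢ X, IsReflection σ ∧ ⇑σ '' S = S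

/-- `S` is centrally symmetric: some involutive isometry fixing a point `p`
maps `S` onto itself, `p` being a midpoint of every pair `x`, `σ x` of `S`. -/
def CentrallySymmetric (S : Set X) : Prop :=
  ∃ (σ : X ≃ᵢ X) (p : X), Function.Involutive ⇑σ ∧ σ p = p ∧ ⇑σ '' S = S ∧
    ∀ x ∈ S, IsMidpoint p x (σ x)

/-- `S` is symmetric with respect to the orthogonal bisector hyperplane of
the segment `[a, b]`, i.e. invariant under the reflection interchanging `a` and `b`. -/
def SymmetricWrtPerpBisector (S : Set X) (a b : X) : Prop :=
  ∃ σ : X ≃ᵢ X, IsReflection σ ∧ σ a = b ∧ ⇑σ '' S = S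

/-- A closed half-space: one of the two closed sides of the mirror of a reflection. -/
def IsHalfspace (P : Set X) : Prop :=
  ∃ σ : X ≃ᵢ X, IsReflection σ ∧ IsClosed P ∧
    P ∪ ⇑σ '' P = univ ∧ P ∩ ⇑σ '' P = {x | σ x = x}

/-- A hyperplane: the mirror (fixed point set) of a reflection. -/
def IsHyperplane (B : Set X) : Prop :=
  ∃ σ : X ≃ᵢ X, IsReflection σ ∧ B = {x | σ x = x}

/-- A paraball (horoball): a sublevel set of a Busemann function. -/
def IsParaball (K : Set X) : Prop :=
  ∃ γ : ℝ → X, Isometry γ ∧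
    K = {x | ∃ b ≤ 0, Tendsto (fun t => dist x (γ t) - t) atTop (nhds b)}

/-- A parasphere (horosphere): the boundary of a paraball. -/
def IsParasphere (C : Set X) : Prop := ∃ K : Set X, IsParaball K ∧ C = frontier K

/-- A hypersphere at distance `lam > 0` from its base hyperplane
(degeneration to a hyperplane excluded). -/
def IsHypersphere (C : Set X) (lam : ℝ) : Prop :=
  0 < lam ∧ (∃ P : Set X, IsHalfspace P ∧ C = frontier {x | infDist x P ≤ lam}) ∧
    ¬ IsHyperplane C

/-- The family of connected components of the boundary of `K`. -/
def bdryComponents (K : Set X) : Set (Set X) :=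
  (connectedComponentIn (frontier K)) '' (frontier K)

/-- `closedBall p r` is an inball of `M` (a ball of maximal radius contained in `M`). -/
def IsInball (M : Set X) (p : X) (r : ℝ) : Prop :=
  0 ≤ r ∧ closedBall p r ⊆ M ∧ ∀ (q : X) (s : ℝ), closedBall q s ⊆ M → s ≤ r

/-- `closedBall p r` is the unique inball of `M`. -/
def HasUniqueInball (M : Set X) (p : X) (r : ℝ) : Prop :=
  IsInball M p r ∧ ∀ (q : X) (s : ℝ), IsInball M q s → q = p

/-- The (geodesic) convex hull of a set. -/
def gconvexHull (Y : Set X) : Set X := ⋂₀ {C : Set X | GConvex C ∧ Y ⊆ C}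

/-- `z` lies on the complete geodesic line through `a` and `b`. -/
def OnLine (a b z : X) : Prop := Btw a z b ∨ Btw z a b ∨ Btw a b z

/-- The closed `(d-1)`-ball of radius `ε` centred at `a` in the hyperplane through `a`
orthogonal to the segment `[a, b]`. -/
def perpDisc (a b : X) (ε : ℝ) : Set X :=
  {x | (∀ z, OnLine a b z → dist x a ≤ dist x z) ∧ dist x a ≤ ε}

/-- The set `D(ε)` associated to the segment `D = [a, b]`: the convex hull of the two
`(d-1)`-balls of radius `ε` orthogonal to `D` at its endpoints. -/
def segCyl (a b : X) (ε : ℝ) : Set X :=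
  gconvexHull (perpDisc a b ε ∪ perpDisc b a ε)

/-- `[a, b]` is the unique diametral segment of `M`. -/
def UniqueDiametral (M : Set X) (a b : X) : Prop :=
  a ∈ M ∧ b ∈ M ∧ a ≠ b ∧ dist a b = diam M ∧
    ∀ a' ∈ M, ∀ b' ∈ M, dist a' b' = diam M → (a' = a ∧ b' = b) ∨ (a' = b ∧ b' = a)

/-- Condition (**): at every boundary point, `K` contains a ball having this point
on its boundary. -/
def CondBallInside (K : Set X) : Prop :=
  ∀ x ∈ frontier K, ∃ ε > 0, ∃ p : X, closedBall p ε ⊆ K ∧ x ∈ sphere p ε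

/-- `K` has an extreme point. -/
def HasExtremePoint (K : Set X) : Prop :=
  ∃ x ∈ K, ∀ y ∈ K, ∀ z ∈ K, Btw y x z → x = y ∨ x = z

/-- Condition (***): near every boundary point, `K` is contained in a ball
(resp. in a convex set bounded by a hypersphere, for hyperbolic space) whose boundary
has sectional curvatures bounded below and passes through the given point. -/
def CondCurvBound (d : ℕ) (K : Set X) : Prop :=
  ∀ x ∈ frontier K, ∃ ε > 0, ∃ B : Set X,
    {y | y ∈ K ∧ dist y x ≤ ε} ⊆ B ∧ x ∈ frontier B ∧
    (IsSphereSpace X d → ∃ (q : X) (R : ℝ), 0 < R ∧ R < Real.pi / 2 ∧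
        ε ≤ Real.cos R / Real.sin R ∧ B = closedBall q R) ∧
    (IsEuclideanSpaceForm X d → ∃ (q : X) (R : ℝ), 0 < R ∧ ε ≤ 1 / R ∧ B = closedBall q R) ∧
    (IsHyperbolicSpace X d → ∃ (P : Set X) (lam : ℝ), IsHalfspace P ∧ 0 < lam ∧
        ε ≤ Real.tanh lam ∧ B = {y | infDist y P ≤ lam})

/-- `K` has a supporting sphere at each of its boundary points
(for the sphere, of radius less than `π/2`). -/
def SupportingSpheres (d : ℕ) (K : Set X) : Prop :=
  ∀ x ∈ frontier K, ∃ (p : X) (R : ℝ), 0 < R ∧ K ⊆ closedBall p R ∧ x ∈ sphere p R ∧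
    (IsSphereSpace X d → R < Real.pi / 2)

/-- `K` is `C¹` (smooth): at each boundary point there is a unique supporting half-space. -/
def SmoothBody (K : Set X) : Prop :=
  ∀ x ∈ frontier K, ∃! P : Set X, IsHalfspace P ∧ K ⊆ P ∧ x ∈ frontier P

/-- A complete geodesic (straight line). -/
def IsGeodesicLine (B : Set X) : Prop := ∃ γ : ℝ → X, Isometry γ ∧ B = Set.range γ

/-- A circle (closed disc) of positive radius. -/
def IsDisc (K : Set X) : Prop := ∃ (p : X) (r : ℝ), 0 < r ∧ K = closedBall p r

/-- The parallel domain of `B` at distance `l`. -/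
def parallelDomain (B : Set X) (l : ℝ) : Set X := {x | infDist x B ≤ l}

/-- `K` is the parallel domain of some straight line, at some distance `l > 0`. -/
def IsParallelDomain (K : Set X) : Prop :=
  ∃ (B : Set X) (l : ℝ), IsGeodesicLine B ∧ 0 < l ∧ K = parallelDomain B l

/-- A convex domain bounded by a (proper) hypercycle. -/
def IsHypercycleDomain (K : Set X) : Prop :=
  ∃ (P : Set X) (l : ℝ), IsHalfspace P ∧ 0 < l ∧ K = {x | infDist x P ≤ l}

/-- `C` is a hypercycle or a straight line (a curve at constant distance `l ≥ 0`
from its base line). -/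
def IsHypercycleOrLine (C : Set X) : Prop :=
  ∃ (P : Set X) (l : ℝ), IsHalfspace P ∧ 0 ≤ l ∧ C = frontier {x | infDist x P ≤ l}

/-- `C` is a hypercycle (or straight line) with base line `B`. -/
def HypercycleWithBase (C B : Set X) : Prop :=
  ∃ (P : Set X) (l : ℝ), IsHalfspace P ∧ 0 ≤ l ∧ frontier P = B ∧
    C = frontier {x | infDist x P ≤ l}

/-! Cases (A)-(E) of Theorem 5 (hyperbolic plane). -/

/-- One of the basic bodies of case (A). -/
def CaseABody (K : Set X) : Prop :=
  IsDisc K ∨ IsParaball K ∨ IsHypercycleDomain K ∨ IsHalfspace K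

/-- Case (A) of Theorem 5. -/
def CaseA (K L : Set X) : Prop :=
  CaseABody K ∧ CaseABody L ∧
    ((IsHypercycleDomain K ∨ IsHalfspace K) → IsDisc L ∨ Congruent K L) ∧
    ((IsHypercycleDomain L ∨ IsHalfspace L) → IsDisc K ∨ Congruent L K)

/-- `M` is bounded either by two hypercycles whose base lines coincide, or by a
hypercycle and its base line. -/
def TwoHypSameBase (M : Set X) : Prop :=
  ∃ (B C₁ C₂ : Set X), IsGeodesicLine B ∧ C₁ ≠ C₂ ∧
    HypercycleWithBase C₁ B ∧ HypercycleWithBase C₂ B ∧ frontier M = C₁ ∪ C₂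

/-- Case (B) of Theorem 5. -/
def CaseB (K L : Set X) : Prop :=
  (IsDisc K ∧ TwoHypSameBase L) ∨ (IsDisc L ∧ TwoHypSameBase K)

/-- `M` is bounded by at least two hypercycles or straight lines, with all base lines
different, whose mutual distances are at least `2r`. -/
def MultiHypFarApart (M : Set X) (r : ℝ) : Prop :=
  (∀ x ∈ frontier M, IsHypercycleOrLine (connectedComponentIn (frontier M) x)) ∧
  (∃ x ∈ frontier M, ∃ y ∈ frontier M,
      connectedComponentIn (frontier M) x ≠ connectedComponentIn (frontier M) y) ∧
  (∀ x ∈ frontier M, ∀ y ∈ frontier M,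
      connectedComponentIn (frontier M) x ≠ connectedComponentIn (frontier M) y →
        2 * r ≤ dist x y ∧
        ∀ B₁ B₂ : Set X, HypercycleWithBase (connectedComponentIn (frontier M) x) B₁ →
          HypercycleWithBase (connectedComponentIn (frontier M) y) B₂ → B₁ ≠ B₂)

/-- Case (C) of Theorem 5. -/
def CaseC (K L : Set X) : Prop :=
  (∃ (p : X) (r : ℝ), 0 < r ∧ K = closedBall p r ∧ MultiHypFarApart L r) ∨
  (∃ (p : X) (r : ℝ), 0 < r ∧ L = closedBall p r ∧ MultiHypFarApart K r)

/-- Case (D) of Theorem 5. -/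
def CaseD (K L : Set X) : Prop :=
  (IsParaball K ∧ IsParallelDomain L) ∨ (IsParaball L ∧ IsParallelDomain K)

/-- Case (E) of Theorem 5. -/
def CaseE (K L : Set X) : Prop :=
  Congruent K L ∧ IsParallelDomain K ∧ IsParallelDomain L

/-- All cases of (3) of Theorem 5 together. -/
def Theorem5Cases (K L : Set X) : Prop :=
  CaseA K L ∨ CaseB K L ∨ CaseC K L ∨ CaseD K L ∨ CaseE K L

/-- Condition (1) of Theorem 5: every intersection of congruent copies admits some
non-trivial congruence. -/
def T5Cond1 (K L : Set X) : Prop :=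
  ∀ φ ψ : X ≃ᵢ X, OrientationPreserving φ → OrientationPreserving ψ →
    (interior ((⇑φ '' K) ∩ (⇑ψ '' L))).Nonempty →
    AdmitsNontrivialCongruence ((⇑φ '' K) ∩ (⇑ψ '' L))

/-- Condition (2) of Theorem 5: every intersection of congruent copies is axially
symmetric. -/
def T5Cond2 (K L : Set X) : Prop :=
  ∀ φ ψ : X ≃ᵢ X, OrientationPreserving φ → OrientationPreserving ψ →
    (interior ((⇑φ '' K) ∩ (⇑ψ '' L))).Nonempty →
    AxiallySymmetric ((⇑φ '' K) ∩ (⇑ψ '' L))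

/-- All connected components of the boundary of `K` are hypercycles or straight lines. -/
def BdryHypOrLine (K : Set X) : Prop :=
  ∀ x ∈ frontier K, IsHypercycleOrLine (connectedComponentIn (frontier K) x)

/-- The boundary of `K` has at least two connected components. -/
def AtLeastTwoComponents (K : Set X) : Prop :=
  ∃ x ∈ frontier K, ∃ y ∈ frontier K,
    connectedComponentIn (frontier K) x ≠ connectedComponentIn (frontier K) y

/-- The boundary of `K` is nonempty and has a single connected component. -/
def SingleComponent (K : Set X) : Prop :=
  (frontier K).Nonempty ∧ ∀ x ∈ frontier K, ∀ y ∈ frontier K,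
    connectedComponentIn (frontier K) x = connectedComponentIn (frontier K) y

/-- The associated graph of `K` contains two edges with at least one common endpoint:
`K` has two distinct boundary components which are asymptotic (come arbitrarily close). -/
def TwoAsymptoticComponents (K : Set X) : Prop :=
  ∃ x ∈ frontier K, ∃ y ∈ frontier K,
    connectedComponentIn (frontier K) x ≠ connectedComponentIn (frontier K) y ∧
    ∀ δ > (0 : ℝ), ∃ p ∈ connectedComponentIn (frontier K) x,
      ∃ q ∈ connectedComponentIn (frontier K) y, dist p q < δ

/-- The associated graph of `K` has only pairwise vertex-disjoint edges: distinct
boundary components of `K` stay at positive distance from each other. -/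
def VertexDisjointEdges (K : Set X) : Prop :=
  ∀ x ∈ frontier K, ∀ y ∈ frontier K,
    connectedComponentIn (frontier K) x ≠ connectedComponentIn (frontier K) y →
      ∃ δ > (0 : ℝ), ∀ p ∈ connectedComponentIn (frontier K) x,
        ∀ q ∈ connectedComponentIn (frontier K) y, δ ≤ dist p q

/-! Conditions of Theorem 6. -/

/-- Condition (1) of Theorem 6. -/
def T6Cond1 (K L : Set X) : Prop :=
  ∃ ε > (0 : ℝ), ∀ φ ψ : X ≃ᵢ X, OrientationPreserving φ → OrientationPreserving ψ →
    (interior ((⇑φ '' K) ∩ (⇑ψ '' L))).Nonempty →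
    diam ((⇑φ '' K) ∩ (⇑ψ '' L)) < ε →
    CentrallySymmetric ((⇑φ '' K) ∩ (⇑ψ '' L))

/-- Condition (2) of Theorem 6. -/
def T6Cond2 (K L : Set X) : Prop :=
  ∀ x ∈ frontier K, ∀ y ∈ frontier L, ∃ ε > (0 : ℝ),
    ∀ φ ψ : X ≃ᵢ X, OrientationPreserving φ → OrientationPreserving ψ →
      (interior ((⇑φ '' K) ∩ (⇑ψ '' L))).Nonempty →
      diam ((⇑φ '' K) ∩ (⇑ψ '' L)) < ε →
      ∀ (p : X) (r : ℝ), HasUniqueInball ((⇑φ '' K) ∩ (⇑ψ '' L)) p r →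
        frontier ((⇑φ '' K) ∩ (⇑ψ '' L)) ∩ sphere p r = {φ x, ψ y} →
        φ x ∈ interior (⇑ψ '' L) → ψ y ∈ interior (⇑φ '' K) →
        IsMidpoint p (φ x) (ψ y) →
        CentrallySymmetric ((⇑φ '' K) ∩ (⇑ψ '' L))

/-- Condition (3) of Theorem 6. -/
def T6Cond3 (K L : Set X) : Prop :=
  ∀ x ∈ frontier K, ∀ y ∈ frontier L, ∃ ε > (0 : ℝ),
    ∀ φ ψ : X ≃ᵢ X, OrientationPreserving φ → OrientationPreserving ψ →
      (interior ((⇑φ '' K) ∩ (⇑ψ '' L))).Nonempty →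
      diam ((⇑φ '' K) ∩ (⇑ψ '' L)) < ε →
      ∀ (p : X) (r : ℝ), HasUniqueInball ((⇑φ '' K) ∩ (⇑ψ '' L)) p r →
        frontier ((⇑φ '' K) ∩ (⇑ψ '' L)) ∩ sphere p r = {φ x, ψ y} →
        φ x ∈ interior (⇑ψ '' L) → ψ y ∈ interior (⇑φ '' K) →
        IsMidpoint p (φ x) (ψ y) →
        SymmetricWrtPerpBisector ((⇑φ '' K) ∩ (⇑ψ '' L)) (φ x) (ψ y)

/-- Condition (4) of Theorem 6. -/
def T6Cond4 (d : ℕ) (K L : Set X) : Prop :=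
  (∃ r > (0 : ℝ), (IsSphereSpace X d → r ≤ Real.pi / 2) ∧
      (∀ C ∈ bdryComponents K ∪ bdryComponents L, ∃ p : X, C = sphere p r) ∧
      (∃ p : X, K = closedBall p r) ∧ ∃ q : X, L = closedBall q r) ∨
  ((∀ C ∈ bdryComponents K ∪ bdryComponents L, IsParasphere C) ∧
      IsParaball K ∧ IsParaball L) ∨
  (∃ lam > (0 : ℝ), ∀ C ∈ bdryComponents K ∪ bdryComponents L, IsHypersphere C lam)

/-! Conditions of Theorems 7 and 8. -/

/-- The pair `φ, ψ` is admissible for hypothesis (****): both are orientation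
preserving, and for the sphere `(φ K) ∪ (ψ L)` lies in an open hemisphere. -/
def GoodPair (d : ℕ) (K L : Set X) (φ ψ : X ≃ᵢ X) : Prop :=
  OrientationPreserving φ ∧ OrientationPreserving ψ ∧
    (IsSphereSpace X d → ∃ s : X, (⇑φ '' K) ∪ (⇑ψ '' L) ⊆ ball s (Real.pi / 2))

/-- The convex hull of the union of the two congruent copies. -/
def hullUnion (K L : Set X) (φ ψ : X ≃ᵢ X) : Set X := gconvexHull ((⇑φ '' K) ∪ (⇑ψ '' L))

/-- Condition (A) of (3) of Theorem 7: the diameter of `M` is sufficiently close to `π`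
(sphere), resp. sufficiently large (Euclidean, hyperbolic), as measured by `δ`. -/
def BigDiam (d : ℕ) (X : Type*) [MetricSpace X] (M : Set X) (δ : ℝ) : Prop :=
  (IsSphereSpace X d → Real.pi - δ < diam M) ∧ (¬ IsSphereSpace X d → 1 / δ < diam M)

/-- Condition (1) of Theorem 7. -/
def T7Cond1 (d : ℕ) (K L : Set X) : Prop :=
  ∀ φ ψ : X ≃ᵢ X, GoodPair d K L φ ψ → CentrallySymmetric (hullUnion K L φ ψ)

/-- Condition (2) of Theorem 7. -/
def T7Cond2 (d : ℕ) (K L : Set X) : Prop :=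
  ∀ φ ψ : X ≃ᵢ X, GoodPair d K L φ ψ → ∀ a b : X, UniqueDiametral (hullUnion K L φ ψ) a b →
    SymmetricWrtPerpBisector (hullUnion K L φ ψ) a b

/-- Condition (3) of Theorem 7. -/
def T7Cond3 (d : ℕ) (K L : Set X) : Prop :=
  ∃ δ > (0 : ℝ), ∀ φ ψ : X ≃ᵢ X, GoodPair d K L φ ψ →
    ∀ x ∈ frontier K, ∀ y ∈ frontier L,
      BigDiam d X (hullUnion K L φ ψ) δ →
      UniqueDiametral (hullUnion K L φ ψ) (φ x) (ψ y) →
      CentrallySymmetric (hullUnion K L φ ψ)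

/-- Condition (4) of Theorem 7. -/
def T7Cond4 (d : ℕ) (K L : Set X) : Prop :=
  ∃ δ > (0 : ℝ), ∀ φ ψ : X ≃ᵢ X, GoodPair d K L φ ψ →
    ∀ x ∈ frontier K, ∀ y ∈ frontier L,
      BigDiam d X (hullUnion K L φ ψ) δ →
      UniqueDiametral (hullUnion K L φ ψ) (φ x) (ψ y) →
      SymmetricWrtPerpBisector (hullUnion K L φ ψ) (φ x) (ψ y)

/-- Condition (5) of Theorem 7. -/
def T7Cond5 (d : ℕ) (K L : Set X) : Prop :=
  ∃ δ > (0 : ℝ), ∀ φ ψ : X ≃ᵢ X, GoodPair d K L φ ψ →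
    ∀ x ∈ frontier K, ∀ y ∈ frontier L,
      BigDiam d X (hullUnion K L φ ψ) δ →
      UniqueDiametral (hullUnion K L φ ψ) (φ x) (ψ y) →
      ∃ ε₀ > (0 : ℝ), ∀ ε : ℝ, 0 < ε → ε < ε₀ →
        (IsSphereSpace X d → ∃ s : X, (⇑φ '' K) ∪ (⇑ψ '' L) ⊆ ball s (Real.pi / 2) ∧
            segCyl (φ x) (ψ y) ε ⊆ ball s (Real.pi / 2)) ∧
        CentrallySymmetric (hullUnion K L φ ψ ∩ segCyl (φ x) (ψ y) ε)

/-- Condition (6) of Theorem 7. -/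
def T7Cond6 (d : ℕ) (K L : Set X) : Prop :=
  ∃ δ > (0 : ℝ), ∀ φ ψ : X ≃ᵢ X, GoodPair d K L φ ψ →
    ∀ x ∈ frontier K, ∀ y ∈ frontier L,
      BigDiam d X (hullUnion K L φ ψ) δ →
      UniqueDiametral (hullUnion K L φ ψ) (φ x) (ψ y) →
      ∃ ε₀ > (0 : ℝ), ∀ ε : ℝ, 0 < ε → ε < ε₀ →
        (IsSphereSpace X d → ∃ s : X, (⇑φ '' K) ∪ (⇑ψ '' L) ⊆ ball s (Real.pi / 2) ∧
            segCyl (φ x) (ψ y) ε ⊆ ball s (Real.pi / 2)) ∧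
        SymmetricWrtPerpBisector (hullUnion K L φ ψ ∩ segCyl (φ x) (ψ y) ε) (φ x) (ψ y)

/-- Condition (7) of Theorem 7: `K` and `L` are congruent balls. -/
def T7Cond7 (d : ℕ) (K L : Set X) : Prop :=
  ∃ r > (0 : ℝ), (IsSphereSpace X d → r < Real.pi / 2) ∧
    (∃ p : X, K = closedBall p r) ∧ ∃ q : X, L = closedBall q r

/-- Condition (1) of Theorem 8. -/
def T8Cond1 (K L : Set X) : Prop :=
  ∀ φ ψ : X ≃ᵢ X, GoodPair 2 K L φ ψ → AxiallySymmetric (hullUnion K L φ ψ)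

/-- Condition (2) of Theorem 8. -/
def T8Cond2 (K L : Set X) : Prop :=
  ∀ φ ψ : X ≃ᵢ X, GoodPair 2 K L φ ψ → AdmitsNontrivialCongruence (hullUnion K L φ ψ)

/-- Condition (3) of Theorem 8. -/
def T8Cond3 (K L : Set X) : Prop :=
  ∃ δ > (0 : ℝ), ∀ φ ψ : X ≃ᵢ X, GoodPair 2 K L φ ψ →
    ∀ x ∈ frontier K, ∀ y ∈ frontier L,
      BigDiam 2 X (hullUnion K L φ ψ) δ →
      UniqueDiametral (hullUnion K L φ ψ) (φ x) (ψ y) →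
      AxiallySymmetric (hullUnion K L φ ψ)

/-- Condition (4) of Theorem 8. -/
def T8Cond4 (K L : Set X) : Prop :=
  ∃ δ > (0 : ℝ), ∀ φ ψ : X ≃ᵢ X, GoodPair 2 K L φ ψ →
    ∀ x ∈ frontier K, ∀ y ∈ frontier L,
      BigDiam 2 X (hullUnion K L φ ψ) δ →
      UniqueDiametral (hullUnion K L φ ψ) (φ x) (ψ y) →
      AdmitsNontrivialCongruence (hullUnion K L φ ψ)

/-- Condition (5) of Theorem 8. -/
def T8Cond5 (K L : Set X) : Prop :=
  ∃ δ > (0 : ℝ), ∀ φ ψ : X ≃ᵢ X, GoodPair 2 K L φ ψ →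
    ∀ x ∈ frontier K, ∀ y ∈ frontier L,
      BigDiam 2 X (hullUnion K L φ ψ) δ →
      UniqueDiametral (hullUnion K L φ ψ) (φ x) (ψ y) →
      ∃ ε₀ > (0 : ℝ), ∀ ε : ℝ, 0 < ε → ε < ε₀ →
        (IsSphereSpace X 2 → ∃ s : X, (⇑φ '' K) ∪ (⇑ψ '' L) ⊆ ball s (Real.pi / 2) ∧
            segCyl (φ x) (ψ y) ε ⊆ ball s (Real.pi / 2)) ∧
        AxiallySymmetric (hullUnion K L φ ψ ∩ segCyl (φ x) (ψ y) ε)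

/-- Condition (6) of Theorem 8. -/
def T8Cond6 (K L : Set X) : Prop :=
  ∃ δ > (0 : ℝ), ∀ φ ψ : X ≃ᵢ X, GoodPair 2 K L φ ψ →
    ∀ x ∈ frontier K, ∀ y ∈ frontier L,
      BigDiam 2 X (hullUnion K L φ ψ) δ →
      UniqueDiametral (hullUnion K L φ ψ) (φ x) (ψ y) →
      ∃ ε₀ > (0 : ℝ), ∀ ε : ℝ, 0 < ε → ε < ε₀ →
        (IsSphereSpace X 2 → ∃ s : X, (⇑φ '' K) ∪ (⇑ψ '' L) ⊆ ball s (Real.pi / 2) ∧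
            segCyl (φ x) (ψ y) ε ⊆ ball s (Real.pi / 2)) ∧
        AdmitsNontrivialCongruence (hullUnion K L φ ψ ∩ segCyl (φ x) (ψ y) ε)

/-- Condition (7) of Theorem 8: `K` and `L` are (in general incongruent) circles. -/
def T8Cond7 (K L : Set X) : Prop :=
  ∃ (p q : X) (r s : ℝ), 0 < r ∧ 0 < s ∧
    (IsSphereSpace X 2 → r < Real.pi / 2 ∧ s < Real.pi / 2) ∧
    K = closedBall p r ∧ L = closedBall q s

/-- The boundary of `K` locally coincides, at each of its points, with a sphere of
radius `r`. -/
def LocallySpherical (K : Set X) (r : ℝ) : Prop :=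
  ∀ x ∈ frontier K, ∃ U : Set X, IsOpen U ∧ x ∈ U ∧
    ∃ p : X, frontier K ∩ U = sphere p r ∩ U

/-! ### Generalized trigonometric functions -/

/-- The admissible normalized curvatures. -/
def IsCurv (k : ℝ) : Prop := k = 1 ∨ k = 0 ∨ k = -1

/-- The generalized sine of curvature `k`. -/
noncomputable def snK (k t : ℝ) : ℝ :=
  if k = 1 then Real.sin t else if k = 0 then t else Real.sinh t

/-- The generalized versine of curvature `k`. -/
noncomputable def vsK (k t : ℝ) : ℝ :=
  if k = 1 then 1 - Real.cos t else if k = 0 then t ^ 2 / 2 else Real.cosh t - 1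

/-- `t` is a possible distance in a space of curvature `k`. -/
def Adm (k t : ℝ) : Prop := 0 ≤ t ∧ (k = 1 → t ≤ Real.pi)

lemma snK_one (t : ℝ) : snK 1 t = Real.sin t := by simp [snK]
lemma snK_flat (t : ℝ) : snK 0 t = t := by simp [snK]
lemma snK_neg_one (t : ℝ) : snK (-1) t = Real.sinh t := by
  have : ¬ ((-1 : ℝ) = 1) := by norm_num
  simp [snK, this]
lemma vsK_one (t : ℝ) : vsK 1 t = 1 - Real.cos t := by simp [vsK]
lemma vsK_flat (t : ℝ) : vsK 0 t = t ^ 2 / 2 := by simp [vsK]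
lemma vsK_neg_one (t : ℝ) : vsK (-1) t = Real.cosh t - 1 := by
  have : ¬ ((-1 : ℝ) = 1) := by norm_num
  simp [vsK, this]

section Trigonometry

variable {k : ℝ}

lemma snK_zero (hk : IsCurv k) : snK k 0 = 0 := by
  rcases hk with rfl | rfl | rfl <;> simp [snK_one, snK_flat, snK_neg_one]

lemma vsK_zero (hk : IsCurv k) : vsK k 0 = 0 := by
  rcases hk with rfl | rfl | rfl <;> simp [vsK_one, vsK_flat, vsK_neg_one]

lemma continuous_snK (hk : IsCurv k) : Continuous (snK k) := by
  rcases hk with rfl | rfl | rfl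
  · rw [funext snK_one]; exact Real.continuous_sin
  · rw [funext snK_flat]; exact continuous_id
  · rw [funext snK_neg_one]; exact Real.continuous_sinh

lemma continuous_vsK (hk : IsCurv k) : Continuous (vsK k) := by
  rcases hk with rfl | rfl | rfl
  · rw [funext vsK_one]; fun_prop
  · rw [funext vsK_flat]; fun_prop
  · rw [funext vsK_neg_one]; exact Real.continuous_cosh.sub continuous_const

lemma snK_neg (hk : IsCurv k) (t : ℝ) : snK k (-t) = -snK k t := by
  rcases hk with rfl | rfl | rfl <;> simp [snK_one, snK_flat, snK_neg_one]

lemma vsK_neg (hk : IsCurv k) (t : ℝ) : vsK k (-t) = vsK k t := by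
  rcases hk with rfl | rfl | rfl <;> simp [vsK_one, vsK_flat, vsK_neg_one]

lemma snK_sq (hk : IsCurv k) (t : ℝ) : snK k t ^ 2 = 2 * vsK k t - k * vsK k t ^ 2 := by
  rcases hk with rfl | rfl | rfl <;> simp only [snK_one, snK_flat, snK_neg_one, vsK_one,
    vsK_flat, vsK_neg_one]
  · nlinarith [Real.sin_sq_add_cos_sq t]
  · ring
  · nlinarith [Real.cosh_sq t]

lemma vsK_add (hk : IsCurv k) (s t : ℝ) :
    vsK k (s + t) = vsK k s + vsK k t - k * vsK k s * vsK k t + snK k s * snK k t := by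
  rcases hk with rfl | rfl | rfl <;> simp only [snK_one, snK_flat, snK_neg_one, vsK_one,
    vsK_flat, vsK_neg_one]
  · rw [Real.cos_add]; ring
  · ring
  · rw [Real.cosh_add]; ring

lemma vsK_sub (hk : IsCurv k) (s t : ℝ) :
    vsK k (s - t) = vsK k s + vsK k t - k * vsK k s * vsK k t - snK k s * snK k t := by
  rw [sub_eq_add_neg, vsK_add hk, snK_neg hk, vsK_neg hk]; ring

lemma snK_add (hk : IsCurv k) (s t : ℝ) :
    snK k (s + t) = snK k s * (1 - k * vsK k t) + (1 - k * vsK k s) * snK k t := by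
  rcases hk with rfl | rfl | rfl <;> simp only [snK_one, snK_flat, snK_neg_one, vsK_one,
    vsK_flat, vsK_neg_one]
  · rw [Real.sin_add]; ring
  · ring
  · rw [Real.sinh_add]; ring

lemma snK_pos (hk : IsCurv k) {t : ℝ} (ht : 0 < t) (h : k = 1 → t < Real.pi) :
    0 < snK k t := by
  rcases hk with rfl | rfl | rfl <;> simp only [snK_one, snK_flat, snK_neg_one]
  · exact Real.sin_pos_of_pos_of_lt_pi ht (h rfl)
  · exact ht
  · exact Real.sinh_pos_iff.2 ht

lemma snK_nonneg (hk : IsCurv k) {t : ℝ} (ht : Adm k t) : 0 ≤ snK k t := by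
  rcases hk with rfl | rfl | rfl <;> simp only [snK_one, snK_flat, snK_neg_one]
  · exact Real.sin_nonneg_of_nonneg_of_le_pi ht.1 (ht.2 rfl)
  · exact ht.1
  · exact Real.sinh_nonneg_iff.2 ht.1

lemma vsK_lt (hk : IsCurv k) {s t : ℝ} (hs : 0 ≤ s) (ht : Adm k t) (h : s < t) :
    vsK k s < vsK k t := by
  rcases hk with rfl | rfl | rfl <;> simp only [vsK_one, vsK_flat, vsK_neg_one]
  · have := Real.cos_lt_cos_of_nonneg_of_le_pi hs (ht.2 rfl) h
    linarith
  · nlinarith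
  · have : Real.cosh s < Real.cosh t := by
      rw [Real.cosh_lt_cosh, abs_of_nonneg hs, abs_of_nonneg ht.1]; exact h
    linarith

lemma vsK_le (hk : IsCurv k) {s t : ℝ} (hs : 0 ≤ s) (ht : Adm k t) (h : s ≤ t) :
    vsK k s ≤ vsK k t := by
  rcases h.eq_or_lt with rfl | h
  · exact le_rfl
  · exact (vsK_lt hk hs ht h).le

lemma vsK_lt_iff (hk : IsCurv k) {s t : ℝ} (hs : Adm k s) (ht : Adm k t) :
    vsK k s < vsK k t ↔ s < t := by
  refine ⟨fun h => ?_, vsK_lt hk hs.1 ht⟩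
  by_contra! h'
  exact absurd (vsK_le hk ht.1 hs h') (not_le.2 h)

lemma vsK_le_iff (hk : IsCurv k) {s t : ℝ} (hs : Adm k s) (ht : Adm k t) :
    vsK k s ≤ vsK k t ↔ s ≤ t := by
  rw [← not_lt, vsK_lt_iff hk ht hs, not_lt]

lemma vsK_inj (hk : IsCurv k) {s t : ℝ} (hs : Adm k s) (ht : Adm k t)
    (h : vsK k s = vsK k t) : s = t :=
  le_antisymm ((vsK_le_iff hk hs ht).1 h.le) ((vsK_le_iff hk ht hs).1 h.ge)

lemma vsK_nonneg (hk : IsCurv k) (t : ℝ) : 0 ≤ vsK k t := by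
  rcases hk with rfl | rfl | rfl <;> simp only [vsK_one, vsK_flat, vsK_neg_one]
  · linarith [Real.cos_le_one t]
  · positivity
  · linarith [Real.one_le_cosh t]

lemma adm_zero : Adm k 0 := ⟨le_rfl, fun _ => Real.pi_pos.le⟩

lemma vsK_pos (hk : IsCurv k) {t : ℝ} (ht : Adm k t) (h : 0 < t) : 0 < vsK k t := by
  have := vsK_lt hk le_rfl ht h
  rwa [vsK_zero hk] at this

/-- The generalized cosine is positive below a quarter turn. -/
lemma csK_pos (hk : IsCurv k) {t : ℝ} (ht : 0 ≤ t) (h : k = 1 → t < Real.pi / 2) :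
    0 < 1 - k * vsK k t := by
  rcases hk with rfl | rfl | rfl <;> simp only [vsK_one, vsK_flat, vsK_neg_one]
  · have := Real.cos_pos_of_mem_Ioo (x := t) ⟨by linarith [Real.pi_pos], h rfl⟩
    linarith
  · norm_num
  · linarith [Real.one_le_cosh t]

lemma exists_vsK_eq (hk : IsCurv k) {w : ℝ} (hw : 0 ≤ w) (h : 0 ≤ 2 * w - k * w ^ 2) :
    ∃ t, Adm k t ∧ vsK k t = w := by
  rcases hk with rfl | rfl | rfl <;> simp only [vsK_one, vsK_flat, vsK_neg_one]
  · have h2 : w ≤ 2 := by nlinarith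
    refine ⟨Real.arccos (1 - w), ⟨Real.arccos_nonneg _, fun _ => Real.arccos_le_pi _⟩, ?_⟩
    rw [Real.cos_arccos (by linarith) (by linarith)]; ring
  · refine ⟨Real.sqrt (2 * w), ⟨Real.sqrt_nonneg _, fun h => absurd h (by norm_num)⟩, ?_⟩
    rw [Real.sq_sqrt (by linarith)]; ring
  · refine ⟨Real.arsinh (Real.sqrt (2 * w + w ^ 2)),
      ⟨Real.arsinh_nonneg_iff.2 (Real.sqrt_nonneg _), fun h => absurd h (by norm_num)⟩, ?_⟩
    rw [Real.cosh_arsinh, Real.sq_sqrt (by positivity),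
      show 1 + (2 * w + w ^ 2) = (1 + w) ^ 2 by ring, Real.sqrt_sq (by linarith)]
    ring

/-- The generalized half-angle quotient, in product form. -/
lemma vsK_lt_mul_snK (hk : IsCurv k) {c : ℝ} (hc : 0 < c) :
    ∀ᶠ t in nhdsWithin (0 : ℝ) (Ioi 0), vsK k t < c * snK k t := by
  have h1 : ∀ᶠ t in nhdsWithin (0 : ℝ) (Ioi 0), snK k t < c := by
    have : Tendsto (snK k) (nhdsWithin 0 (Ioi 0)) (nhds (snK k 0)) :=
      (continuous_snK hk).continuousAt.tendsto.mono_left nhdsWithin_le_nhds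
    rw [snK_zero hk] at this
    exact this.eventually_lt_const hc
  have h2 : ∀ᶠ t in nhdsWithin (0 : ℝ) (Ioi 0), t < Real.pi / 2 :=
    nhdsWithin_le_nhds (eventually_lt_nhds (by positivity))
  filter_upwards [h1, h2, self_mem_nhdsWithin] with t h1 h2 (h3 : 0 < t)
  have hs : 0 < snK k t := snK_pos hk h3 fun _ => by linarith [Real.pi_pos]
  have hcs := csK_pos hk h3.le fun _ => h2
  have hv := vsK_nonneg hk t
  have hsq := snK_sq hk t
  have : vsK k t ≤ snK k t ^ 2 := by rw [hsq]; nlinarith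
  nlinarith

end Trigonometry

section Charts

open scoped RealInnerProductSpace

variable {k : ℝ} {E : Type*} [NormedAddCommGroup E] [InnerProductSpace ℝ E]

/-- The versine of the distance. -/
noncomputable def vd (k : ℝ) (p q : X) : ℝ := vsK k (dist p q)

/-- A chart `ξ` at `z`: the point at distance `t` from `z` in direction `θ`
has coordinate `snK k t • θ`, and the law of cosines holds. -/
structure IsChart (k : ℝ) (z : X) (ξ : X → E) : Prop where
  law : ∀ p q, vd k p q = vd k z p + vd k z q - k * vd k z p * vd k z q - ⟪ξ p, ξ q⟫
  surj : ∀ (θ : E) (t : ℝ), ‖θ‖ = 1 → Adm k t → ∃ p, dist z p = t ∧ ξ p = snK k t • θ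

/-- A space form of curvature `k` modelled on `E`: it has a chart somewhere. -/
structure HasCharts (k : ℝ) (X : Type*) [MetricSpace X] (E : Type*) [NormedAddCommGroup E]
    [InnerProductSpace ℝ E] : Prop where
  curv : IsCurv k
  diam_le : k = 1 → ∀ p q : X, dist p q ≤ Real.pi
  dim : 2 ≤ Module.finrank ℝ E
  exists_chart : ∃ (z : X) (ξ : X → E), IsChart k z ξ

namespace HasCharts

variable (H : HasCharts k X E)
include H

lemma adm (p q : X) : Adm k (dist p q) := ⟨dist_nonneg, fun h => H.diam_le h p q⟩

lemma vd_self (p : X) : vd k p p = 0 := by simp [vd, vsK_zero H.curv]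

lemma vd_nonneg (p q : X) : 0 ≤ vd k p q := vsK_nonneg H.curv _

lemma vd_eq_zero {p q : X} : vd k p q = 0 ↔ p = q := by
  constructor
  · intro h
    have := vsK_inj H.curv (H.adm p q) adm_zero (by rw [vsK_zero H.curv]; exact h)
    exact dist_eq_zero.1 this
  · rintro rfl; exact H.vd_self p

lemma vd_pos {p q : X} (h : p ≠ q) : 0 < vd k p q :=
  lt_of_le_of_ne (H.vd_nonneg p q) (fun h' => h (H.vd_eq_zero.1 h'.symm))

lemma vd_le_iff {p q : X} {r : ℝ} (hr : Adm k r) : vd k p q ≤ vsK k r ↔ dist p q ≤ r :=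
  vsK_le_iff H.curv (H.adm p q) hr

lemma vd_lt_iff {p q : X} {r : ℝ} (hr : Adm k r) : vd k p q < vsK k r ↔ dist p q < r :=
  vsK_lt_iff H.curv (H.adm p q) hr

lemma vd_eq_iff {p q : X} {r : ℝ} (hr : Adm k r) : vd k p q = vsK k r ↔ dist p q = r :=
  ⟨fun h => vsK_inj H.curv (H.adm p q) hr h, fun h => by rw [vd, h]⟩

lemma vd_inj {p q p' q' : X} : vd k p q = vd k p' q' ↔ dist p q = dist p' q' :=
  H.vd_eq_iff (H.adm p' q')

lemma vd_le_vd {p q p' q' : X} : vd k p q ≤ vd k p' q' ↔ dist p q ≤ dist p' q' :=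
  H.vd_le_iff (H.adm p' q')

lemma cont_vd {Y : Type*} [TopologicalSpace Y] {f g : Y → X}
    (hf : Continuous f) (hg : Continuous g) : Continuous fun y => vd k (f y) (g y) :=
  (continuous_vsK H.curv).comp (hf.dist hg)

lemma tendsto_of_vd {ι : Type*} {l : Filter ι} {f : ι → X} {p : X}
    (h : Tendsto (fun i => vd k (f i) p) l (nhds 0)) : Tendsto f l (nhds p) := by
  rw [Metric.tendsto_nhds]
  intro ε hε
  have hadm : Adm k (min ε 1) :=
    ⟨by positivity, fun _ => (min_le_right _ _).trans (by linarith [Real.pi_gt_three])⟩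
  have h0 : 0 < vsK k (min ε 1) := vsK_pos H.curv hadm (by positivity)
  filter_upwards [h.eventually_lt_const h0] with i hi
  exact ((H.vd_lt_iff hadm).1 hi).trans_le (min_le_left _ _)

lemma exists_unit : ∃ θ : E, ‖θ‖ = 1 := by
  have : 0 < Module.finrank ℝ E := by linarith [H.dim]
  have := Module.nontrivial_of_finrank_pos this
  exact exists_norm_eq E zero_le_one

end HasCharts

lemma vd_comm (k : ℝ) (p q : X) : vd k p q = vd k q p := by rw [vd, vd, dist_comm]

namespace IsChart

variable {z : X} {ξ : X → E} (h : IsChart k z ξ) (H : HasCharts k X E)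
include h H

lemma inner_self (p : X) : ⟪ξ p, ξ p⟫ = 2 * vd k z p - k * vd k z p ^ 2 := by
  have := h.law p p
  rw [H.vd_self] at this
  linarith

lemma norm_eq (p : X) : ‖ξ p‖ = snK k (dist z p) := by
  have h1 := h.inner_self H p
  rw [real_inner_self_eq_norm_sq, vd, ← snK_sq H.curv] at h1
  exact (sq_eq_sq₀ (norm_nonneg _) (snK_nonneg H.curv (H.adm _ _))).1 h1

lemma map_base : ξ z = 0 := by
  rw [← norm_eq_zero, h.norm_eq H, dist_self, snK_zero H.curv]

lemma ext {p q : X} (h1 : ξ p = ξ q) (h2 : vd k z p = vd k z q) : p = q := by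
  rw [← H.vd_eq_zero, h.law, h1, h.inner_self H, h2]; ring

lemma exists_pt {ζ : E} {w : ℝ} (hw : 0 ≤ w) (hz : ⟪ζ, ζ⟫ = 2 * w - k * w ^ 2) :
    ∃ p, vd k z p = w ∧ ξ p = ζ := by
  obtain ⟨t, ht, htw⟩ := exists_vsK_eq H.curv hw (by rw [← hz]; exact real_inner_self_nonneg)
  have hn : ‖ζ‖ = snK k t := by
    rw [real_inner_self_eq_norm_sq, ← htw, ← snK_sq H.curv] at hz
    exact (sq_eq_sq₀ (norm_nonneg _) (snK_nonneg H.curv ht)).1 hz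
  obtain ⟨θ, hθ, hθζ⟩ : ∃ θ : E, ‖θ‖ = 1 ∧ ζ = ‖ζ‖ • θ := by
    by_cases h0 : ζ = 0
    · obtain ⟨θ, hθ⟩ := H.exists_unit
      exact ⟨θ, hθ, by simp [h0]⟩
    · have : ‖ζ‖ ≠ 0 := norm_ne_zero_iff.2 h0
      exact ⟨‖ζ‖⁻¹ • ζ, by rw [norm_smul]; simp [this], by rw [smul_smul, mul_inv_cancel₀ this, one_smul]⟩
  obtain ⟨p, hp, hp'⟩ := h.surj θ t hθ ht
  exact ⟨p, by rw [vd, hp, htw], by rw [hp', ← hn, ← hθζ]⟩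

lemma norm_sub_sq (p q : X) : ‖ξ p - ξ q‖ ^ 2 = 2 * vd k p q - k * (vd k z p - vd k z q) ^ 2 := by
  rw [← real_inner_self_eq_norm_sq, inner_sub_left, inner_sub_right, inner_sub_right,
    h.inner_self H, h.inner_self H, real_inner_comm (ξ p) (ξ q)]
  have := h.law p q
  linarith

lemma continuous : Continuous ξ := by
  rw [continuous_iff_continuousAt]
  intro q
  rw [ContinuousAt, tendsto_iff_norm_sub_tendsto_zero]
  have : Tendsto (fun p => ‖ξ p - ξ q‖ ^ 2) (nhds q) (nhds 0) := by
    simp_rw [h.norm_sub_sq H]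
    have hc : Continuous fun p => 2 * vd k p q - k * (vd k z p - vd k z q) ^ 2 := by
      have := H.cont_vd continuous_id (continuous_const (y := q))
      have := H.cont_vd (continuous_const (y := z)) continuous_id
      simp only [id] at *
      fun_prop
    have := hc.tendsto q
    simpa [H.vd_self] using this
  have := this.sqrt
  simpa using this

lemma exists_geod {θ : E} (hθ : ‖θ‖ = 1) : ∃ γ : ℝ → X, Continuous γ ∧ γ 0 = z ∧
    (∀ t, vd k z (γ t) = vsK k t) ∧ (∀ t, ξ (γ t) = snK k t • θ) ∧
    (∀ s t, vd k (γ s) (γ t) = vsK k (s - t)) ∧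
    (∀ s t, (k = 1 → |s - t| ≤ Real.pi) → dist (γ s) (γ t) = |s - t|) := by
  have hex : ∀ t, ∃ p, vd k z p = vsK k t ∧ ξ p = snK k t • θ := fun t =>
    h.exists_pt H (vsK_nonneg H.curv t) (by
      rw [real_inner_self_eq_norm_sq, norm_smul, hθ, ← snK_sq H.curv]; simp)
  choose γ h1 h2 using hex
  have h3 : ∀ s t, vd k (γ s) (γ t) = vsK k (s - t) := by
    intro s t
    rw [h.law, h1, h1, h2, h2, vsK_sub H.curv, real_inner_smul_left, real_inner_smul_right,
      real_inner_self_eq_norm_sq, hθ]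
    ring
  refine ⟨γ, ?_, ?_, h1, h2, h3, ?_⟩
  · rw [continuous_iff_continuousAt]
    intro t
    apply H.tendsto_of_vd
    simp_rw [h3]
    have : Continuous fun s => vsK k (s - t) := (continuous_vsK H.curv).comp (by fun_prop)
    have := this.tendsto t
    simpa [vsK_zero H.curv] using this
  · apply h.ext H
    · rw [h2, h.map_base H, snK_zero H.curv, zero_smul]
    · rw [h1, H.vd_self, vsK_zero H.curv]
  · intro s t hst
    have : Adm k |s - t| := ⟨abs_nonneg _, hst⟩
    rw [← H.vd_eq_iff this, h3]
    rcases abs_choice (s - t) with h' | h' <;> rw [h']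
    rw [vsK_neg H.curv]

end IsChart

lemma neg_curv_aux {E : Type*} [NormedAddCommGroup E] [InnerProductSpace ℝ E] {w w' : ℝ}
    {ζ ζ' : E} (hw : w ≤ -2) (hw' : 0 ≤ w') (h1 : ⟪ζ, ζ⟫ = 2 * w + w ^ 2)
    (h2 : ⟪ζ', ζ'⟫ = 2 * w' + w' ^ 2) : w + w' + w * w' - ⟪ζ, ζ'⟫ < 0 := by
  have hcs := real_inner_mul_inner_self_le ζ ζ'
  rw [h1, h2] at hcs
  by_contra hcon
  push Not at hcon
  have h3 : -⟪ζ, ζ'⟫ ≥ -(w + 1) * (w' + 1) + 1 := by nlinarith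
  have h4 : 1 ≤ -(w + 1) * (w' + 1) := by nlinarith
  nlinarith [mul_self_le_mul_self (by linarith : (0:ℝ) ≤ -(w + 1) * (w' + 1) + 1) h3, sq_nonneg (w+1), sq_nonneg (w'+1)]

namespace IsChart

lemma exists_reflection {z : X} {ξ : X → E} (h : IsChart k z ξ) (H : HasCharts k X E)
    {u v : X} (huv : u ≠ v) : ∃ ρ : X ≃ᵢ X, IsReflection ρ ∧ ρ u = v ∧ ρ v = u ∧
      (∀ x, ρ (ρ x) = x) ∧ (∀ x, dist x u = dist x v → ρ x = x) ∧
      (∀ x, ∃ l : ℝ, ξ (ρ x) = ξ x + l • (ξ u - ξ v)) := by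
  set D := vd k u v with hD
  have hDpos : 0 < D := H.vd_pos huv
  have hD' : vd k v u = D := vd_comm _ _ _
  set lam : X → ℝ := fun x => (vd k x u - vd k x v) / D with hlam
  have hlamD : ∀ x, lam x * D = vd k x u - vd k x v := fun x => div_mul_cancel₀ _ hDpos.ne'
  have key : ∀ x, ∃ x', ξ x' = ξ x + lam x • (ξ u - ξ v) ∧
      ∀ y, vd k x' y = vd k x y + lam x * lam y * D := by
    intro x
    have lxu := h.law x u
    have lxv := h.law x v
    have luv := h.law u v
    have lx := h.inner_self H x
    have lu := h.inner_self H u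
    have lv := h.inner_self H v
    have lvu := real_inner_comm (ξ u) (ξ v)
    have lux := real_inner_comm (ξ x) (ξ u)
    have lvx := real_inner_comm (ξ x) (ξ v)
    have e1 := hlamD x
    set w' := vd k z x + lam x * (vd k z u - vd k z v) with hw'
    have hz : ⟪ξ x + lam x • (ξ u - ξ v), ξ x + lam x • (ξ u - ξ v)⟫ = 2 * w' - k * w' ^ 2 := by
      simp only [inner_add_left, inner_add_right, inner_sub_left, inner_sub_right,
        real_inner_smul_left, real_inner_smul_right]
      rw [lux, lvx, lvu, lx, lu, lv]
      have a1 : ⟪ξ x, ξ u⟫ = vd k z x + vd k z u - k * vd k z x * vd k z u - vd k x u := by linarith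
      have a2 : ⟪ξ x, ξ v⟫ = vd k z x + vd k z v - k * vd k z x * vd k z v - vd k x v := by linarith
      have a3 : ⟪ξ u, ξ v⟫ = vd k z u + vd k z v - k * vd k z u * vd k z v - D := by linarith
      rw [a1, a2, a3, hw']
      linear_combination (-2 * lam x) * (-e1)
    have hw0 : 0 ≤ w' := by
      have hnn : 0 ≤ 2 * w' - k * w' ^ 2 := by rw [← hz]; exact real_inner_self_nonneg
      rcases H.curv with hk | hk | hk
      · subst hk; nlinarith
      · subst hk; linarith
      · subst hk
        by_contra hneg
        push Not at hneg
        have hle : w' ≤ -2 := by nlinarith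
        have := neg_curv_aux hle (H.vd_nonneg z v) (by rw [hz]; ring)
          (by rw [lv]; ring : ⟪ξ v, ξ v⟫ = _)
        have h0 := H.vd_nonneg x u
        simp only [inner_add_left, inner_sub_left, real_inner_smul_left] at this
        rw [lv] at this
        have a2 : ⟪ξ x, ξ v⟫ = vd (-1) z x + vd (-1) z v - (-1) * vd (-1) z x * vd (-1) z v - vd (-1) x v := by linarith
        have a3 : ⟪ξ u, ξ v⟫ = vd (-1) z u + vd (-1) z v - (-1) * vd (-1) z u * vd (-1) z v - D := by linarith
        rw [a2, a3, hw'] at this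
        have : vd (-1) x u < 0 := by linear_combination this + (-e1)
        linarith
    obtain ⟨x', hx1, hx2⟩ := h.exists_pt H hw0 hz
    refine ⟨x', hx2, fun y => ?_⟩
    have lyu := h.law y u
    have lyv := h.law y v
    have lxy := h.law x y
    have e2 := hlamD y
    have b1 := real_inner_comm (ξ y) (ξ u)
    have b2 := real_inner_comm (ξ y) (ξ v)
    rw [h.law, hx1, hx2, inner_add_left, real_inner_smul_left, inner_sub_left, b1, b2, hw']
    linear_combination (-lam x) * e2 + (-1) * lxy + (lam x) * lyv - lam x * lyu
  choose ρ hρξ hρ using key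
  have lamu : lam u = -1 := by
    simp only [hlam]; rw [H.vd_self, ← hD]; field_simp; ring
  have lamv : lam v = 1 := by
    simp only [hlam]; rw [H.vd_self, hD']; field_simp; ring
  have lamρ : ∀ x, lam (ρ x) = - lam x := by
    intro x
    have := hlamD (ρ x)
    rw [hρ, hρ, lamu, lamv] at this
    have h2 := hlamD x
    have : lam (ρ x) * D = -lam x * D := by rw [this]; linear_combination -h2
    exact mul_right_cancel₀ hDpos.ne' this
  have inv : ∀ x, ρ (ρ x) = x := by
    intro x
    rw [← H.vd_eq_zero, hρ, hρ, lamρ, H.vd_self]; ring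
  have iso : ∀ x y, dist (ρ x) (ρ y) = dist x y := by
    intro x y
    rw [← H.vd_inj, hρ, vd_comm, hρ, lamρ, vd_comm k y x]; ring
  have fixed_iff : ∀ x, ρ x = x ↔ lam x = 0 := by
    intro x
    constructor
    · intro hx
      have := lamρ x
      rw [hx] at this
      linarith
    · intro hx
      rw [← H.vd_eq_zero, hρ, hx, H.vd_self]; ring
  have ρu : ρ u = v := by rw [← H.vd_eq_zero, hρ, lamu, lamv]; simp [hD]
  have ρv : ρ v = u := by rw [← ρu, inv]
  let R : X ≃ᵢ X := ⟨⟨ρ, ρ, inv, inv⟩, Isometry.of_dist_eq iso⟩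
  have hR : ∀ x, R x = ρ x := fun x => rfl
  have hneg : ∀ x, lam x < 0 ↔ vd k x u < vd k x v := fun x => by
    simp only [hlam]; rw [div_neg_iff]; constructor
    · rintro (h | h) <;> linarith
    · intro h; right; exact ⟨by linarith, hDpos⟩
  have hlc : Continuous lam := by
    have c1 := H.cont_vd continuous_id (continuous_const (y := u))
    have c2 := H.cont_vd continuous_id (continuous_const (y := v))
    exact (c1.sub c2).div_const _
  refine ⟨R, ⟨?_, ?_, ?_⟩, ρu, ρv, inv, ?_, fun x => ⟨lam x, hρξ x⟩⟩
  · ext x; exact inv x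
  · intro hc
    have : R u = u := by rw [hc]; rfl
    exact huv (by rw [← this, hR, ρu] )
  · intro hc
    have := hc {x | lam x < 0} {x | 0 < lam x} (isOpen_lt hlc continuous_const)
      (isOpen_lt continuous_const hlc) ?_ ⟨u, ?_, ?_⟩ ⟨v, ?_, ?_⟩
    · obtain ⟨x, -, hx1, hx2⟩ := this
      exact absurd hx1 (not_lt.2 (le_of_lt (show 0 < lam x from hx2)))
    · intro x hx
      have : lam x ≠ 0 := fun h0 => hx ((fixed_iff x).2 h0)
      rcases lt_or_gt_of_ne this with h | h
      · left; exact h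
      · right; exact h
    · change ρ u ≠ u; rw [ρu]; exact huv.symm
    · change lam u < 0; rw [lamu]; norm_num
    · change ρ v ≠ v; rw [ρv]; exact huv
    · change 0 < lam v; rw [lamv]; norm_num
  · intro x hx
    rw [hR, fixed_iff]
    have : vd k x u = vd k x v := H.vd_inj.2 hx
    simp [hlam, this]

lemma transfer {z : X} {ξ : X → E} (h : IsChart k z ξ) (H : HasCharts k X E) (z' : X) :
    ∃ ξ' : X → E, IsChart k z' ξ' ∧ ∀ x, ∃ l : ℝ, ξ' x = ξ x + l • ξ z' := by
  by_cases hz : z = z'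
  · subst hz; exact ⟨ξ, h, fun x => ⟨0, by simp⟩⟩
  obtain ⟨ρ, -, ρz, ρz', inv, -, hl⟩ := h.exists_reflection H hz
  have hvd : ∀ x y, vd k (ρ x) (ρ y) = vd k x y := fun x y => by rw [vd, vd, ρ.dist_eq]
  refine ⟨ξ ∘ ρ, ⟨fun p q => ?_, fun θ t hθ ht => ?_⟩, fun x => ?_⟩
  · have := h.law (ρ p) (ρ q)
    rw [← ρz', hvd, hvd, hvd] at this
    exact this
  · obtain ⟨p, hp, hp'⟩ := h.surj θ t hθ ht
    refine ⟨ρ p, ?_, ?_⟩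
    · rw [← hp, ← ρz, ρ.dist_eq]
    · simp only [Function.comp]; rw [inv, hp']
  · obtain ⟨l, hl⟩ := hl x
    refine ⟨-l, ?_⟩
    simp only [Function.comp]
    rw [hl, h.map_base H]; simp

end IsChart

lemma HasCharts.chartAt (H : HasCharts k X E) (z : X) : ∃ ξ : X → E, IsChart k z ξ := by
  obtain ⟨z0, ξ, h⟩ := H.exists_chart
  obtain ⟨ξ', h', -⟩ := h.transfer H z
  exact ⟨ξ', h'⟩

end Charts

section Geometry

open scoped RealInnerProductSpace

variable {k : ℝ} {E : Type*} [NormedAddCommGroup E] [InnerProductSpace ℝ E]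

lemma HasCharts.compact_closedBall [FiniteDimensional ℝ E] (H : HasCharts k X E)
    (z : X) (r : ℝ) : IsCompact (closedBall z r) := by
  obtain ⟨ξ, h⟩ := H.chartAt z
  obtain ⟨W, hW⟩ : ∃ W, ∀ t ∈ Icc 0 r, vsK k t ≤ W := by
    obtain ⟨W, hW⟩ := (isCompact_Icc (a := (0:ℝ)) (b := r)).bddAbove_image
      (continuous_vsK H.curv).continuousOn
    exact ⟨W, fun t ht => hW (mem_image_of_mem _ ht)⟩
  set Φ : X → E × ℝ := fun p => (ξ p, vd k z p) with hΦ
  rw [isCompact_iff_isSeqCompact]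
  intro x hx
  have hbound : ∀ n, Φ (x n) ∈ closedBall (0 : E × ℝ) (2 * W + W ^ 2 + 1) := by
    intro n
    have hd : dist z (x n) ≤ r := by rw [dist_comm]; exact hx n
    have h1 : vd k z (x n) ≤ W := hW _ ⟨dist_nonneg, hd⟩
    have h0 := H.vd_nonneg z (x n)
    have h2 := h.inner_self H (x n)
    rw [real_inner_self_eq_norm_sq] at h2
    have hk : -k ≤ 1 := by rcases H.curv with h | h | h <;> rw [h] <;> norm_num
    have h3 : ‖ξ (x n)‖ ≤ 2 * W + W ^ 2 + 1 := by
      nlinarith [sq_nonneg (‖ξ (x n)‖ - 1), sq_nonneg (vd k z (x n))]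
    rw [mem_closedBall_zero_iff, Prod.norm_def]
    refine max_le h3 ?_
    rw [Real.norm_of_nonneg h0]
    nlinarith
  obtain ⟨⟨ζ, w⟩, -, φ, hφ, hlim⟩ :=
    (isCompact_closedBall (0 : E × ℝ) (2 * W + W ^ 2 + 1)).isSeqCompact hbound
  have hζ : Tendsto (fun n => ξ (x (φ n))) atTop (nhds ζ) :=
    (continuous_fst.tendsto _).comp hlim
  have hw : Tendsto (fun n => vd k z (x (φ n))) atTop (nhds w) :=
    (continuous_snd.tendsto _).comp hlim
  have hw0 : 0 ≤ w := ge_of_tendsto' hw fun n => H.vd_nonneg _ _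
  have heq : ⟪ζ, ζ⟫ = 2 * w - k * w ^ 2 := by
    have h1 := hζ.inner hζ (𝕜 := ℝ)
    have h2 : Tendsto (fun n => ⟪ξ (x (φ n)), ξ (x (φ n))⟫) atTop (nhds (2 * w - k * w ^ 2)) := by
      simp_rw [h.inner_self H]
      exact (hw.const_mul 2).sub ((hw.pow 2).const_mul k)
    exact tendsto_nhds_unique h1 h2
  obtain ⟨p, hp, hpζ⟩ := h.exists_pt H hw0 heq
  have hconv : Tendsto (fun n => x (φ n)) atTop (nhds p) := by
    apply H.tendsto_of_vd
    refine Tendsto.congr (fun n => (h.law _ p).symm) ?_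
    simp only [hp, hpζ]
    have := ((hw.add_const w).sub ((hw.const_mul k).mul_const w)).sub
      (hζ.inner (tendsto_const_nhds (x := ζ)) (𝕜 := ℝ))
    rw [heq] at this
    convert this using 2
    ring
  exact ⟨p, isClosed_closedBall.mem_of_tendsto hconv (Eventually.of_forall fun n => hx _), φ, hφ, hconv⟩

lemma HasCharts.properSpace [FiniteDimensional ℝ E] (H : HasCharts k X E) : ProperSpace X :=
  ⟨H.compact_closedBall⟩

lemma HasCharts.exists_perp (H : HasCharts k X E) (a : E) : ∃ τ : E, ‖τ‖ = 1 ∧ ⟪a, τ⟫ = 0 := by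
  have : FiniteDimensional ℝ E := Module.finite_of_finrank_pos (by linarith [H.dim])
  have hd : 0 < Module.finrank ℝ (ℝ ∙ a)ᗮ := by
    have h1 := Submodule.finrank_add_finrank_orthogonal (ℝ ∙ a)
    have h2 := finrank_span_le_card (R := ℝ) ({a} : Set E)
    simp at h2
    have := H.dim
    omega
  have := Module.nontrivial_of_finrank_pos hd
  obtain ⟨⟨τ, hτ⟩, hτ1⟩ := exists_norm_eq (ℝ ∙ a)ᗮ zero_le_one
  exact ⟨τ, hτ1, Submodule.mem_orthogonal_singleton_iff_inner_right.1 hτ⟩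

namespace IsChart

variable {z : X} {ξ : X → E} (h : IsChart k z ξ) (H : HasCharts k X E)
include h H

lemma exists_dir (p : X) : ∃ θ : E, ‖θ‖ = 1 ∧ ξ p = snK k (dist z p) • θ := by
  by_cases h0 : ξ p = 0
  · obtain ⟨θ, hθ⟩ := H.exists_unit
    refine ⟨θ, hθ, ?_⟩
    rw [← h.norm_eq H, h0]; simp
  · have : ‖ξ p‖ ≠ 0 := norm_ne_zero_iff.2 h0
    exact ⟨‖ξ p‖⁻¹ • ξ p, by rw [norm_smul]; simp [this],
      by rw [← h.norm_eq H, smul_smul, mul_inv_cancel₀ this, one_smul]⟩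

end IsChart

lemma HasCharts.isPreconnected_univ (H : HasCharts k X E) : IsPreconnected (univ : Set X) := by
  obtain ⟨z, ξ, h⟩ := H.exists_chart
  refine isPreconnected_of_forall z fun p _ => ?_
  obtain ⟨θ, hθ, hp⟩ := h.exists_dir H p
  obtain ⟨γ, hc, h0, hv, hξ, -, -⟩ := h.exists_geod H hθ
  refine ⟨range γ, subset_univ _, ⟨0, h0⟩, ⟨dist z p, ?_⟩, isPreconnected_range hc⟩
  exact h.ext H (by rw [hξ, hp]) (by rw [hv]; rfl)

lemma HasCharts.exists_reflection_fixing (H : HasCharts k X E) (q y : X) :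
    ∃ ρ : X ≃ᵢ X, IsReflection ρ ∧ ρ q = q ∧ ρ y = y := by
  obtain ⟨ξ, h⟩ := H.chartAt q
  obtain ⟨τ, hτ, hperp⟩ := H.exists_perp (ξ y)
  obtain ⟨γ, hc, h0, hv, hξ, hst, -⟩ := h.exists_geod H hτ
  have adm2 : Adm k 2 := ⟨by norm_num, fun _ => by linarith [Real.pi_gt_three]⟩
  have hne : γ 1 ≠ γ (-1) := by
    intro hc
    have := hst 1 (-1)
    rw [hc, H.vd_self] at this
    have h2 := vsK_pos H.curv adm2 (by norm_num)
    norm_num at this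
    linarith
  obtain ⟨ρ, hρ, -, -, -, hfix, -⟩ := h.exists_reflection H hne
  refine ⟨ρ, hρ, hfix q ?_, hfix y ?_⟩
  · rw [← H.vd_inj, hv, hv, vsK_neg H.curv]
  · rw [← H.vd_inj, h.law y (γ 1), h.law y (γ (-1)), hv, hv, hξ, hξ, vsK_neg H.curv, real_inner_smul_right,
      real_inner_smul_right, hperp]
    ring

lemma foldr_trans_apply (l : List (X ≃ᵢ X)) (x : X) :
    (l.foldr IsometryEquiv.trans (IsometryEquiv.refl X)) x = l.foldl (fun x σ => σ x) x := by
  induction l generalizing x with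
  | nil => rfl
  | cons a l ih => simp [ih]

lemma orientationPreserving_refl : OrientationPreserving (IsometryEquiv.refl X) :=
  ⟨[], by simp, by simp, rfl⟩

lemma HasCharts.exists_motion (H : HasCharts k X E) {q y q' y' : X}
    (hd : dist q y = dist q' y') :
    ∃ ψ : X ≃ᵢ X, OrientationPreserving ψ ∧ ψ q = q' ∧ ψ y = y' := by
  obtain ⟨z, ξ, h⟩ := H.exists_chart
  have hl : ∀ {a b : X}, ∃ l : List (X ≃ᵢ X), (∀ σ ∈ l, IsReflection σ) ∧
      l.foldl (fun x σ => σ x) a = b ∧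
      ∀ c, dist c a = dist c b → l.foldl (fun x σ => σ x) c = c := by
    intro a b
    by_cases hab : a = b
    · exact ⟨[], by simp, by simpa using hab, by simp⟩
    · obtain ⟨ρ, hρ, h1, -, -, hfix, -⟩ := h.exists_reflection H hab
      exact ⟨[ρ], by simpa using hρ, by simpa using h1, fun c hc => by simpa using hfix c hc⟩
  have hdist : ∀ (l : List (X ≃ᵢ X)) (x y : X), dist (l.foldl (fun x σ => σ x) x)
      (l.foldl (fun x σ => σ x) y) = dist x y := fun l x y => by
    rw [← foldr_trans_apply, ← foldr_trans_apply, IsometryEquiv.dist_eq]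
  obtain ⟨l1, hl1, h1q, -⟩ := hl (a := q) (b := q')
  obtain ⟨l2, hl2, h2y, h2fix⟩ := hl (a := l1.foldl (fun x σ => σ x) y) (b := y')
  have h2q := h2fix q' (by rw [← h1q, hdist, hd, h1q])
  obtain ⟨l, hl, hq, hy⟩ : ∃ l : List (X ≃ᵢ X), (∀ σ ∈ l, IsReflection σ) ∧
      l.foldl (fun x σ => σ x) q = q' ∧ l.foldl (fun x σ => σ x) y = y' :=
    ⟨l1 ++ l2, fun σ hσ => (List.mem_append.1 hσ).elim (hl1 σ) (hl2 σ),
      by rw [List.foldl_append, h1q, h2q], by rw [List.foldl_append, h2y]⟩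
  rcases Nat.even_or_odd l.length with he | ho
  · exact ⟨_, ⟨l, hl, he, rfl⟩, by rw [foldr_trans_apply, hq], by rw [foldr_trans_apply, hy]⟩
  · obtain ⟨ρ, hρ, hρq, hρy⟩ := H.exists_reflection_fixing q' y'
    refine ⟨_, ⟨l ++ [ρ], fun σ hσ => ?_, ?_, rfl⟩, ?_, ?_⟩
    · rcases List.mem_append.1 hσ with h | h
      · exact hl σ h
      · rw [List.mem_singleton.1 h]; exact hρ
    · rw [List.length_append]; exact ho.add_odd (by simp)
    · rw [foldr_trans_apply, List.foldl_append, hq]; exact hρq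
    · rw [foldr_trans_apply, List.foldl_append, hy]; exact hρy

lemma HasCharts.dist_lt_of_btw (H : HasCharts k X E) {u z w m : X} {r : ℝ}
    (hb : Btw u z w) (hzu : z ≠ u) (hzw : z ≠ w) (hu : dist u m ≤ r) (hw : dist w m ≤ r)
    (hr : k = 1 → r < Real.pi / 2) : dist z m < r := by
  obtain ⟨ξ, h⟩ := H.chartAt z
  have admr : Adm k r := ⟨dist_nonneg.trans hu, fun h => by linarith [hr h, Real.pi_pos]⟩
  rw [← H.vd_le_iff admr] at hu hw
  rw [← H.vd_lt_iff admr]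
  set a := dist z u with ha
  set b := dist z w with hb'
  have ha0 : 0 < a := dist_pos.2 hzu
  have hb0 : 0 < b := dist_pos.2 hzw
  have hab : dist u w = a + b := by rw [ha, hb', dist_comm z u]; exact hb.symm
  have hpi : k = 1 → a + b ≤ Real.pi := fun hk => hab ▸ H.diam_le hk u w
  have hSa : 0 < snK k a := snK_pos H.curv ha0 fun hk => by linarith [hpi hk]
  have hSb : 0 < snK k b := snK_pos H.curv hb0 fun hk => by linarith [hpi hk]
  have hva : 0 < vsK k a := vsK_pos H.curv ⟨ha0.le, fun hk => by linarith [hpi hk]⟩ ha0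
  have hvb : 0 < vsK k b := vsK_pos H.curv ⟨hb0.le, fun hk => by linarith [hpi hk]⟩ hb0
  have hin : ⟪ξ u, ξ w⟫ = - (snK k a * snK k b) := by
    have h1 := h.law u w
    rw [vd, vd, vd, hab, ← ha, ← hb', vsK_add H.curv] at h1
    linarith
  have hzero : snK k b • ξ u + snK k a • ξ w = 0 := by
    rw [← norm_eq_zero, ← sq_eq_zero_iff, ← real_inner_self_eq_norm_sq, inner_add_left,
      inner_add_right, inner_add_right, real_inner_smul_left, real_inner_smul_left,
      real_inner_smul_left, real_inner_smul_left, real_inner_smul_right, real_inner_smul_right,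
      real_inner_smul_right, real_inner_smul_right, real_inner_comm (ξ u) (ξ w), hin,
      real_inner_self_eq_norm_sq, real_inner_self_eq_norm_sq, h.norm_eq H, h.norm_eq H, ← ha, ← hb']
    ring
  have hin2 : snK k b * ⟪ξ u, ξ m⟫ + snK k a * ⟪ξ w, ξ m⟫ = 0 := by
    rw [← real_inner_smul_left, ← real_inner_smul_left, ← inner_add_left, hzero, inner_zero_left]
  have lu := h.law u m
  have lw := h.law w m
  set x := vd k z m
  have e1 : vd k z u = vsK k a := rfl
  have e2 : vd k z w = vsK k b := rfl
  rw [e1] at lu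
  rw [e2] at lw
  have hsum : snK k b * vd k u m + snK k a * vd k w m =
      (snK k b * vsK k a + snK k a * vsK k b) * (1 - k * x) + (snK k a + snK k b) * x := by
    rw [lu, lw]; linear_combination (-1) * hin2
  have hle : snK k b * vd k u m + snK k a * vd k w m ≤ (snK k a + snK k b) * vsK k r := by
    nlinarith
  by_cases hx : 0 < 1 - k * x
  · have hpos : 0 < (snK k b * vsK k a + snK k a * vsK k b) * (1 - k * x) := by positivity
    have hlt : (snK k a + snK k b) * x < (snK k a + snK k b) * vsK k r := by linarith
    exact lt_of_mul_lt_mul_left hlt (by linarith)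
  · exfalso
    have hx0 : 0 ≤ x := H.vd_nonneg z m
    have hk : k = 1 := by
      rcases H.curv with hk | hk | hk
      · exact hk
      · rw [hk] at hx; norm_num at hx
      · rw [hk] at hx; exact absurd (by linarith) hx
    have hrr := csK_pos H.curv admr.1 hr
    have hs : snK k b * vsK k a + snK k a * vsK k b = snK k a + snK k b - snK k (a + b) := by
      rw [hk]; simp only [snK_one, vsK_one, Real.sin_add]; ring
    have hs0 : 0 ≤ snK k (a + b) := snK_nonneg H.curv ⟨by linarith, hpi⟩
    rw [hsum, hs] at hle
    rw [hk] at hx hrr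
    simp only [one_mul] at hx hrr
    rw [hk] at hle hSa hSb hs0
    nlinarith

lemma HasCharts.gconvex_closedBall (H : HasCharts k X E) (m : X) {r : ℝ}
    (hr : k = 1 → r < Real.pi / 2) : GConvex (closedBall m r) := by
  intro u hu w hw z hz
  by_cases hzu : z = u
  · rwa [hzu]
  by_cases hzw : z = w
  · rwa [hzw]
  exact (H.dist_lt_of_btw hz.1 hzu hzw hu hw hr).le

end Geometry

section Models

open scoped RealInnerProductSpace

lemma inner_snoc {d : ℕ} (u v : EuclideanSpace ℝ (Fin (d + 1))) :
    ⟪u, v⟫ = ⟪(WithLp.toLp 2 fun i : Fin d => u i.castSucc : EuclideanSpace ℝ (Fin d)),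
      WithLp.toLp 2 fun i : Fin d => v i.castSucc⟫ + u (Fin.last d) * v (Fin.last d) := by
  simp only [PiLp.inner_apply, Fin.sum_univ_castSucc]
  simp [mul_comm]

lemma IsSphereSpace.hasCharts {d : ℕ} (hd : 2 ≤ d) (hX : IsSphereSpace X d) :
    HasCharts 1 X (EuclideanSpace ℝ (Fin d)) := by
  obtain ⟨e, -, hr, he⟩ := hX
  have hn : ∀ p, ‖e p‖ = 1 := fun p => by
    have : e p ∈ range e := ⟨p, rfl⟩
    rw [hr] at this; simpa using this
  have hvd : ∀ p q, vd 1 p q = 1 - ⟪e p, e q⟫ := fun p q => by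
    have := abs_le.1 (abs_real_inner_le_norm (e p) (e q))
    rw [hn, hn, one_mul] at this
    rw [vd, vsK_one, he, Real.cos_arccos this.1 this.2]
  obtain ⟨z, hz⟩ : ∃ z, e z = EuclideanSpace.single (Fin.last d) (1 : ℝ) := by
    have : EuclideanSpace.single (Fin.last d) (1 : ℝ) ∈ range e := by rw [hr]; simp
    exact this
  have hvz : ∀ p, vd 1 z p = 1 - e p (Fin.last d) := fun p => by
    rw [hvd, hz, EuclideanSpace.inner_single_left]; simp
  refine ⟨Or.inl rfl, fun _ p q => by rw [he]; exact Real.arccos_le_pi _, by simpa using hd, z,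
    fun p => WithLp.toLp 2 fun i : Fin d => e p i.castSucc, fun p q => ?_, fun θ t hθ ht => ?_⟩
  · rw [hvz, hvz, hvd, inner_snoc]; ring
  · set u : EuclideanSpace ℝ (Fin (d + 1)) :=
      WithLp.toLp 2 (Fin.snoc (α := fun _ => ℝ) (fun i => Real.sin t * θ i) (Real.cos t)) with hu
    have h1 : (WithLp.toLp 2 fun i : Fin d => u i.castSucc : EuclideanSpace ℝ (Fin d))
        = Real.sin t • θ := by
      ext i; simp [hu]
    have h2 : u (Fin.last d) = Real.cos t := by simp [hu]
    have hmem : u ∈ range e := by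
      rw [hr, mem_sphere_zero_iff_norm, ← sq_eq_sq₀ (norm_nonneg _) zero_le_one,
        ← real_inner_self_eq_norm_sq, inner_snoc, h1, h2, real_inner_smul_left,
        real_inner_smul_right, real_inner_self_eq_norm_sq, hθ]
      nlinarith [Real.sin_sq_add_cos_sq t]
    obtain ⟨p, hp⟩ := hmem
    refine ⟨p, ?_, ?_⟩
    · rw [he, hz, EuclideanSpace.inner_single_left, hp, h2]
      simp [Real.arccos_cos ht.1 (ht.2 rfl)]
    · rw [hp, h1, snK_one]

lemma IsEuclideanSpaceForm.hasCharts {d : ℕ} (hd : 2 ≤ d) (hX : IsEuclideanSpaceForm X d) :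
    HasCharts 0 X (EuclideanSpace ℝ (Fin d)) := by
  obtain ⟨f⟩ := hX
  refine ⟨Or.inr (Or.inl rfl), fun h => by norm_num at h, by simpa using hd, f.symm 0, f,
    fun p q => ?_, fun θ t hθ ht => ⟨f.symm (t • θ), ?_, ?_⟩⟩
  · have h0 : ∀ p, dist (f.symm 0) p = ‖f p‖ := fun p => by
      rw [← f.dist_eq, f.apply_symm_apply, dist_zero_left]
    simp only [vd, vsK_flat, h0]
    rw [← f.dist_eq, dist_eq_norm, norm_sub_sq_real]
    ring
  · rw [f.symm.dist_eq, dist_zero_left, norm_smul, hθ, mul_one, Real.norm_of_nonneg ht.1]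
  · rw [f.apply_symm_apply, snK_flat]

lemma IsHyperbolicSpace.hasCharts {d : ℕ} (hd : 2 ≤ d) (hX : IsHyperbolicSpace X d) :
    HasCharts (-1) X (EuclideanSpace ℝ (Fin d)) := by
  obtain ⟨e, -, hr, he⟩ := hX
  have hk : IsCurv (-1) := Or.inr (Or.inr rfl)
  have hvd : ∀ p q, vd (-1) p q = (e p).2 * (e q).2 - ⟪(e p).1, (e q).1⟫ - 1 := fun p q => by
    rw [vd, vsK_neg_one, he, mink]; ring
  obtain ⟨z, hz⟩ : ∃ z, e z = (0, 1) := by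
    have : ((0, 1) : EuclideanSpace ℝ (Fin d) × ℝ) ∈ range e := by rw [hr]; simp [mink]
    exact this
  have hvz : ∀ p, vd (-1) z p = (e p).2 - 1 := fun p => by rw [hvd, hz]; simp
  refine ⟨hk, fun h => by norm_num at h, by simpa using hd, z, fun p => (e p).1, fun p q => ?_,
    fun θ t hθ ht => ?_⟩
  · rw [hvz, hvz, hvd]; ring
  · have hmem : ((Real.sinh t • θ, Real.cosh t) : EuclideanSpace ℝ (Fin d) × ℝ) ∈ range e := by
      rw [hr]
      refine ⟨?_, Real.cosh_pos t⟩
      simp only [mink]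
      rw [real_inner_smul_left, real_inner_smul_right, real_inner_self_eq_norm_sq, hθ]
      nlinarith [Real.cosh_sq t]
    obtain ⟨p, hp⟩ := hmem
    refine ⟨p, ?_, by rw [hp, snK_neg_one]⟩
    refine vsK_inj hk ⟨dist_nonneg, fun h => by norm_num at h⟩ ht ?_
    have := hvz p
    rw [hp] at this
    rw [vsK_neg_one (t := t)]; exact this

lemma IsSpaceForm.exists_hasCharts {d : ℕ} (hd : 2 ≤ d) (hX : IsSpaceForm X d) :
    ∃ k, HasCharts k X (EuclideanSpace ℝ (Fin d)) ∧ (IsSphereSpace X d ↔ k = 1) := by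
  have key : ∀ k, HasCharts k X (EuclideanSpace ℝ (Fin d)) → k ≠ 1 → ¬ IsSphereSpace X d := by
    rintro k H hk ⟨e, -, -, he⟩
    obtain ⟨z, ξ, h⟩ := H.exists_chart
    obtain ⟨θ, hθ⟩ := H.exists_unit
    obtain ⟨p, hp, -⟩ := h.surj θ 4 hθ ⟨by norm_num, fun h => absurd h hk⟩
    have := Real.arccos_le_pi ⟪e z, e p⟫
    rw [← he, hp] at this
    linarith [Real.pi_lt_d2]
  rcases hX with h | h | h
  · exact ⟨1, h.hasCharts hd, by simp [h]⟩
  · exact ⟨0, h.hasCharts hd, by simpa using key 0 (h.hasCharts hd) (by norm_num)⟩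
  · exact ⟨-1, h.hasCharts hd, by
      have := key (-1) (h.hasCharts hd) (by norm_num)
      constructor
      · intro h; exact absurd h this
      · intro h; norm_num at h⟩

end Models

section Circumball

open scoped RealInnerProductSpace

variable {k : ℝ} {E : Type*} [NormedAddCommGroup E] [InnerProductSpace ℝ E]

lemma isCompact_convexHull_of_isCompact {E : Type*} [NormedAddCommGroup E] [NormedSpace ℝ E]
    [FiniteDimensional ℝ E] {s : Set E} (hs : IsCompact s) : IsCompact (convexHull ℝ s) := by
  set N := Module.finrank ℝ E + 1 with hN
  have himg : convexHull ℝ s = (fun a : (Fin N → ℝ) × (Fin N → E) => ∑ i, a.1 i • a.2 i) ''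
      (stdSimplex ℝ (Fin N) ×ˢ univ.pi fun _ => s) := by
    refine Subset.antisymm (fun x hx => ?_) ?_
    · obtain ⟨ι, hι, z, w, hz, hind, hw, hw1, hsum⟩ := eq_pos_convex_span_of_mem_convexHull hx
      have hcard : Fintype.card ι ≤ Fintype.card (Fin N) := by
        rw [Fintype.card_fin]
        exact hind.card_le_finrank_succ.trans
          (Nat.succ_le_succ (Submodule.finrank_le _))
      obtain ⟨j⟩ := Function.Embedding.nonempty_of_card_le hcard
      obtain ⟨s0, hs0⟩ : s.Nonempty := convexHull_nonempty_iff.1 ⟨x, hx⟩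
      have e1 : ∀ i, Function.extend j w 0 (j i) = w i := fun i => j.injective.extend_apply _ _ _
      have e2 : ∀ i, Function.extend j z (fun _ => s0) (j i) = z i :=
        fun i => j.injective.extend_apply _ _ _
      have e3 : ∀ i, i ∉ range j → Function.extend j w 0 i = 0 := fun i hi =>
        Function.extend_apply' _ _ _ (by simpa using hi)
      refine ⟨(Function.extend j w 0, Function.extend j z fun _ => s0), ⟨⟨fun i => ?_, ?_⟩,
        fun i _ => ?_⟩, ?_⟩
      · by_cases hi : i ∈ range j
        · obtain ⟨a, rfl⟩ := hi
          exact (hw a).le.trans_eq (e1 a).symm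
        · exact (e3 i hi).ge
      · rw [← hw1]
        exact (Fintype.sum_of_injective j j.injective _ _ e3 fun i => (e1 i).symm).symm
      · by_cases hi : i ∈ range j
        · obtain ⟨a, rfl⟩ := hi
          simp only [e2]
          exact hz ⟨a, rfl⟩
        · simp only
          rw [Function.extend_apply' _ _ _ (by simpa using hi)]
          exact hs0
      · rw [← hsum]
        exact (Fintype.sum_of_injective j j.injective _ _ (fun i hi => by simp [e3 i hi])
          fun i => by simp only [e1, e2]).symm
    · rintro _ ⟨⟨w, z⟩, ⟨hw, hz⟩, rfl⟩
      exact (convex_convexHull ℝ s).sum_mem (fun i _ => hw.1 i) hw.2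
        fun i _ => subset_convexHull ℝ s (hz i (mem_univ i))
  rw [himg]
  exact ((isCompact_stdSimplex ℝ (Fin N)).prod (isCompact_univ_pi fun _ => hs)).image
    (by fun_prop)

lemma HasCharts.frontier_nonempty (H : HasCharts k X E) {K : Set X} (hne : K.Nonempty)
    (hpr : K ≠ univ) : (frontier K).Nonempty := by
  have : PreconnectedSpace X := ⟨H.isPreconnected_univ⟩
  rw [nonempty_iff_ne_empty]
  intro h
  rcases isClopen_iff.1 (isClopen_iff_frontier_eq_empty.2 h) with h | h
  · exact hne.ne_empty h
  · exact hpr h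

lemma HasCharts.mem_frontier_of_dist_eq (H : HasCharts k X E) {K : Set X} {o x : X} {R : ℝ}
    (hR : k = 1 → R < Real.pi / 2) (hK : K ⊆ closedBall o R) (hx : x ∈ K) (hd : dist o x = R) :
    x ∈ frontier K := by
  refine ⟨subset_closure hx, fun hinner => ?_⟩
  obtain ⟨ξ, h⟩ := H.chartAt o
  obtain ⟨θ, hθ, hxθ⟩ := h.exists_dir H x
  obtain ⟨γ, hc, h0, hv, hξ, -, hdist⟩ := h.exists_geod H hθ
  rw [hd] at hxθ
  have hγR : γ R = x := h.ext H (by rw [hξ, hxθ]) (by rw [hv, vd, hd])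
  have hR0 : 0 ≤ R := hd ▸ dist_nonneg
  have h1 : ∀ᶠ t in nhds R, γ t ∈ interior K :=
    (hc.tendsto R).eventually (by rw [hγR]; exact isOpen_interior.mem_nhds hinner)
  have h2 : ∀ᶠ t in nhdsWithin R (Ioi R), γ t ∈ interior K ∧ t < R + 1 ∧ R < t :=
    (h1.filter_mono nhdsWithin_le_nhds).and (((eventually_lt_nhds (by linarith)).filter_mono
      nhdsWithin_le_nhds).and self_mem_nhdsWithin)
  obtain ⟨t, ht1, ht2, ht3⟩ := h2.exists
  have h3 := hK (interior_subset ht1)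
  rw [mem_closedBall, dist_comm, ← h0, hdist 0 t, zero_sub, abs_neg, abs_of_pos (by linarith)] at h3
  · linarith
  · intro hk
    rw [zero_sub, abs_neg, abs_of_pos (by linarith)]
    linarith [hR hk, Real.pi_gt_three]

lemma HasCharts.exists_ne_near (H : HasCharts k X E) (x : X) {U : Set X} (hU : U ∈ nhds x) :
    ∃ y ∈ U, y ≠ x := by
  obtain ⟨ξ, h⟩ := H.chartAt x
  obtain ⟨θ, hθ⟩ := H.exists_unit
  obtain ⟨γ, hc, h0, hv, hξ, -, hdist⟩ := h.exists_geod H hθ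
  have h1 : ∀ᶠ t in nhds (0:ℝ), γ t ∈ U := (hc.tendsto 0).eventually (by rwa [h0])
  have h2 : ∀ᶠ t in nhdsWithin (0:ℝ) (Ioi 0), γ t ∈ U ∧ t < 1 ∧ 0 < t :=
    (h1.filter_mono nhdsWithin_le_nhds).and (((eventually_lt_nhds (by norm_num)).filter_mono
      nhdsWithin_le_nhds).and self_mem_nhdsWithin)
  obtain ⟨t, ht1, ht2, ht3⟩ := h2.exists
  refine ⟨γ t, ht1, fun he => ?_⟩
  have := hv t
  rw [he, H.vd_self] at this
  have := vsK_pos H.curv ⟨ht3.le, fun _ => by linarith [Real.pi_gt_three]⟩ ht3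
  linarith

lemma HasCharts.exists_circumball [FiniteDimensional ℝ E] (H : HasCharts k X E) {K : Set X}
    (hinner : (interior K).Nonempty) {p : X} {R₁ : ℝ} (hp : K ⊆ closedBall p R₁) :
    ∃ (o : X) (R : ℝ), 0 < R ∧ R ≤ R₁ ∧ K ⊆ closedBall o R ∧
      ∀ (q : X) (s : ℝ), K ⊆ closedBall q s → R ≤ s := by
  have := H.properSpace
  obtain ⟨x0, hx0⟩ := hinner
  have hx0K := interior_subset hx0
  set A : Set (X × ℝ) := (closedBall x0 R₁ ×ˢ Icc 0 R₁) ∩ {a | ∀ x ∈ K, dist x a.1 ≤ a.2} with hA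
  have hAc : IsCompact A := by
    refine ((isCompact_closedBall x0 R₁).prod isCompact_Icc).inter_right ?_
    simp only [ofPred_forall]
    exact isClosed_biInter fun x _ => isClosed_le (by fun_prop) (by fun_prop)
  have hpx : dist x0 p ≤ R₁ := hp hx0K
  have hAne : A.Nonempty := ⟨(p, R₁), ⟨by rw [mem_closedBall, dist_comm]; exact hpx,
    dist_nonneg.trans hpx, le_rfl⟩, fun x hx => hp hx⟩
  obtain ⟨⟨o, R⟩, ⟨⟨h1, h2⟩, h3⟩, hmin⟩ := hAc.exists_isMinOn hAne continuous_snd.continuousOn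
  have h2' : 0 ≤ R ∧ R ≤ R₁ := h2
  have hmin' : ∀ (q : X) (s : ℝ), K ⊆ closedBall q s → R ≤ s := by
    intro q s hs
    by_cases hsR : s ≤ R₁
    · have hq : dist x0 q ≤ s := hs hx0K
      exact hmin (show (q, s) ∈ A from ⟨⟨by rw [mem_closedBall, dist_comm]; exact hq.trans hsR,
        dist_nonneg.trans hq, hsR⟩, fun x hx => hs hx⟩)
    · exact h2'.2.trans (not_le.1 hsR).le
  refine ⟨o, R, lt_of_le_of_ne h2'.1 fun h0 => ?_, h2'.2, h3, hmin'⟩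
  obtain ⟨y, hy, hyx⟩ := H.exists_ne_near x0 (isOpen_interior.mem_nhds hx0)
  have e1 : dist x0 o ≤ R := h3 x0 hx0K
  have e2 : dist y o ≤ R := h3 y (interior_subset hy)
  rw [← h0] at e1 e2
  exact hyx (by rw [dist_le_zero.1 e1, dist_le_zero.1 e2])

/-- The contact directions of a circumscribed ball surround its centre. -/
lemma HasCharts.zero_mem_convexHull [FiniteDimensional ℝ E] (H : HasCharts k X E) {K : Set X}
    (hKcl : IsClosed K) (hne : K.Nonempty) {o : X} {R : ℝ} (hR0 : 0 < R)
    (hR : k = 1 → R < Real.pi / 2) (hK : K ⊆ closedBall o R)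
    (hmin : ∀ (q : X) (s : ℝ), K ⊆ closedBall q s → R ≤ s) {ξ : X → E} (h : IsChart k o ξ) :
    (0 : E) ∈ convexHull ℝ (ξ '' (K ∩ sphere o R)) := by
  have := H.properSpace
  have hKc : IsCompact K := (isCompact_closedBall o R).of_isClosed_subset hKcl hK
  have admR : Adm k R := ⟨hR0.le, fun hk => by linarith [hR hk, Real.pi_pos]⟩
  by_contra hcon
  have hCc : IsCompact (ξ '' (K ∩ sphere o R)) :=
    (hKc.inter_right isClosed_sphere).image (h.continuous H)
  obtain ⟨f, u, hf0, hfu⟩ := geometric_hahn_banach_point_closed (convex_convexHull ℝ _)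
    (isCompact_convexHull_of_isCompact hCc).isClosed hcon
  rw [map_zero] at hf0
  obtain ⟨e, c, he, hc, hec⟩ : ∃ (e : E) (c : ℝ), ‖e‖ = 1 ∧ 0 < c ∧
      ∀ x ∈ K, dist x o = R → c < ⟪e, ξ x⟫ := by
    set v := (InnerProductSpace.toDual ℝ E).symm f with hv
    have hfv : ∀ x, f x = ⟪v, x⟫ := fun x => by
      rw [hv, InnerProductSpace.toDual_symm_apply]
    by_cases hv0 : v = 0
    · obtain ⟨θ, hθ⟩ := H.exists_unit
      refine ⟨θ, 1, hθ, one_pos, fun x hx hd => ?_⟩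
      have := hfu (ξ x) (subset_convexHull ℝ _ ⟨x, ⟨hx, hd⟩, rfl⟩)
      rw [hfv, hv0, inner_zero_left] at this
      linarith
    · have hvn : 0 < ‖v‖ := norm_pos_iff.2 hv0
      refine ⟨‖v‖⁻¹ • v, ‖v‖⁻¹ * u, by rw [norm_smul]; simp [hvn.ne'], by positivity,
        fun x hx hd => ?_⟩
      have := hfu (ξ x) (subset_convexHull ℝ _ ⟨x, ⟨hx, hd⟩, rfl⟩)
      rw [hfv] at this
      rw [real_inner_smul_left]
      gcongr
  obtain ⟨γ, hγ, h0, hvγ, hξγ, -, -⟩ := h.exists_geod H he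
  have hformula : ∀ t x, vd k (γ t) x = vsK k t + vd k o x - k * vsK k t * vd k o x
      - snK k t * ⟪e, ξ x⟫ := fun t x => by
    rw [h.law, hvγ, hξγ, real_inner_smul_left]
  have hwle : ∀ x ∈ K, vd k o x ≤ vsK k R := fun x hx =>
    (H.vd_le_iff admR).2 (by rw [dist_comm]; exact hK hx)
  have hcont : Continuous fun x => ⟪e, ξ x⟫ := continuous_const.inner (h.continuous H)
  set N : Set X := {x | ⟪e, ξ x⟫ ≤ c} with hN
  have hNc : IsCompact (K ∩ N) := hKc.inter_right (isClosed_le hcont continuous_const)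
  have ev1 : ∀ᶠ t in nhds (0:ℝ), ∀ x ∈ K ∩ N, vd k (γ t) x < vsK k R := by
    refine hNc.eventually_forall_of_forall_eventually fun x hx => ?_
    have hc2 : Continuous fun a : ℝ × X => vd k (γ a.1) a.2 :=
      H.cont_vd (hγ.comp continuous_fst) continuous_snd
    refine (hc2.tendsto (0, x)).eventually_lt_const ?_
    simp only [h0]
    refine lt_of_le_of_ne (hwle x hx.1) fun he => ?_
    have := hec x hx.1 (by rw [dist_comm]; exact (H.vd_eq_iff admR).1 he)
    exact absurd hx.2 (not_le.2 this)
  set M := 1 + vsK k R with hM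
  have hvR : 0 ≤ vsK k R := vsK_nonneg H.curv _
  have hM0 : 0 < M := by linarith
  have ev2 := vsK_lt_mul_snK H.curv (div_pos hc hM0)
  have ev3 : ∀ᶠ t : ℝ in nhdsWithin 0 (Ioi 0), t < 1 ∧ 0 < t :=
    ((eventually_lt_nhds one_pos).filter_mono nhdsWithin_le_nhds).and self_mem_nhdsWithin
  obtain ⟨t, ht1, ht2, ht3, ht4⟩ :=
    ((ev1.filter_mono nhdsWithin_le_nhds).and (ev2.and ev3)).exists
  have hlt : ∀ x ∈ K, vd k (γ t) x < vsK k R := by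
    intro x hx
    by_cases hxN : x ∈ N
    · exact ht1 x ⟨hx, hxN⟩
    · have hxc : c < ⟪e, ξ x⟫ := not_le.1 hxN
      rw [hformula]
      have hw0 := H.vd_nonneg o x
      have hw := hwle x hx
      have hv0 := vsK_nonneg H.curv t
      have hS := snK_pos H.curv ht4 fun _ => by linarith [Real.pi_gt_three]
      have h5 : vsK k t * M < c * snK k t := by
        rw [div_mul_eq_mul_div, lt_div_iff₀ hM0] at ht2; exact ht2
      have h6 : vsK k t * (1 - k * vd k o x) ≤ vsK k t * M := by
        apply mul_le_mul_of_nonneg_left _ hv0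
        rcases H.curv with hk | hk | hk <;> rw [hk] at hw hw0 hvR ⊢ <;> simp only [hM, hk] <;> linarith
      nlinarith
  obtain ⟨x1, hx1, hmax⟩ := hKc.exists_isMaxOn hne
    (f := fun x => dist x (γ t)) (by fun_prop)
  have := hmin (γ t) (dist x1 (γ t)) fun x hx => hmax hx
  have h7 := (H.vd_lt_iff admR).1 (hlt x1 hx1)
  rw [dist_comm] at h7
  linarith

end Circumball

/-- Near `y`, the set `L` is contained in a ball of radius `R` touching it at `y`. -/
def LocSupp (L : Set X) (y : X) (R : ℝ) : Prop :=
  ∃ U ∈ nhds y, ∃ q : X, L ∩ U ⊆ closedBall q R ∧ dist q y = R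

section LocalToGlobal

open scoped RealInnerProductSpace

variable {k : ℝ} {E : Type*} [NormedAddCommGroup E] [InnerProductSpace ℝ E]

lemma IsChart.inner_of_btw {x : X} {ξ : X → E} (h : IsChart k x ξ) (H : HasCharts k X E)
    {z y : X} (hb : Btw x z y) : ⟪ξ z, ξ y⟫ = snK k (dist x z) * snK k (dist x y) := by
  have h1 := h.law z y
  have h2 : dist z y = dist x y - dist x z := by rw [← hb]; ring
  rw [vd, vd, vd, h2, vsK_sub H.curv] at h1
  linarith

lemma IsChart.eq_smul_of_btw {x : X} {ξ : X → E} (h : IsChart k x ξ) (H : HasCharts k X E)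
    {z y : X} (hb : Btw x z y) (hxy : x ≠ y) (hpi : k = 1 → dist x y < Real.pi) :
    ξ z = (snK k (dist x z) / snK k (dist x y)) • ξ y := by
  have hS := snK_pos H.curv (dist_pos.2 hxy) hpi
  have hin := h.inner_of_btw H hb
  rw [← sub_eq_zero, ← norm_eq_zero, ← sq_eq_zero_iff, ← real_inner_self_eq_norm_sq,
    inner_sub_left, inner_sub_right, inner_sub_right, real_inner_smul_left,
    real_inner_smul_right, real_inner_smul_right, real_inner_smul_left,
    real_inner_comm (ξ z) (ξ y), hin,
    real_inner_self_eq_norm_sq, real_inner_self_eq_norm_sq, h.norm_eq H, h.norm_eq H]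
  field_simp
  ring

lemma HasCharts.unique_of_btw (H : HasCharts k X E) {x z y : X} (hb : Btw x z y)
    (hxy : x ≠ y) (hpi : k = 1 → dist x y < Real.pi) : UniqueBtwPt x z y := by
  obtain ⟨ξ, h⟩ := H.chartAt x
  refine ⟨hb, fun w hw hd => ?_⟩
  apply h.ext H
  · rw [h.eq_smul_of_btw H hb hxy hpi, h.eq_smul_of_btw H hw hxy hpi, hd]
  · rw [vd, vd, hd]

/-- If two spheres of radii `R < R'` pass through `x`, there are points near `x` inside the
larger one and outside the smaller one, in any prescribed plane through the larger centre. -/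
lemma IsChart.exists_inside_outside {x : X} {ξ : X → E} (h : IsChart k x ξ)
    (H : HasCharts k X E) {o q : X} {R R' : ℝ} (hR0 : 0 < R) (hRR : R < R')
    (hR' : k = 1 → R' < Real.pi / 2) (hq : dist x q = R) (ho : dist x o = R')
    {n τ : E} (hn : ‖n‖ = 1) (hτ : ‖τ‖ = 1) (hnτ : ⟪n, τ⟫ = 0) (hon : ξ o = snK k R' • n)
    {U : Set X} (hU : U ∈ nhds x) :
    ∃ p ∈ U, (∃ a b : ℝ, ξ p = a • n + b • τ) ∧ dist p o < R' ∧ R < dist p q := by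
  obtain ⟨m, hm, hqm⟩ := h.exists_dir H q
  rw [hq] at hqm
  have hpi := Real.pi_pos
  have admR : Adm k R := ⟨hR0.le, fun hk => by linarith [hR' hk]⟩
  have admR' : Adm k R' := ⟨by linarith, fun hk => by linarith [hR' hk]⟩
  have hSR : 0 < snK k R := snK_pos H.curv hR0 fun hk => by linarith [hR' hk]
  have hSR' : 0 < snK k R' := snK_pos H.curv (by linarith) fun hk => by linarith [hR' hk]
  have hCR : 0 < 1 - k * vsK k R := csK_pos H.curv hR0.le fun hk => by linarith [hR' hk]
  have hCR' : 0 < 1 - k * vsK k R' := csK_pos H.curv (by linarith) hR'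
  have hcot : (1 - k * vsK k R') * snK k R < (1 - k * vsK k R) * snK k R' := by
    have h1 := snK_pos H.curv (t := R' + -R) (by linarith) fun hk => by linarith [hR' hk]
    rw [snK_add H.curv, snK_neg H.curv, vsK_neg H.curv] at h1
    linarith
  obtain ⟨δ, hδ, hball⟩ := Metric.mem_nhds_iff.1 hU
  have ev1 := vsK_lt_mul_snK H.curv (div_pos hSR hCR)
  have ev2 : ∀ᶠ t : ℝ in nhdsWithin 0 (Ioi 0), t < min δ 1 ∧ 0 < t :=
    ((eventually_lt_nhds (lt_min hδ one_pos)).filter_mono nhdsWithin_le_nhds).and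
      self_mem_nhdsWithin
  obtain ⟨r, hr1, hr2, hr3⟩ := (ev1.and ev2).exists
  have hrδ : r < δ := hr2.trans_le (min_le_left _ _)
  have hr1' : r < 1 := hr2.trans_le (min_le_right _ _)
  have admr : Adm k r := ⟨hr3.le, fun _ => by linarith [Real.pi_gt_three]⟩
  have hSr : 0 < snK k r := snK_pos H.curv hr3 fun _ => by linarith [Real.pi_gt_three]
  have hvr : 0 < vsK k r := vsK_pos H.curv admr hr3
  rw [div_mul_eq_mul_div, lt_div_iff₀ hCR] at hr1
  obtain ⟨s, hs1, hs2⟩ : ∃ s, vsK k r * (1 - k * vsK k R') < snK k r * snK k R' * s ∧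
      snK k r * snK k R * s < vsK k r * (1 - k * vsK k R) := by
    obtain ⟨s, hs1, hs2⟩ := exists_between
      (show vsK k r * (1 - k * vsK k R') / (snK k r * snK k R') <
        vsK k r * (1 - k * vsK k R) / (snK k r * snK k R) by
        rw [div_lt_div_iff₀ (by positivity) (by positivity)]
        have : 0 < vsK k r * snK k r := by positivity
        nlinarith)
    rw [div_lt_iff₀ (by positivity)] at hs1
    rw [lt_div_iff₀ (by positivity)] at hs2
    exact ⟨s, by linarith, by linarith⟩
  have hs0 : 0 < s := by
    have : 0 < snK k r * snK k R' * s := lt_trans (by positivity) hs1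
    exact (pos_iff_pos_of_mul_pos this).1 (by positivity)
  have hs1' : s < 1 := by
    by_contra hc
    have : snK k r * snK k R * 1 ≤ snK k r * snK k R * s :=
      mul_le_mul_of_nonneg_left (not_lt.1 hc) (by positivity)
    linarith
  set c := Real.sqrt (1 - s ^ 2) with hc
  have hcs : c ^ 2 + s ^ 2 = 1 := by rw [hc, Real.sq_sqrt (by nlinarith)]; ring
  have hdir : ∀ c' : ℝ, c' ^ 2 + s ^ 2 = 1 → ‖s • n + c' • τ‖ = 1 := by
    intro c' hc'
    rw [← sq_eq_sq₀ (norm_nonneg _) zero_le_one, ← real_inner_self_eq_norm_sq, inner_add_left,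
      inner_add_right, inner_add_right, real_inner_smul_left, real_inner_smul_left,
      real_inner_smul_left, real_inner_smul_left, real_inner_smul_right, real_inner_smul_right,
      real_inner_smul_right, real_inner_smul_right, real_inner_comm n τ, hnτ,
      real_inner_self_eq_norm_sq, real_inner_self_eq_norm_sq, hn, hτ]
    linarith
  have main : ∀ c' : ℝ, c' ^ 2 + s ^ 2 = 1 → ∃ p ∈ U, (∃ a b : ℝ, ξ p = a • n + b • τ) ∧
      dist p o < R' ∧ vd k p q = vsK k r * (1 - k * vsK k R) + vsK k R
        - snK k r * snK k R * ⟪s • n + c' • τ, m⟫ := by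
    intro c' hc'
    obtain ⟨p, hp, hpξ⟩ := h.surj _ r (hdir c' hc') admr
    refine ⟨p, hball ?_, ⟨snK k r * s, snK k r * c', ?_⟩, ?_, ?_⟩
    · rw [mem_ball, dist_comm, hp]; exact hrδ
    · rw [hpξ, smul_add, smul_smul, smul_smul]
    · rw [← H.vd_lt_iff admR', h.law, vd, vd, hp, ho, hpξ, hon, real_inner_smul_left,
        real_inner_smul_right, inner_add_left, real_inner_smul_left, real_inner_smul_left,
        real_inner_comm n τ, hnτ, real_inner_self_eq_norm_sq, hn]
      linarith
    · rw [h.law, vd, vd, hp, hq, hpξ, hqm, real_inner_smul_left, real_inner_smul_right]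
      ring
  obtain ⟨p1, hp1U, hp1, hp1o, hp1q⟩ := main c hcs
  obtain ⟨p2, hp2U, hp2, hp2o, hp2q⟩ := main (-c) (by rw [neg_sq]; exact hcs)
  by_contra hcon
  push Not at hcon
  have e1 := (H.vd_le_iff admR).2 (hcon p1 hp1U hp1 hp1o)
  have e2 := (H.vd_le_iff admR).2 (hcon p2 hp2U hp2 hp2o)
  rw [hp1q, inner_add_left, real_inner_smul_left, real_inner_smul_left] at e1
  rw [hp2q, inner_add_left, real_inner_smul_left, real_inner_smul_left] at e2
  have hnm : ⟪n, m⟫ ≤ 1 := by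
    have := real_inner_le_norm n m
    rwa [hn, hm, one_mul] at this
  have : snK k r * snK k R * (s * ⟪n, m⟫) ≤ snK k r * snK k R * (s * 1) := by
    gcongr
  nlinarith

end LocalToGlobal

section Lens

open scoped RealInnerProductSpace

variable {k : ℝ} {E : Type*} [NormedAddCommGroup E] [InnerProductSpace ℝ E]

/-- Interior points of chords of a locally `R`-supported convex set are interior points. -/
lemma HasCharts.mem_interior_of_chord (H : HasCharts k X E) {L : Set X} {R : ℝ}
    (hcv : GConvex L) (hR : k = 1 → R < Real.pi / 2)
    (hsupp : ∀ y ∈ frontier L, LocSupp L y R) {η : ℝ → X} (hη : Continuous η)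
    (hdist : ∀ s t, (k = 1 → |s - t| ≤ Real.pi) → dist (η s) (η t) = |s - t|) {ζ : ℝ}
    (hζ : k = 1 → ζ < Real.pi / 2) (hm : η (-ζ) ∈ L) (hp : η ζ ∈ L) {t : ℝ}
    (ht : -ζ < t) (ht' : t < ζ) : η t ∈ interior L := by
  have hd : ∀ s t, -ζ ≤ s → s ≤ t → t ≤ ζ → dist (η s) (η t) = t - s := by
    intro s t h1 h2 h3
    rw [hdist, abs_sub_comm, abs_of_nonneg (by linarith)]
    intro hk
    rw [abs_sub_comm, abs_of_nonneg (by linarith)]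
    linarith [hζ hk]
  have hmem : ∀ s, -ζ ≤ s → s ≤ ζ → η s ∈ L := by
    intro s h1 h2
    refine hcv _ hm _ hp _ (H.unique_of_btw ?_ ?_ ?_)
    · rw [Btw, hd _ _ le_rfl h1 h2, hd _ _ h1 h2 le_rfl, hd _ _ le_rfl (by linarith) le_rfl]
      ring
    · rw [← dist_pos, hd _ _ le_rfl (by linarith) le_rfl]
      linarith
    · intro hk
      rw [hd _ _ le_rfl (by linarith) le_rfl]
      linarith [hζ hk]
  by_contra hinner
  obtain ⟨U, hU, q, hUq, hq⟩ := hsupp (η t)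
    ⟨subset_closure (hmem t ht.le ht'.le), hinner⟩
  have hev : ∀ᶠ δ : ℝ in nhdsWithin 0 (Ioi 0), η (t - δ) ∈ U ∧ η (t + δ) ∈ U := by
    refine Filter.Eventually.and ?_ ?_
    · have : Tendsto (fun δ : ℝ => η (t - δ)) (nhds 0) (nhds (η t)) := by
        have : Continuous fun δ : ℝ => η (t - δ) := by fun_prop
        simpa using this.tendsto 0
      exact (this.mono_left nhdsWithin_le_nhds).eventually hU
    · have : Tendsto (fun δ : ℝ => η (t + δ)) (nhds 0) (nhds (η t)) := by
        have : Continuous fun δ : ℝ => η (t + δ) := by fun_prop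
        simpa using this.tendsto 0
      exact (this.mono_left nhdsWithin_le_nhds).eventually hU
  have hev2 : ∀ᶠ δ : ℝ in nhdsWithin 0 (Ioi 0), δ < min (ζ - t) (t + ζ) ∧ 0 < δ :=
    ((eventually_lt_nhds (lt_min (by linarith) (by linarith))).filter_mono
      nhdsWithin_le_nhds).and self_mem_nhdsWithin
  obtain ⟨δ, ⟨h1, h2⟩, h3, h4⟩ := (hev.and hev2).exists
  have h5 := h3.trans_le (min_le_left _ _)
  have h6 := h3.trans_le (min_le_right _ _)
  have hlt := H.dist_lt_of_btw (u := η (t - δ)) (z := η t) (w := η (t + δ)) (m := q) (r := R)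
    (by rw [Btw, hd _ _ (by linarith) (by linarith) (by linarith),
          hd _ _ (by linarith) (by linarith) (by linarith),
          hd _ _ (by linarith) (by linarith) (by linarith)]; ring)
    (by rw [ne_comm, ← dist_pos, hd _ _ (by linarith) (by linarith) (by linarith)]; linarith)
    (by rw [← dist_pos, hd _ _ (by linarith) (by linarith) (by linarith)]; linarith)
    (mem_closedBall.1 (hUq ⟨hmem _ (by linarith) (by linarith), h1⟩))
    (mem_closedBall.1 (hUq ⟨hmem _ (by linarith) (by linarith), h2⟩)) hR
  rw [dist_comm, hq] at hlt
  exact lt_irrefl _ hlt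

/-- The part of an `R`-ball cut off by a chord (on the side away from the centre), within a
plane, belongs to every locally `R`-supported convex set containing the endpoints of the chord. -/
lemma IsChart.mem_of_lens [FiniteDimensional ℝ E] {μ : X} {ξ : X → E} (h : IsChart k μ ξ)
    (H : HasCharts k X E)
    {L : Set X} {R : ℝ} (hcv : GConvex L) (hR0 : 0 < R)
    (hR : k = 1 → R < Real.pi / 2) (hsupp : ∀ y ∈ frontier L, LocSupp L y R) {e f : E}
    (he : ‖e‖ = 1) (hf : ‖f‖ = 1) (hef : ⟪e, f⟫ = 0) {r₀ ζ : ℝ} (hr₀ : 0 ≤ r₀)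
    (hr₀R : r₀ < R) (hζ0 : 0 < ζ) (hζ : k = 1 → ζ < Real.pi / 2) {o cp cm : X}
    (hcp : cp ∈ L) (hcm : cm ∈ L) (ho : dist μ o = r₀) (hoξ : ξ o = -(snK k r₀ • e))
    (hcpd : dist μ cp = ζ) (hcpξ : ξ cp = snK k ζ • f) (hcmd : dist μ cm = ζ)
    (hcmξ : ξ cm = -(snK k ζ • f))
    (hv : vsK k R = vsK k r₀ + vsK k ζ - k * vsK k r₀ * vsK k ζ)
    {x₀ : X} (hx₀ : ξ x₀ = ⟪ξ x₀, e⟫ • e + ⟪ξ x₀, f⟫ • f) (hx₀e : 0 ≤ ⟪ξ x₀, e⟫)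
    (hx₀o : dist x₀ o < R) : x₀ ∈ L := by
  by_contra hx₀L
  have hc := H.curv
  have hpi := Real.pi_pos
  have hps := H.properSpace
  have hfe : ⟪f, e⟫ = 0 := by rw [real_inner_comm, hef]
  have hee : ⟪e, e⟫ = (1 : ℝ) := by rw [real_inner_self_eq_norm_sq, he]; norm_num
  have hff : ⟪f, f⟫ = (1 : ℝ) := by rw [real_inner_self_eq_norm_sq, hf]; norm_num
  obtain ⟨γ, hγc, hγ0, hγv, hγξ, -, -⟩ := h.exists_geod H he
  set F : ℝ × X → ℝ := fun p => vd k p.2 (γ (-p.1)) with hF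
  have hFe : ∀ σ x, F (σ, x) = vd k μ x + vsK k σ - k * vd k μ x * vsK k σ +
      snK k σ * ⟪ξ x, e⟫ := by
    intro σ x
    simp only [hF]
    rw [h.law, hγv, hγξ, vsK_neg hc, snK_neg hc, real_inner_smul_right]
    ring
  have hξc := h.continuous H
  have hFc : Continuous F := H.cont_vd continuous_snd (hγc.comp continuous_fst.neg)
  have admR : Adm k R := ⟨hR0.le, fun hk => by linarith [hR hk]⟩
  have hoγ : o = γ (-r₀) := by
    apply h.ext H
    · rw [hoξ, hγξ, snK_neg hc, neg_smul]
    · rw [hγv, vsK_neg hc, vd, ho]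
  have hF0 : F (r₀, x₀) < vsK k R := by
    simp only [hF]
    rw [← hoγ, H.vd_lt_iff admR]
    exact hx₀o
  obtain ⟨σ₀, hσ₀1, hσ₀2, hσ₀3⟩ : ∃ σ₀, r₀ < σ₀ ∧ σ₀ < R ∧ F (σ₀, x₀) < vsK k R := by
    have hcont : Continuous fun σ => F (σ, x₀) := by fun_prop
    have ev1 : ∀ᶠ σ in nhdsWithin r₀ (Ioi r₀), F (σ, x₀) < vsK k R :=
      ((hcont.tendsto r₀).eventually (eventually_lt_nhds hF0)).filter_mono nhdsWithin_le_nhds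
    have ev2 : ∀ᶠ σ in nhdsWithin r₀ (Ioi r₀), σ < R ∧ r₀ < σ :=
      ((eventually_lt_nhds hr₀R).filter_mono nhdsWithin_le_nhds).and self_mem_nhdsWithin
    obtain ⟨σ, h1, h2, h3⟩ := (ev1.and ev2).exists
    exact ⟨σ, h3, h2, h1⟩
  have hCζ : 0 < 1 - k * vsK k ζ := csK_pos hc hζ0.le hζ
  have hDmono : ∀ s t, 0 ≤ s → s ≤ t → t ≤ σ₀ ∨ (k = 1 → t < Real.pi / 2) →
      vsK k ζ + vsK k s * (1 - k * vsK k ζ) ≤ vsK k ζ + vsK k t * (1 - k * vsK k ζ) := by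
    intro s t h1 h2 h3
    have : vsK k s ≤ vsK k t := vsK_le hc h1 ⟨by linarith, fun hk => by
      rcases h3 with h3 | h3
      · linarith [hR hk]
      · linarith [h3 hk]⟩ h2
    gcongr
  have hRD : vsK k R < vsK k ζ + vsK k σ₀ * (1 - k * vsK k ζ) := by
    have : vsK k r₀ < vsK k σ₀ := vsK_lt hc hr₀ ⟨by linarith, fun hk => by linarith [hR hk]⟩ hσ₀1
    nlinarith
  obtain ⟨R', hRR', hR'D, hR'⟩ : ∃ R', R < R' ∧
      vsK k R' < vsK k ζ + vsK k σ₀ * (1 - k * vsK k ζ) ∧ (k = 1 → R' < Real.pi / 2) := by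
    have ev1 : ∀ᶠ t in nhdsWithin R (Ioi R), vsK k t < vsK k ζ + vsK k σ₀ * (1 - k * vsK k ζ) :=
      (((continuous_vsK hc).tendsto R).eventually (eventually_lt_nhds hRD)).filter_mono
        nhdsWithin_le_nhds
    have ev2 : ∀ᶠ t in nhdsWithin R (Ioi R), (k = 1 → t < Real.pi / 2) := by
      by_cases hk : k = 1
      · exact ((eventually_lt_nhds (hR hk)).filter_mono nhdsWithin_le_nhds).mono fun _ h _ => h
      · exact Eventually.of_forall fun _ h => absurd h hk
    obtain ⟨t, ⟨h1, h2⟩, h3⟩ := ((ev1.and ev2).and self_mem_nhdsWithin).exists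
    exact ⟨t, h3, h1, h2⟩
  have admR' : Adm k R' := ⟨by linarith, fun hk => by linarith [hR' hk]⟩
  obtain ⟨σ₁, hσ₁1, hσ₁⟩ : ∃ σ₁, R' < σ₁ ∧ (k = 1 → σ₁ < Real.pi / 2) := by
    by_cases hk : k = 1
    · obtain ⟨s, h1, h2⟩ := exists_between (hR' hk)
      exact ⟨s, h1, fun _ => h2⟩
    · exact ⟨R' + 1, by linarith, fun h => absurd h hk⟩
  set T : Set (ℝ × X) := {p | p.1 ∈ Icc σ₀ σ₁ ∧ ξ p.2 = ⟪ξ p.2, e⟫ • e + ⟪ξ p.2, f⟫ • f ∧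
    0 ≤ ⟪ξ p.2, e⟫ ∧ p.2 ∉ interior L ∧ F p ≤ vsK k R'} with hT
  have hξ2 : Continuous fun p : ℝ × X => ξ p.2 := hξc.comp continuous_snd
  have hTc : IsCompact T := by
    refine IsCompact.of_isClosed_subset (isCompact_Icc.prod
      (isCompact_closedBall μ (R' + σ₁)) : IsCompact (Icc σ₀ σ₁ ×ˢ closedBall μ (R' + σ₁)))
      ?_ ?_
    · have e1 : T = (Prod.fst ⁻¹' Icc σ₀ σ₁) ∩
          ({p | ξ p.2 = ⟪ξ p.2, e⟫ • e + ⟪ξ p.2, f⟫ • f} ∩ ({p | 0 ≤ ⟪ξ p.2, e⟫} ∩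
            ((Prod.snd ⁻¹' interior L)ᶜ ∩ {p | F p ≤ vsK k R'}))) := by
        ext p
        rfl
      rw [e1]
      exact (isClosed_Icc.preimage continuous_fst).inter
        ((isClosed_eq hξ2 (by fun_prop)).inter
        ((isClosed_le continuous_const (by fun_prop)).inter
        (((isOpen_interior.preimage continuous_snd).isClosed_compl).inter
        (isClosed_le hFc continuous_const))))
    · rintro ⟨σ, x⟩ ⟨h1, -, -, -, h5⟩
      refine ⟨h1, ?_⟩
      have h1' : σ₀ ≤ σ ∧ σ ≤ σ₁ := h1
      have h6 : dist x (γ (-σ)) ≤ R' := (H.vd_le_iff admR').1 h5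
      have h7 : dist μ (γ (-σ)) ≤ σ := by
        rw [← H.vd_le_iff ⟨by linarith, fun hk => by linarith [hσ₁ hk]⟩, hγv, vsK_neg hc]
      rw [mem_closedBall]
      have := dist_triangle_right x μ (γ (-σ))
      linarith
  have hTn : T.Nonempty := ⟨(σ₀, x₀), ⟨le_rfl, by linarith⟩, hx₀, hx₀e,
    fun hi => hx₀L (interior_subset hi), by
      have := vsK_lt hc hR0.le admR' hRR'
      linarith⟩
  obtain ⟨⟨σ, x⟩, ⟨hσ, hxP, hxe, hxint, hxF⟩, hmax⟩ :=
    hTc.exists_isMaxOn hTn continuous_fst.continuousOn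
  obtain ⟨hσ0, hσ1⟩ : σ₀ ≤ σ ∧ σ ≤ σ₁ := hσ
  simp only at hxP hxe hxint
  have hσlt : σ < σ₁ := by
    refine hσ1.lt_of_ne fun heq => ?_
    rw [heq, hFe] at hxF
    have h1 := vsK_lt hc admR'.1 ⟨by linarith [admR'.1], fun hk => by linarith [hσ₁ hk]⟩ hσ₁1
    have h2 := csK_pos hc (t := σ₁) (by linarith [admR'.1]) hσ₁
    have h3 := H.vd_nonneg μ x
    have h4 := snK_nonneg hc (t := σ₁) ⟨by linarith [admR'.1], fun hk => by linarith [hσ₁ hk]⟩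
    nlinarith [mul_nonneg h3 h2.le, mul_nonneg h4 hxe]
  have hin : ∀ y, ξ y = ⟪ξ y, e⟫ • e + ⟪ξ y, f⟫ • f → 0 ≤ ⟪ξ y, e⟫ → F (σ, y) < vsK k R' →
      y ∈ interior L := by
    intro y hy1 hy2 hy3
    by_contra hy
    have hcont : Continuous fun σ => F (σ, y) := by fun_prop
    have ev1 : ∀ᶠ s in nhdsWithin σ (Ioi σ), F (s, y) < vsK k R' :=
      ((hcont.tendsto σ).eventually (eventually_lt_nhds hy3)).filter_mono nhdsWithin_le_nhds
    have ev2 : ∀ᶠ s in nhdsWithin σ (Ioi σ), s < σ₁ ∧ σ < s :=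
      ((eventually_lt_nhds hσlt).filter_mono nhdsWithin_le_nhds).and self_mem_nhdsWithin
    obtain ⟨s, h1, h2, h3⟩ := (ev1.and ev2).exists
    have : s ≤ σ := hmax (show (s, y) ∈ T from ⟨⟨by linarith, h2.le⟩, hy1, hy2, hy, h1.le⟩)
    linarith
  have hxF' : F (σ, x) = vsK k R' :=
    le_antisymm hxF (not_lt.1 fun hlt => hxint (hin x hxP hxe hlt))
  rcases hxe.lt_or_eq with hpos | hzero
  · obtain ⟨ξ', h', hξ'⟩ := h.transfer H x
    have hxo : dist x (γ (-σ)) = R' := (H.vd_eq_iff admR').1 hxF'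
    have hSR' : 0 < snK k R' := snK_pos hc (by linarith) fun hk => by linarith [hR' hk]
    obtain ⟨a, b, hab⟩ : ∃ a b : ℝ, (snK k R')⁻¹ • ξ' (γ (-σ)) = a • e + b • f := by
      obtain ⟨l, hl⟩ := hξ' (γ (-σ))
      rw [hl, hγξ, hxP]
      exact ⟨(snK k R')⁻¹ * (snK k (-σ) + l * ⟪ξ x, e⟫), (snK k R')⁻¹ * (l * ⟪ξ x, f⟫), by
        module⟩
    have hn : ‖a • e + b • f‖ = 1 := by
      rw [← hab, norm_smul, h'.norm_eq H, hxo, norm_inv, Real.norm_of_nonneg hSR'.le,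
        inv_mul_cancel₀ hSR'.ne']
    have hnn : a ^ 2 + b ^ 2 = 1 := by
      have := real_inner_self_eq_norm_sq (a • e + b • f)
      rw [hn, inner_add_left, inner_add_right, inner_add_right] at this
      simp only [real_inner_smul_left, real_inner_smul_right, hee, hff, hef, hfe] at this
      linarith
    have hτ : ‖(-b) • e + a • f‖ = 1 := by
      rw [← sq_eq_sq₀ (norm_nonneg _) zero_le_one, ← real_inner_self_eq_norm_sq,
        inner_add_left, inner_add_right, inner_add_right]
      simp only [real_inner_smul_left, real_inner_smul_right, hee, hff, hef, hfe]
      linarith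
    have hnτ : ⟪a • e + b • f, (-b) • e + a • f⟫ = 0 := by
      rw [inner_add_left, inner_add_right, inner_add_right]
      simp only [real_inner_smul_left, real_inner_smul_right, hee, hff, hef, hfe]
      ring
    have hon : ξ' (γ (-σ)) = snK k R' • (a • e + b • f) := by
      rw [← hab, smul_smul, mul_inv_cancel₀ hSR'.ne', one_smul]
    have key : ∀ U ∈ nhds x, ∀ q, dist x q = R → ∃ p ∈ U, p ∈ L ∧ R < dist p q := by
      intro U hU q hq
      have hU' : U ∩ {y | 0 < ⟪ξ y, e⟫} ∈ nhds x :=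
        inter_mem hU ((isOpen_lt continuous_const (by fun_prop)).mem_nhds hpos)
      obtain ⟨p, ⟨hpU, hpe⟩, ⟨a', b', hp⟩, hpo, hpq⟩ :=
        h'.exists_inside_outside H hR0 hRR' hR' hq hxo hn hτ hnτ hon hU'
      refine ⟨p, hpU, interior_subset (hin p ?_ (le_of_lt hpe) ?_), hpq⟩
      · obtain ⟨l, hl⟩ := hξ' p
        have h3 : ξ p = (a' * a - b' * b - l * ⟪ξ x, e⟫) • e +
            (a' * b + b' * a - l * ⟪ξ x, f⟫) • f := by
          have : ξ p = ξ' p - l • ξ x := by rw [hl]; abel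
          rw [this, hp, hxP]
          simp only [inner_add_left, real_inner_smul_left, hee, hff, hef, hfe]
          module
        rw [h3]
        simp only [inner_add_left, real_inner_smul_left, hee, hff, hef, hfe]
        module
      · simp only [hF]
        rwa [H.vd_lt_iff admR']
    have hxL : x ∈ closure L := by
      rw [mem_closure_iff_nhds]
      intro U hU
      obtain ⟨θ, hθ⟩ := H.exists_unit
      obtain ⟨q, hq, -⟩ := h'.surj θ R hθ admR
      obtain ⟨p, h1, h2, -⟩ := key U hU q hq
      exact ⟨p, h1, h2⟩
    obtain ⟨U, hU, q, hUq, hq⟩ := hsupp x ⟨hxL, hxint⟩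
    obtain ⟨p, h1, h2, h3⟩ := key U hU q (by rw [dist_comm]; exact hq)
    exact absurd (mem_closedBall.1 (hUq ⟨h2, h1⟩)) (not_le.2 h3)
  · obtain ⟨η, hηc, hη0, hηv, hηξ, -, hηd⟩ := h.exists_geod H hf
    rw [← hzero, zero_smul, zero_add] at hxP
    have hwζ : dist μ x < ζ := by
      have admζ : Adm k ζ := ⟨hζ0.le, fun hk => by linarith [hζ hk]⟩
      rw [← H.vd_lt_iff admζ]
      have h1 := hDmono σ₀ σ (by linarith) hσ0 (Or.inr fun hk => by linarith [hσ₁ hk])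
      have h2 := csK_pos hc (t := σ) (by linarith) fun hk => by linarith [hσ₁ hk]
      rw [hFe, ← hzero] at hxF'
      have h3 : vd k μ x * (1 - k * vsK k σ) < vsK k ζ * (1 - k * vsK k σ) := by nlinarith
      exact lt_of_mul_lt_mul_right h3 h2.le
    have hnorm : |⟪ξ x, f⟫| = snK k (dist μ x) := by
      rw [← h.norm_eq H, hxP, norm_smul, hf, real_inner_smul_left, hff, mul_one, mul_one,
        Real.norm_eq_abs]
    obtain ⟨t, ht, ht', hxt⟩ : ∃ t, -ζ < t ∧ t < ζ ∧ x = η t := by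
      have h0 := dist_nonneg (x := μ) (y := x)
      rcases abs_choice ⟪ξ x, f⟫ with hs | hs
      · refine ⟨dist μ x, by linarith, hwζ, h.ext H ?_ ?_⟩
        · rw [hηξ, ← hnorm, hs, ← hxP]
        · rw [hηv, vd]
      · refine ⟨-dist μ x, by linarith, by linarith, h.ext H ?_ ?_⟩
        · rw [hηξ, snK_neg hc, ← hnorm, hs, neg_neg, ← hxP]
        · rw [hηv, vd, vsK_neg hc]
    apply hxint
    rw [hxt]
    refine H.mem_interior_of_chord hcv hR hsupp hηc hηd hζ ?_ ?_ ht ht'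
    · convert hcm using 1
      apply h.ext H
      · rw [hηξ, snK_neg hc, hcmξ, neg_smul]
      · rw [hηv, vd, hcmd, vsK_neg hc]
    · convert hcp using 1
      apply h.ext H
      · rw [hηξ, hcpξ]
      · rw [hηv, vd, hcpd]

end Lens

section BallTheorem

open scoped RealInnerProductSpace

variable {k : ℝ} {E : Type*} [NormedAddCommGroup E] [InnerProductSpace ℝ E]

lemma IsChart.eq_neg_of_dist {z : X} {ξ : X → E} (h : IsChart k z ξ) (H : HasCharts k X E)
    {a b : X} {ζ : ℝ} (ha : dist z a = ζ) (hb : dist z b = ζ) (hab : dist a b = 2 * ζ) :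
    ξ b = -ξ a := by
  have h1 := h.law a b
  rw [vd, vd, vd, ha, hb, hab, two_mul, vsK_add H.curv] at h1
  have h2 : ‖ξ b + ξ a‖ ^ 2 = 0 := by
    rw [← real_inner_self_eq_norm_sq, inner_add_left, inner_add_right, inner_add_right,
      real_inner_self_eq_norm_sq, real_inner_self_eq_norm_sq, h.norm_eq H, h.norm_eq H, ha, hb,
      real_inner_comm (ξ a) (ξ b)]
    linarith
  rw [eq_neg_iff_add_eq_zero, ← norm_eq_zero]
  exact pow_eq_zero_iff two_ne_zero |>.1 h2

lemma IsChart.exists_mem_nhds_ray {z : X} {ξ : X → E} (h : IsChart k z ξ) (H : HasCharts k X E)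
    {c : X} (hzc : z ≠ c) (hpi : k = 1 → dist z c < Real.pi) {U : Set X} (hU : U ∈ nhds c) :
    ∃ x ∈ U, x ≠ z ∧ x ≠ c ∧ Btw z x c ∧ ∃ s : ℝ, 0 ≤ s ∧ ξ x = s • ξ c := by
  obtain ⟨θ, hθ, hcθ⟩ := h.exists_dir H c
  obtain ⟨γ, hγc, hγ0, hγv, hγξ, -, hγd⟩ := h.exists_geod H hθ
  have hd := dist_pos.2 hzc
  have hle := H.adm z c
  have hcγ : γ (dist z c) = c := h.ext H (by rw [hγξ, hcθ]) (by rw [hγv, vd])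
  have ev1 : ∀ᶠ t in nhdsWithin (dist z c) (Iio (dist z c)), γ t ∈ U := by
    refine Filter.Eventually.filter_mono nhdsWithin_le_nhds ?_
    exact (hγc.tendsto (dist z c)).eventually (by rw [hcγ]; exact hU)
  have ev2 : ∀ᶠ t in nhdsWithin (dist z c) (Iio (dist z c)), 0 < t ∧ t < dist z c :=
    ((eventually_gt_nhds hd).filter_mono nhdsWithin_le_nhds).and self_mem_nhdsWithin
  obtain ⟨t, h1, h2, h3⟩ := (ev1.and ev2).exists
  have e1 : dist z (γ t) = t := by
    rw [← hγ0, hγd, zero_sub, abs_neg, abs_of_pos h2]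
    intro hk
    rw [zero_sub, abs_neg, abs_of_pos h2]
    linarith [hle.2 hk]
  have e2 : dist (γ t) c = dist z c - t := by
    conv_lhs => rw [← hcγ]
    rw [hγd, abs_sub_comm, abs_of_pos (by linarith)]
    intro hk
    rw [abs_sub_comm, abs_of_pos (by linarith)]
    linarith [hle.2 hk]
  refine ⟨γ t, h1, ?_, ?_, ?_, ?_⟩
  · rw [ne_comm, ← dist_pos, e1]; exact h2
  · rw [← dist_pos, e2]; linarith
  · rw [Btw, e1, e2]; ring
  · have hS := snK_pos H.curv hd hpi
    refine ⟨snK k t / snK k (dist z c), ?_, ?_⟩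
    · exact div_nonneg (snK_nonneg H.curv ⟨h2.le, fun hk => by linarith [hle.2 hk]⟩) hS.le
    · rw [hγξ, hcθ, smul_smul, div_mul_cancel₀ _ hS.ne']

/-- Two non-antipodal contacts with the sphere of radius `R` span a whole arc of contacts. -/
lemma IsChart.mem_of_arc {o : X} {ξ : X → E} (h : IsChart k o ξ) (H : HasCharts k X E)
    {L : Set X} {R : ℝ} (hcl : IsClosed L) (hcv : GConvex L) (hR0 : 0 < R)
    (hR : k = 1 → R < Real.pi / 2) (hsupp : ∀ y ∈ frontier L, LocSupp L y R) {c₁ c₂ c : X}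
    (h₁ : c₁ ∈ L) (h₂ : c₂ ∈ L) (hd₁ : dist o c₁ = R) (hd₂ : dist o c₂ = R)
    (hne : c₁ ≠ c₂) (hnanti : ξ c₂ ≠ -ξ c₁) (hd : dist o c = R) {α β : ℝ} (hα : 0 ≤ α)
    (hβ : 0 ≤ β) (hc : ξ c = α • ξ c₁ + β • ξ c₂) : c ∈ L := by
  have hfin : FiniteDimensional ℝ E := Module.finite_of_finrank_pos (by linarith [H.dim])
  have hk := H.curv
  have hpi := Real.pi_pos
  set ζ := dist c₁ c₂ / 2 with hζdef
  have hζ0 : 0 < ζ := half_pos (dist_pos.2 hne)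
  have hζR : ζ ≤ R := by
    have := dist_triangle_left c₁ c₂ o
    rw [hζdef]; linarith
  have hζ : k = 1 → ζ < Real.pi / 2 := fun h1 => by linarith [hR h1]
  obtain ⟨μ, hμ₁, hμ₂⟩ : ∃ μ, dist μ c₁ = ζ ∧ dist μ c₂ = ζ := by
    obtain ⟨ξ₁, g⟩ := H.chartAt c₁
    obtain ⟨θ, hθ, hcθ⟩ := g.exists_dir H c₂
    obtain ⟨γ, -, hγ0, hγv, hγξ, -, hγd⟩ := g.exists_geod H hθ
    have e : γ (dist c₁ c₂) = c₂ := g.ext H (by rw [hγξ, hcθ]) (by rw [hγv, vd])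
    have e2 : dist c₁ c₂ = 2 * ζ := by rw [hζdef]; ring
    refine ⟨γ ζ, ?_, ?_⟩
    · conv_lhs => rw [← hγ0]
      rw [hγd, sub_zero, abs_of_pos hζ0]
      intro h1
      rw [sub_zero, abs_of_pos hζ0]
      linarith [hζ h1]
    · conv_lhs => rw [← e]
      rw [hγd, e2, abs_sub_comm, abs_of_pos (by linarith)]
      · ring
      · intro h1
        rw [e2, abs_sub_comm, abs_of_pos (by linarith)]
        linarith [hζ h1]
  have h12 : dist c₁ c₂ = 2 * ζ := by rw [hζdef]; ring
  obtain ⟨ξ', h', hξ'⟩ := h.transfer H μ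
  have hneg := h'.eq_neg_of_dist H hμ₁ hμ₂ h12
  have hμo : μ ≠ o := by
    rintro rfl
    exact hnanti (h.eq_neg_of_dist H hμ₁ hμ₂ h12)
  set r := dist μ o with hr
  have hr0 : 0 < r := dist_pos.2 hμo
  have hrR : r < R := by
    refine H.dist_lt_of_btw (u := c₁) (w := c₂) ?_ ?_ ?_ ?_ ?_ hR
    · rw [Btw, dist_comm c₁ μ, hμ₁, hμ₂, h12]; ring
    · rw [← dist_pos, hμ₁]; exact hζ0
    · rw [← dist_pos, hμ₂]; exact hζ0
    · rw [dist_comm, hd₁]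
    · rw [dist_comm, hd₂]
  have hSr : 0 < snK k r := snK_pos hk hr0 fun h1 => by linarith [hR h1]
  have hSζ : 0 < snK k ζ := snK_pos hk hζ0 fun h1 => by linarith [hζ h1]
  have hSR : 0 < snK k R := snK_pos hk hR0 fun h1 => by linarith [hR h1]
  have hCr : 0 < 1 - k * vsK k r := csK_pos hk hr0.le fun h1 => by linarith [hR h1]
  have hCζ : 0 < 1 - k * vsK k ζ := csK_pos hk hζ0.le hζ
  have hvr : 0 ≤ vsK k r := vsK_nonneg hk r
  have l1 := h'.law o c₁
  have l2 := h'.law o c₂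
  rw [hneg, inner_neg_right] at l2
  rw [vd, vd, vd, hd₁, hμ₁, ← hr] at l1
  rw [vd, vd, vd, hd₂, hμ₂, ← hr] at l2
  have hperp : ⟪ξ' o, ξ' c₁⟫ = 0 := by linarith
  have hv : vsK k R = vsK k r + vsK k ζ - k * vsK k r * vsK k ζ := by linarith
  set f := (snK k ζ)⁻¹ • ξ' c₁ with hf
  set e := -((snK k r)⁻¹ • ξ' o) with he
  have hf1 : ‖f‖ = 1 := by
    rw [hf, norm_smul, h'.norm_eq H, hμ₁, norm_inv, Real.norm_of_nonneg hSζ.le,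
      inv_mul_cancel₀ hSζ.ne']
  have he1 : ‖e‖ = 1 := by
    rw [he, norm_neg, norm_smul, h'.norm_eq H, ← hr, norm_inv, Real.norm_of_nonneg hSr.le,
      inv_mul_cancel₀ hSr.ne']
  have hef : ⟪e, f⟫ = 0 := by
    rw [he, hf, inner_neg_left, real_inner_smul_left, real_inner_smul_right, hperp]
    simp
  have hc₁ : ξ' c₁ = snK k ζ • f := by
    rw [hf, smul_smul, mul_inv_cancel₀ hSζ.ne', one_smul]
  have hoe : ξ' o = -(snK k r • e) := by
    rw [he, smul_neg, neg_neg, smul_smul, mul_inv_cancel₀ hSr.ne', one_smul]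
  have hee : ⟪e, e⟫ = (1 : ℝ) := by rw [real_inner_self_eq_norm_sq, he1]; norm_num
  have hff : ⟪f, f⟫ = (1 : ℝ) := by rw [real_inner_self_eq_norm_sq, hf1]; norm_num
  have hfe : ⟪f, e⟫ = 0 := by rw [real_inner_comm, hef]
  -- the arc lies in the plane spanned by `e` and `f`
  have hμe : ∃ l : ℝ, ξ μ = l • e := by
    obtain ⟨l, hl⟩ := hξ' o
    rw [h.map_base H, zero_add, hoe] at hl
    have hl0 : l ≠ 0 := by
      rintro rfl
      rw [zero_smul, neg_eq_zero, smul_eq_zero] at hl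
      rcases hl with hl | hl
      · exact hSr.ne' hl
      · rw [hl, norm_zero] at he1; exact zero_ne_one he1
    refine ⟨-(l⁻¹ * snK k r), ?_⟩
    rw [← inv_smul_smul₀ hl0 (ξ μ), ← hl]
    module
  have hplane : ∃ A B : ℝ, ξ' c = A • e + B • f := by
    obtain ⟨l, hl⟩ := hμe
    obtain ⟨l₀, hl₀⟩ := hξ' c
    obtain ⟨l₁, hl₁⟩ := hξ' c₁
    obtain ⟨l₂, hl₂⟩ := hξ' c₂
    have e1 : ξ c₁ = snK k ζ • f - l₁ • l • e := by rw [← hc₁, hl₁, hl]; abel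
    have e2 : ξ c₂ = -(snK k ζ • f) - l₂ • l • e := by rw [← hc₁, ← hneg, hl₂, hl]; abel
    refine ⟨l₀ * l - α * l₁ * l - β * l₂ * l, (α - β) * snK k ζ, ?_⟩
    rw [hl₀, hc, e1, e2, hl]
    module
  obtain ⟨A, B, hAB⟩ := hplane
  have hAe : ⟪ξ' c, e⟫ = A := by
    rw [hAB, inner_add_left, real_inner_smul_left, real_inner_smul_left, hee, hfe]; ring
  have hBf : ⟪ξ' c, f⟫ = B := by
    rw [hAB, inner_add_left, real_inner_smul_left, real_inner_smul_left, hff, hef]; ring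
  have hαβ : 1 ≤ α + β := by
    have h1 := norm_add_le (α • ξ c₁) (β • ξ c₂)
    rw [← hc, norm_smul, norm_smul, h.norm_eq H, h.norm_eq H, h.norm_eq H, hd, hd₁, hd₂,
      Real.norm_of_nonneg hα, Real.norm_of_nonneg hβ, ← add_mul] at h1
    by_contra hlt
    nlinarith
  have hA : 0 ≤ A := by
    have hro : vd k μ o = vsK k r := rfl
    have hoc : vd k o c = vsK k R := by rw [vd, hd]
    have m1 := h.law μ c₁
    have m2 := h.law μ c₂
    have m := h.law μ c
    rw [vd, vd, vd, hd₁, hμ₁, dist_comm o μ, ← hr] at m1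
    rw [vd, vd, vd, hd₂, hμ₂, dist_comm o μ, ← hr] at m2
    rw [hc, inner_add_right, real_inner_smul_right, real_inner_smul_right, vd_comm k o μ,
      hoc] at m
    have n := h'.law c o
    rw [vd_comm k c o, hoc, hoe, inner_neg_right, real_inner_smul_right, hAe, hro] at n
    rw [hro] at m
    have hG : 0 ≤ ⟪ξ μ, ξ c₁⟫ := by
      have : ⟪ξ μ, ξ c₁⟫ = vsK k r * ((1 + (1 - k * vsK k r)) * (1 - k * vsK k ζ)) := by
        rw [hv] at m1
        linarith
      rw [this]
      positivity
    have hG2 : ⟪ξ μ, ξ c₂⟫ = ⟪ξ μ, ξ c₁⟫ := by linarith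
    rw [hG2] at m
    have hV : vd k μ c ≤ vsK k ζ := by
      have h1 : vsK k ζ - vd k μ c = (α + β - 1) * ⟪ξ μ, ξ c₁⟫ := by linarith
      have h2 := mul_nonneg (sub_nonneg.2 hαβ) hG
      linarith
    have : 0 ≤ snK k r * A := by
      have h1 : snK k r * A = (vsK k ζ - vd k μ c) * (1 - k * vsK k r) := by linarith
      rw [h1]
      exact mul_nonneg (sub_nonneg.2 hV) hCr.le
    exact nonneg_of_mul_nonneg_right this hSr
  have hμc : μ ≠ c := by
    rintro rfl
    rw [dist_comm] at hd
    linarith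
  have hμcπ : k = 1 → dist μ c < Real.pi := fun h1 => by
    have := dist_triangle μ o c
    linarith [hR h1]
  have : c ∈ closure L := by
    rw [mem_closure_iff_nhds]
    intro U hU
    obtain ⟨x, hxU, hxμ, hxc, hb, s, hs, hx⟩ := h'.exists_mem_nhds_ray H hμc hμcπ hU
    refine ⟨x, hxU, ?_⟩
    refine h'.mem_of_lens H hcv hR0 hR hsupp he1 hf1 hef hr0.le hrR hζ0 hζ h₁ h₂ hr.symm hoe
      hμ₁ hc₁ hμ₂ (by rw [hneg, hc₁]) hv ?_ ?_ ?_
    · rw [hx, real_inner_smul_left, real_inner_smul_left, hAe, hBf, hAB]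
      module
    · rw [hx, real_inner_smul_left, hAe]
      positivity
    · exact H.dist_lt_of_btw hb hxμ hxc hrR.le (by rw [dist_comm, hd]) hR
  exact hcl.closure_eq ▸ this

/-- A locally `R`-supported convex set inscribed in a ball of radius `R` with the centre in the
convex hull of the contacts is that ball. -/
lemma IsChart.eq_closedBall {o : X} {ξ : X → E} (h : IsChart k o ξ) (H : HasCharts k X E)
    {L : Set X} {R : ℝ} (hcl : IsClosed L) (hcv : GConvex L) (hR0 : 0 < R)
    (hR : k = 1 → R < Real.pi / 2) (hsupp : ∀ y ∈ frontier L, LocSupp L y R)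
    (hLo : L ⊆ closedBall o R) (h0 : (0 : E) ∈ convexHull ℝ (ξ '' (L ∩ sphere o R))) :
    L = closedBall o R := by
  have hfin : FiniteDimensional ℝ E := Module.finite_of_finrank_pos (by linarith [H.dim])
  have hk := H.curv
  have hpi := Real.pi_pos
  have admR : Adm k R := ⟨hR0.le, fun h1 => by linarith [hR h1]⟩
  have hSR : 0 < snK k R := snK_pos hk hR0 fun h1 => by linarith [hR h1]
  by_cases hanti : ∃ c₁ ∈ L, ∃ c₂ ∈ L, dist o c₁ = R ∧ dist o c₂ = R ∧ ξ c₂ = -ξ c₁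
  · obtain ⟨c₁, h₁, c₂, h₂, hd₁, hd₂, hneg⟩ := hanti
    set f := (snK k R)⁻¹ • ξ c₁ with hf
    have hf1 : ‖f‖ = 1 := by
      rw [hf, norm_smul, h.norm_eq H, hd₁, norm_inv, Real.norm_of_nonneg hSR.le,
        inv_mul_cancel₀ hSR.ne']
    have hff : ⟪f, f⟫ = (1 : ℝ) := by rw [real_inner_self_eq_norm_sq, hf1]; norm_num
    have hc₁ : ξ c₁ = snK k R • f := by
      rw [hf, smul_smul, mul_inv_cancel₀ hSR.ne', one_smul]
    have hball : ball o R ⊆ L := by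
      intro x hx
      obtain ⟨e, he1, hfe, hxe, hxe0⟩ : ∃ e, ‖e‖ = 1 ∧ ⟪f, e⟫ = 0 ∧
          ξ x = ⟪ξ x, e⟫ • e + ⟪ξ x, f⟫ • f ∧ 0 ≤ ⟪ξ x, e⟫ := by
        set w := ξ x - ⟪ξ x, f⟫ • f with hw
        have hxw : ξ x = w + ⟪ξ x, f⟫ • f := by rw [hw]; abel
        have hwf : ⟪f, w⟫ = 0 := by
          rw [hw, inner_sub_right, real_inner_smul_right, hff, real_inner_comm]; ring
        by_cases hw0 : w = 0
        · obtain ⟨e, he1, hfe⟩ := H.exists_perp f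
          have : ⟪ξ x, e⟫ = 0 := by
            rw [hxw, hw0, zero_add, real_inner_smul_left, hfe, mul_zero]
          refine ⟨e, he1, hfe, ?_, this.ge⟩
          rw [this, zero_smul, zero_add]
          rwa [hw0, zero_add] at hxw
        · have hwn := norm_pos_iff.2 hw0
          have : ⟪ξ x, (‖w‖)⁻¹ • w⟫ = ‖w‖ := by
            rw [real_inner_smul_right, hxw, inner_add_left, real_inner_smul_left, hwf,
              real_inner_self_eq_norm_sq]
            field_simp
            ring
          refine ⟨(‖w‖)⁻¹ • w, norm_smul_inv_norm hw0, ?_, ?_, ?_⟩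
          · rw [real_inner_smul_right, hwf, mul_zero]
          · rw [this, smul_smul, mul_inv_cancel₀ hwn.ne', one_smul]
            exact hxw
          · rw [this]; exact hwn.le
      refine h.mem_of_lens H hcv hR0 hR hsupp he1 hf1 (by rw [real_inner_comm, hfe]) le_rfl hR0
        hR0 hR h₁ h₂ (dist_self o) ?_ hd₁ hc₁ hd₂ (by rw [hneg, hc₁]) ?_ hxe hxe0 hx
      · rw [h.map_base H, snK_zero hk, zero_smul, neg_zero]
      · rw [vsK_zero hk]; ring
    refine hLo.antisymm fun c hc => ?_
    rcases (mem_closedBall'.1 hc).lt_or_eq with hlt | heq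
    · exact hball (mem_ball'.2 hlt)
    · have hoc : o ≠ c := by rw [← dist_pos, heq]; exact hR0
      have : c ∈ closure L := by
        rw [mem_closure_iff_nhds]
        intro U hU
        obtain ⟨x, hxU, hxo, hxc, hb, -⟩ := h.exists_mem_nhds_ray H hoc
          (fun h1 => by linarith [hR h1]) hU
        refine ⟨x, hxU, hball ?_⟩
        rw [mem_ball']
        have : 0 < dist x c := dist_pos.2 hxc
        rw [Btw] at hb
        linarith
      exact hcl.closure_eq ▸ this
  · exfalso
    push Not at hanti
    have hn : ∀ c, dist o c = R → ‖ξ c‖ = snK k R := fun c hc => by rw [h.norm_eq H, hc]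
    set D : Set E := {v | ∃ t : ℝ, 0 < t ∧ ∃ c ∈ L, dist o c = R ∧ v = t • ξ c} with hD
    have hDconv : Convex ℝ D := by
      rw [convex_iff_forall_pos]
      rintro _ ⟨t₁, ht₁, c₁, h₁, hd₁, rfl⟩ _ ⟨t₂, ht₂, c₂, h₂, hd₂, rfl⟩ a b ha hb -
      rw [smul_smul, smul_smul]
      have hp : 0 < a * t₁ := by positivity
      have hq : 0 < b * t₂ := by positivity
      generalize a * t₁ = p at hp
      generalize b * t₂ = q at hq
      by_cases hcc : c₁ = c₂
      · subst hcc
        exact ⟨p + q, by positivity, c₁, h₁, hd₁, by rw [add_smul]⟩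
      set w := p • ξ c₁ + q • ξ c₂ with hw
      have hw0 : w ≠ 0 := by
        intro hw0
        have e1 : p • ξ c₁ = -(q • ξ c₂) := eq_neg_of_add_eq_zero_left hw0
        have e2 := congrArg norm e1
        rw [norm_neg, norm_smul, norm_smul, hn _ hd₁, hn _ hd₂, Real.norm_of_nonneg hp.le,
          Real.norm_of_nonneg hq.le] at e2
        have e3 : p = q := mul_right_cancel₀ hSR.ne' e2
        rw [e3, ← smul_neg] at e1
        have e4 := smul_right_injective E hq.ne' e1
        exact hanti c₁ h₁ c₂ h₂ hd₁ hd₂ (by rw [e4, neg_neg])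
      have hwn := norm_pos_iff.2 hw0
      obtain ⟨c, hcd, hcξ⟩ := h.surj ((‖w‖)⁻¹ • w) R (norm_smul_inv_norm hw0) admR
      refine ⟨‖w‖ / snK k R, by positivity, c, ?_, hcd, ?_⟩
      · refine h.mem_of_arc H hcl hcv hR0 hR hsupp h₁ h₂ hd₁ hd₂ hcc
          (hanti c₁ h₁ c₂ h₂ hd₁ hd₂) hcd (α := snK k R * (‖w‖)⁻¹ * p)
          (β := snK k R * (‖w‖)⁻¹ * q) (by positivity) (by positivity) ?_
        rw [hcξ, hw]
        module
      · rw [hcξ, smul_smul, smul_smul]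
        field_simp
        rw [one_smul]
    have hsub : ξ '' (L ∩ sphere o R) ⊆ D := by
      rintro _ ⟨c, ⟨hc, hcs⟩, rfl⟩
      exact ⟨1, one_pos, c, hc, mem_sphere'.1 hcs, by rw [one_smul]⟩
    obtain ⟨t, ht, c, hc, hcd, h00⟩ := convexHull_min hsub hDconv h0
    have := congrArg norm h00
    rw [norm_zero, norm_smul, hn c hcd, Real.norm_of_nonneg ht.le] at this
    have : 0 < t * snK k R := by positivity
    linarith

end BallTheorem

section Hull

open scoped RealInnerProductSpace

variable {k : ℝ} {E : Type*} [NormedAddCommGroup E] [InnerProductSpace ℝ E]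

lemma subset_gconvexHull (Y : Set X) : Y ⊆ gconvexHull Y :=
  subset_sInter fun _ hC => hC.2

lemma gconvexHull_subset {Y C : Set X} (hC : GConvex C) (h : Y ⊆ C) : gconvexHull Y ⊆ C :=
  sInter_subset_of_mem ⟨hC, h⟩

lemma HasCharts.eq_of_btw_btw (H : HasCharts k X E) {m p z a : X} (hz : Btw m p z)
    (ha : Btw m p a) (hd : dist m z = dist m a) (hmp : m ≠ p)
    (hpi : k = 1 → dist m a < Real.pi) : z = a := by
  obtain ⟨ξ, h⟩ := H.chartAt m
  have hp := dist_pos.2 hmp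
  have hle : dist m p ≤ dist m a := by
    rw [← ha]; linarith [dist_nonneg (x := p) (y := a)]
  have hma : m ≠ a := dist_pos.1 (hp.trans_le hle)
  have hmz : m ≠ z := dist_pos.1 (by rw [hd]; exact hp.trans_le hle)
  have e1 := h.eq_smul_of_btw H hz hmz (by rw [hd]; exact hpi)
  have e2 := h.eq_smul_of_btw H ha hma hpi
  rw [hd] at e1
  refine h.ext H ?_ (by rw [vd, vd, hd])
  refine smul_right_injective E ?_ (e1.symm.trans e2)
  have h1 := snK_pos H.curv hp fun hk => by linarith [hpi hk]
  have h2 := snK_pos H.curv (hp.trans_le hle) hpi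
  positivity

lemma HasCharts.gconvex_ball_union (H : HasCharts k X E) {m a b : X} {r : ℝ}
    (hr : k = 1 → r < Real.pi / 2) (ha : dist a m ≤ r) (hb : dist b m ≤ r) :
    GConvex (ball m r ∪ {a, b}) := by
  have hsub : ∀ x ∈ ball m r ∪ {a, b}, dist x m ≤ r := by
    rintro x (hx | rfl | rfl)
    · exact (mem_ball.1 hx).le
    · exact ha
    · exact hb
  intro x hx y hy z hz
  by_cases hzx : z = x
  · rwa [hzx]
  by_cases hzy : z = y
  · rwa [hzy]
  exact Or.inl (H.dist_lt_of_btw hz.1 hzx hzy (hsub x hx) (hsub y hy) hr)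

lemma HasCharts.uniqueDiametral_hull (H : HasCharts k X E) {m a b : X} {r : ℝ} {Y : Set X}
    (hr0 : 0 < r) (hr : k = 1 → r < Real.pi / 2) (hY : Y ⊆ closedBall m r) (ha : a ∈ Y)
    (hb : b ∈ Y) (hab : dist a b = 2 * r) (hext : ∀ z ∈ Y, dist z m = r → z = a ∨ z = b) :
    diam (gconvexHull Y) = 2 * r ∧ UniqueDiametral (gconvexHull Y) a b := by
  have hsub : gconvexHull Y ⊆ ball m r ∪ {a, b} := by
    refine gconvexHull_subset (H.gconvex_ball_union hr (hY ha) (hY hb)) fun z hz => ?_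
    rcases (mem_closedBall.1 (hY hz)).lt_or_eq with h | h
    · exact Or.inl h
    · exact Or.inr (hext z hz h)
  have hsub' : gconvexHull Y ⊆ closedBall m r :=
    gconvexHull_subset (H.gconvex_closedBall m hr) hY
  have haM := subset_gconvexHull Y ha
  have hbM := subset_gconvexHull Y hb
  have hdiam : diam (gconvexHull Y) = 2 * r := by
    apply le_antisymm
    · exact (diam_mono hsub' isBounded_closedBall).trans (diam_closedBall hr0.le)
    · rw [← hab]
      exact dist_le_diam_of_mem (isBounded_closedBall.subset hsub') haM hbM
  refine ⟨hdiam, haM, hbM, dist_pos.1 (by rw [hab]; linarith), by rw [hab, hdiam], ?_⟩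
  intro a' ha' b' hb' hd
  rw [hdiam] at hd
  have h1 := dist_triangle_right a' b' m
  have h2 := mem_closedBall.1 (hsub' ha')
  have h3 := mem_closedBall.1 (hsub' hb')
  have h4 : a' = a ∨ a' = b := by
    rcases hsub ha' with h | h
    · have := mem_ball.1 h; linarith
    · exact h
  have h5 : b' = a ∨ b' = b := by
    rcases hsub hb' with h | h
    · have := mem_ball.1 h; linarith
    · exact h
  have h6 : a' ≠ b' := dist_pos.1 (by rw [hd]; linarith)
  rcases h4 with rfl | rfl <;> rcases h5 with rfl | rfl
  · exact absurd rfl h6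
  · exact Or.inl ⟨rfl, rfl⟩
  · exact Or.inr ⟨rfl, rfl⟩
  · exact absurd rfl h6

/-- Near the far endpoint of the smaller ball, the hull of two balls is in the first ball. -/
lemma HasCharts.hull_near (H : HasCharts k X E) {a p q : X} {R c R' : ℝ} {Y : Set X}
    (hR0 : 0 < R) (hR'0 : 0 < R') (hap : dist a p = R) (hpq : dist p q = c)
    (haq : dist a q = R + c) (hRℓ : R < (R + c + R') / 2) (hR'ℓ : R' < (R + c + R') / 2)
    (hℓ : k = 1 → R + c + R' < Real.pi) (hY : Y ⊆ closedBall p R ∪ closedBall q R') :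
    ∃ U ∈ nhds a, gconvexHull Y ∩ U ⊆ closedBall p R := by
  have hk := H.curv
  have hpi := Real.pi_pos
  obtain ⟨ρ, hρ1, hρ2, hρ3⟩ : ∃ ρ, (R + c + R') / 2 < ρ ∧ ρ < R + c ∧
      (k = 1 → ρ < Real.pi / 2) := by
    by_cases h1 : k = 1
    · obtain ⟨ρ, h2, h3⟩ := exists_between (show (R + c + R') / 2 < min (R + c) (Real.pi / 2) from
        lt_min (by linarith) (by linarith [hℓ h1]))
      exact ⟨ρ, h2, h3.trans_le (min_le_left _ _), fun _ => h3.trans_le (min_le_right _ _)⟩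
    · obtain ⟨ρ, h2, h3⟩ := exists_between (show (R + c + R') / 2 < R + c by linarith)
      exact ⟨ρ, h2, h3, fun h => absurd h h1⟩
  obtain ⟨ξ, h⟩ := H.chartAt p
  have hSR : 0 < snK k R := snK_pos hk hR0 fun h1 => by linarith [hℓ h1]
  have admρ' : Adm k (ρ - R') := ⟨by linarith, fun h1 => by linarith [hρ3 h1]⟩
  have admρR : Adm k (ρ - R) := ⟨by linarith, fun h1 => by linarith [hρ3 h1]⟩
  set J : X → ℝ := fun w => vsK k (ρ - R) + vsK k c - k * vsK k (ρ - R) * vsK k c +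
    snK k (ρ - R) / snK k (dist p w) * ⟪ξ w, ξ q⟫ with hJ
  have hJa : J a < vsK k (ρ - R') := by
    have e1 : ⟪ξ a, ξ q⟫ = -(snK k R * snK k c) := by
      have := h.law a q
      rw [vd, vd, vd, haq, dist_comm p a, hap, hpq, vsK_add hk] at this
      linarith
    have e2 : J a = vsK k (c - (ρ - R)) := by
      simp only [hJ]
      rw [e1, dist_comm p a, hap, vsK_sub hk c (ρ - R)]
      field_simp
      ring
    rw [e2]
    exact vsK_lt hk (by linarith) admρ' (by linarith)
  have hSc := continuous_snK hk
  have hξc := h.continuous H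
  have hJc : ContinuousAt J a := by
    have h1 : Continuous fun w => snK k (dist p w) := by fun_prop
    have h2 : ContinuousAt (fun w => snK k (ρ - R) / snK k (dist p w)) a :=
      continuousAt_const.div h1.continuousAt (by rw [dist_comm, hap]; exact hSR.ne')
    have h3 : ContinuousAt (fun w => ⟪ξ w, ξ q⟫) a := by fun_prop
    exact continuousAt_const.add (h2.mul h3)
  have ev1 : ∀ᶠ w in nhds a, J w < vsK k (ρ - R') := hJc.eventually (eventually_lt_nhds hJa)
  have ev2 : ∀ᶠ w in nhds a, k = 1 → dist p w < Real.pi - (ρ - R) := by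
    by_cases h1 : k = 1
    · have : Continuous fun w => dist p w := by fun_prop
      exact (this.continuousAt.eventually (eventually_lt_nhds
        (show dist p a < Real.pi - (ρ - R) by
          rw [dist_comm, hap]; linarith [hρ3 h1]))).mono fun _ h _ => h
    · exact Eventually.of_forall fun _ h => absurd h h1
  refine ⟨_, ev1.and ev2, ?_⟩
  rintro w ⟨hw, hw1, hw2⟩
  by_contra hwp
  rw [mem_closedBall', not_le] at hwp
  obtain ⟨θ, hθ, hwθ⟩ := h.exists_dir H w
  obtain ⟨m, hmd, hmξ⟩ := h.surj (-θ) (ρ - R) (by rw [norm_neg, hθ]) admρR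
  have hSw : 0 < snK k (dist p w) :=
    snK_pos hk (by linarith) fun h1 => by linarith [hw2 h1]
  have hθθ : ⟪θ, θ⟫ = (1 : ℝ) := by rw [real_inner_self_eq_norm_sq, hθ]; norm_num
  have h1 : gconvexHull Y ⊆ closedBall m ρ := by
    refine gconvexHull_subset (H.gconvex_closedBall m hρ3) (hY.trans (union_subset ?_ ?_))
    · exact closedBall_subset_closedBall' (by rw [hmd]; linarith)
    · refine closedBall_subset_closedBall' ?_
      have : dist q m ≤ ρ - R' := by
        rw [dist_comm, ← H.vd_le_iff admρ', h.law, vd, vd, hmd, hpq, hmξ]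
        rw [real_inner_smul_left, inner_neg_left]
        refine le_trans (le_of_eq ?_) hw1.le
        simp only [hJ]
        rw [hwθ, real_inner_smul_left]
        field_simp
        ring
      linarith
  have h2 := mem_closedBall'.1 (h1 hw)
  rw [← H.vd_le_iff ⟨by linarith, fun h1 => by linarith [hρ3 h1]⟩, h.law, vd, vd, hmd, hmξ, hwθ,
    real_inner_smul_left, real_inner_smul_right, inner_neg_left, hθθ] at h2
  have h3 : vsK k ρ < vsK k ((ρ - R) + dist p w) := vsK_lt hk (by linarith)
    ⟨by linarith, fun h1 => by linarith [hw2 h1]⟩ (by linarith)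
  rw [vsK_add hk] at h3
  linarith

lemma IsChart.inner_eq_zero_of_onLine {b : X} {ξ : X → E} (h : IsChart k b ξ)
    (H : HasCharts k X E) {a z w : X} (hz : OnLine b a z) (hab : ξ a ≠ 0)
    (hw : ⟪ξ w, ξ a⟫ = 0) : ⟪ξ w, ξ z⟫ = 0 := by
  have hsq : ⟪ξ z, ξ a⟫ ^ 2 = (snK k (dist b z) * snK k (dist b a)) ^ 2 := by
    rcases hz with hz | hz | hz
    · rw [h.inner_of_btw H hz]
    · have h1 := h.law z a
      rw [Btw] at hz
      rw [vd, vd, vd, ← hz, dist_comm z b, vsK_add H.curv] at h1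
      have : ⟪ξ z, ξ a⟫ = -(snK k (dist b z) * snK k (dist b a)) := by linarith
      rw [this, neg_sq]
    · rw [real_inner_comm, h.inner_of_btw H hz]; ring
  have ha : snK k (dist b a) ≠ 0 := by
    rw [← h.norm_eq H]; exact norm_ne_zero_iff.2 hab
  have hnorm : ‖ξ z - (⟪ξ z, ξ a⟫ / snK k (dist b a) ^ 2) • ξ a‖ ^ 2 = 0 := by
    rw [← real_inner_self_eq_norm_sq, inner_sub_left, inner_sub_right, inner_sub_right,
      real_inner_smul_left, real_inner_smul_right, real_inner_smul_left,
      real_inner_smul_right, real_inner_self_eq_norm_sq, real_inner_self_eq_norm_sq,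
      h.norm_eq H, h.norm_eq H, real_inner_comm (ξ z) (ξ a)]
    field_simp
    linarith
  have e := sub_eq_zero.1 (norm_eq_zero.1 (pow_eq_zero_iff two_ne_zero |>.1 hnorm))
  rw [e, real_inner_smul_right, hw, mul_zero]

/-- Near `b`, the ball with diameter `[a, b]` lies in the cylinder about `[a, b]`. -/
lemma HasCharts.ball_near_subset_segCyl (H : HasCharts k X E) {a b m : X} {r ε : ℝ}
    (hr0 : 0 < r) (hr : k = 1 → r < Real.pi / 2) (ham : dist a m = r) (hmb : dist m b = r)
    (hab : dist a b = 2 * r) (hε : 0 < ε) :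
    ∃ U ∈ nhds b, closedBall m r ∩ U ⊆ segCyl a b ε := by
  have hk := H.curv
  have hpi := Real.pi_pos
  obtain ⟨s, hs0, hsε, hs1, hsπ⟩ : ∃ s, 0 < s ∧ 2 * s ≤ ε ∧ 2 * s ≤ 1 ∧
      (k = 1 → 2 * r + s < Real.pi) := by
    by_cases h1 : k = 1
    · obtain ⟨s, h2, h3⟩ := exists_between (show 0 < min (min (ε / 2) (1 / 2)) (Real.pi - 2 * r)
        from lt_min (lt_min (by linarith) (by norm_num)) (by linarith [hr h1]))
      have h4 := h3.trans_le (min_le_left _ _)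
      have h5 := h3.trans_le (min_le_right _ _)
      have h6 := h4.trans_le (min_le_left _ _)
      have h7 := h4.trans_le (min_le_right _ _)
      exact ⟨s, h2, by linarith, by linarith, fun _ => by linarith⟩
    · obtain ⟨s, h2, h3⟩ := exists_between (show 0 < min (ε / 2) (1 / 2)
        from lt_min (by linarith) (by norm_num))
      have h6 := h3.trans_le (min_le_left _ _)
      have h7 := h3.trans_le (min_le_right _ _)
      exact ⟨s, h2, by linarith, by linarith, fun h => absurd h h1⟩
  obtain ⟨ξ, h⟩ := H.chartAt a
  obtain ⟨χ, g⟩ := H.chartAt b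
  have hSℓ : 0 < snK k (2 * r) := snK_pos hk (by linarith) fun h1 => by linarith [hr h1]
  have hSs : 0 < snK k s := snK_pos hk hs0 fun h1 => by linarith [hsπ h1]
  have hSr : 0 < snK k r := snK_pos hk hr0 fun h1 => by linarith [hr h1]
  have hba : b ≠ a := by rw [ne_comm, ← dist_pos, hab]; linarith
  have hχa : χ a ≠ 0 := by
    rw [← norm_ne_zero_iff, g.norm_eq H, dist_comm, hab]; exact hSℓ.ne'
  have hχ : ∀ p, ⟪χ p, χ a⟫ =
      vd k b p * (1 - k * vsK k (2 * r)) + vsK k (2 * r) - vd k a p := by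
    intro p
    have h1 := g.law p a
    have h2 : vd k b a = vsK k (2 * r) := by rw [vd, dist_comm, hab]
    rw [vd_comm k p a, h2] at h1
    linarith
  have hpos : ∀ w ∈ closedBall m r, 0 ≤ ⟪χ w, χ a⟫ := by
    intro w hw
    have hbma : Btw b m a := by
      rw [Btw, dist_comm b m, hmb, dist_comm m a, ham, dist_comm, hab]; ring
    have e := g.eq_smul_of_btw H hbma hba fun h1 => by
      rw [dist_comm, hab]; linarith [hr h1]
    rw [dist_comm b m, hmb, dist_comm b a, hab] at e
    have e2 : χ a = (snK k (2 * r) / snK k r) • χ m := by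
      rw [e, smul_smul]
      field_simp
      rw [one_smul]
    have h1 := g.law w m
    have h2 : vd k b m = vsK k r := by rw [vd, dist_comm, hmb]
    have h3 : vd k w m ≤ vsK k r :=
      (H.vd_le_iff ⟨hr0.le, fun h1 => by linarith [hr h1]⟩).2 hw
    have h4 := mul_nonneg (H.vd_nonneg b w) (csK_pos hk hr0.le hr).le
    rw [h2] at h1
    rw [e2, real_inner_smul_right]
    have : 0 ≤ ⟪χ w, χ m⟫ := by linarith
    positivity
  set J : X → ℝ := fun w => (vsK k (2 * r) + vsK k (dist a w + s)
    - k * vsK k (2 * r) * vsK k (dist a w + s)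
    - snK k (dist a w + s) / snK k (dist a w) * ⟪ξ w, ξ b⟫) * (1 - k * vsK k (2 * r))
    + vsK k (2 * r) - vsK k (dist a w + s) with hJ
  have hJb : J b < 0 := by
    have e1 : J b = -(snK k (2 * r) * snK k s) := by
      have e2 : vsK k s = vsK k ((2 * r + s) - 2 * r) := by ring_nf
      have e3 := vsK_add hk (2 * r) s
      rw [vsK_sub hk] at e2
      simp only [hJ]
      rw [hab, real_inner_self_eq_norm_sq, h.norm_eq H, hab]
      have e4 : snK k (2 * r + s) / snK k (2 * r) * snK k (2 * r) ^ 2 =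
          snK k (2 * r + s) * snK k (2 * r) := by field_simp
      rw [e4]
      have e5 : vsK k (2 * r) + vsK k (2 * r + s) - k * vsK k (2 * r) * vsK k (2 * r + s)
          - snK k (2 * r + s) * snK k (2 * r) = vsK k s := by rw [e2]; ring
      rw [e5]
      linarith
    rw [e1, neg_lt_zero]
    positivity
  have hSc := continuous_snK hk
  have hvc := continuous_vsK hk
  have hξc := h.continuous H
  have hJc : ContinuousAt J b := by
    have h1 : ContinuousAt (fun w => snK k (dist a w + s) / snK k (dist a w)) b :=
      ContinuousAt.div (by fun_prop) (by fun_prop) (by rw [hab]; exact hSℓ.ne')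
    have h2 : ContinuousAt (fun w => vsK k (dist a w + s)) b := by fun_prop
    have h3 : ContinuousAt (fun w => ⟪ξ w, ξ b⟫) b := by fun_prop
    exact ((((continuousAt_const.add h2).sub (continuousAt_const.mul h2)).sub
      (h1.mul h3)).mul continuousAt_const).add continuousAt_const |>.sub h2
  have ev1 : ∀ᶠ w in nhds b, J w < 0 := hJc.eventually (eventually_lt_nhds hJb)
  have ev2 : ∀ᶠ w in nhds b, dist w b < s := ball_mem_nhds b hs0
  have hda : Continuous fun w => dist a w := by fun_prop
  have ev3 : ∀ᶠ w in nhds b, k = 1 → dist a w < Real.pi - s := by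
    by_cases h1 : k = 1
    · exact (hda.continuousAt.eventually (eventually_lt_nhds
        (show dist a b < Real.pi - s by rw [hab]; linarith [hsπ h1]))).mono fun _ h _ => h
    · exact Eventually.of_forall fun _ h => absurd h h1
  have ev4 : ∀ᶠ w in nhds b, 0 < dist a w :=
    hda.continuousAt.eventually (eventually_gt_nhds (show 0 < dist a b by rw [hab]; linarith))
  refine ⟨_, (ev1.and ev2).and (ev3.and ev4), ?_⟩
  rintro w ⟨hw, ⟨hw1, hw2⟩, hw3, hw4⟩
  obtain ⟨θ, hθ, hwθ⟩ := h.exists_dir H w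
  obtain ⟨γ, hγc, hγ0, hγv, hγξ, -, hγd⟩ := h.exists_geod H hθ
  have hSw : 0 < snK k (dist a w) := snK_pos hk hw4 fun h1 => by linarith [hw3 h1]
  have hwγ : γ (dist a w) = w := h.ext H (by rw [hγξ, hwθ]) (by rw [hγv, vd])
  obtain ⟨t, ⟨ht1, ht2⟩, ht⟩ : ∃ t ∈ Icc (dist a w) (dist a w + s), ⟪χ (γ t), χ a⟫ = 0 := by
    have hcont : ContinuousOn (fun t => ⟪χ (γ t), χ a⟫) (Icc (dist a w) (dist a w + s)) :=
      (((g.continuous H).comp hγc).inner continuous_const).continuousOn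
    have := intermediate_value_Icc' (by linarith) hcont
    refine this ⟨?_, ?_⟩
    · refine le_trans (le_of_eq ?_) hw1.le
      show ⟪χ (γ (dist a w + s)), χ a⟫ = J w
      simp only [hJ]
      have e1 : vd k a b = vsK k (2 * r) := by rw [vd, hab]
      rw [hχ, h.law b, hγv, hγξ, real_inner_smul_right, hwθ, real_inner_smul_left, e1,
        real_inner_comm (ξ b) θ]
      field_simp
    · show 0 ≤ ⟪χ (γ (dist a w)), χ a⟫
      rw [hwγ]
      exact hpos w hw
  have htπ : k = 1 → t < Real.pi := fun h1 => by linarith [hw3 h1]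
  have d1 : dist a (γ t) = t := by
    conv_lhs => rw [← hγ0]
    rw [hγd, zero_sub, abs_neg, abs_of_pos (by linarith)]
    intro h1
    rw [zero_sub, abs_neg, abs_of_pos (by linarith)]
    exact (htπ h1).le
  have d2 : dist w (γ t) = t - dist a w := by
    conv_lhs => rw [← hwγ]
    rw [hγd, abs_sub_comm, abs_of_nonneg (by linarith)]
    intro h1
    rw [abs_sub_comm, abs_of_nonneg (by linarith)]
    linarith [htπ h1]
  have d3 : dist (γ t) b ≤ 2 * s := by
    have := dist_triangle (γ t) w b
    rw [dist_comm (γ t) w, d2] at this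
    linarith
  have hmem : γ t ∈ perpDisc b a ε := by
    refine ⟨fun z hz => ?_, by linarith⟩
    have h0 := g.inner_eq_zero_of_onLine H hz hχa ht
    have h1 := g.law (γ t) z
    have h2 := mul_nonneg (H.vd_nonneg b z) (csK_pos hk (dist_nonneg (x := b) (y := γ t))
      fun _ => by rw [dist_comm]; linarith [Real.pi_gt_three]).le
    rw [← H.vd_le_vd, h1, h0, vd_comm k (γ t) b]
    have h3 : vd k b (γ t) = vsK k (dist b (γ t)) := rfl
    rw [h3]
    linarith
  have hmem' : a ∈ perpDisc a b ε :=
    ⟨fun z _ => by rw [dist_self]; exact dist_nonneg, by rw [dist_self]; exact hε.le⟩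
  rw [segCyl, gconvexHull, mem_sInter]
  rintro C ⟨hC, hCs⟩
  refine hC a (hCs (Or.inl hmem')) (γ t) (hCs (Or.inr hmem)) w (H.unique_of_btw ?_ ?_ ?_)
  · rw [Btw, d1, d2]; ring
  · rw [← dist_pos, d1]; linarith
  · rw [d1]; exact htπ

end Hull

/-- The part of the hull close to the diametral
segment is invariant under an isometry interchanging the endpoints of that segment. -/
def HasSwaps (d : ℕ) (K L : Set X) : Prop :=
  ∃ δ > (0 : ℝ), ∀ φ ψ : X ≃ᵢ X, GoodPair d K L φ ψ →
    ∀ x ∈ frontier K, ∀ y ∈ frontier L,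
      BigDiam d X (hullUnion K L φ ψ) δ →
      UniqueDiametral (hullUnion K L φ ψ) (φ x) (ψ y) →
      ∃ ε > (0 : ℝ), ∃ σ : X ≃ᵢ X, σ (φ x) = ψ y ∧ σ (ψ y) = φ x ∧
        ⇑σ '' (hullUnion K L φ ψ ∩ segCyl (φ x) (ψ y) ε) =
          hullUnion K L φ ψ ∩ segCyl (φ x) (ψ y) ε

lemma segCyl_comm (a b : X) (ε : ℝ) : segCyl a b ε = segCyl b a ε := by
  rw [segCyl, segCyl, union_comm]

lemma left_mem_segCyl (a b : X) {ε : ℝ} (hε : 0 ≤ ε) : a ∈ segCyl a b ε :=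
  subset_gconvexHull _ (Or.inl ⟨fun z _ => by simp, by simpa using hε⟩)

lemma UniqueDiametral.symm {M : Set X} {a b : X} (h : UniqueDiametral M a b) :
    UniqueDiametral M b a := by
  obtain ⟨h1, h2, h3, h4, h5⟩ := h
  exact ⟨h2, h1, h3.symm, by rw [dist_comm, h4], fun a' ha' b' hb' hd => (h5 a' ha' b' hb' hd).symm⟩

lemma hullUnion_comm (K L : Set X) (φ ψ : X ≃ᵢ X) : hullUnion K L φ ψ = hullUnion L K ψ φ := by
  rw [hullUnion, hullUnion, union_comm]

lemma T7Cond5.hasSwaps {d : ℕ} {K L : Set X} (h : T7Cond5 d K L) : HasSwaps d K L := by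
  obtain ⟨δ, hδ, h⟩ := h
  refine ⟨δ, hδ, fun φ ψ hg x hx y hy hb hu => ?_⟩
  obtain ⟨ε₀, hε₀, h⟩ := h φ ψ hg x hx y hy hb hu
  obtain ⟨-, σ, p, hinv, hp, hS, hmid⟩ := h (ε₀ / 2) (by linarith) (by linarith)
  have hε : 0 ≤ ε₀ / 2 := by linarith
  set S := hullUnion K L φ ψ ∩ segCyl (φ x) (ψ y) (ε₀ / 2) with hSdef
  obtain ⟨h1, h2, h3, h4, h5⟩ := hu
  have ha : φ x ∈ S := ⟨h1, left_mem_segCyl _ _ hε⟩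
  have hb' : ψ y ∈ S := ⟨h2, by rw [segCyl_comm]; exact left_mem_segCyl _ _ hε⟩
  have hm : ∀ z ∈ S, σ z ∈ S := fun z hz => by rw [← hS]; exact mem_image_of_mem _ hz
  refine ⟨ε₀ / 2, by linarith, σ, ?_⟩
  rw [← hSdef]
  rcases h5 _ (hm _ ha).1 _ (hm _ hb').1 (by rw [σ.dist_eq, h4]) with ⟨e1, e2⟩ | ⟨e1, e2⟩
  · exfalso
    have m1 := hmid _ ha
    have m2 := hmid _ hb'
    rw [e1] at m1
    rw [e2] at m2
    have := m1.1
    have h6 := m2.1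
    rw [Btw, dist_self] at this h6
    have i1 : dist (φ x) p = 0 := by linarith [@dist_nonneg _ _ (φ x) p, @dist_nonneg _ _ p (φ x)]
    have i2 : dist (ψ y) p = 0 := by linarith [@dist_nonneg _ _ (ψ y) p, @dist_nonneg _ _ p (ψ y)]
    exact h3 ((dist_eq_zero.1 i1).trans (dist_eq_zero.1 i2).symm)
  · exact ⟨e1, e2, hS⟩

lemma T7Cond6.hasSwaps {d : ℕ} {K L : Set X} (h : T7Cond6 d K L) : HasSwaps d K L := by
  obtain ⟨δ, hδ, h⟩ := h
  refine ⟨δ, hδ, fun φ ψ hg x hx y hy hb hu => ?_⟩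
  obtain ⟨ε₀, hε₀, h⟩ := h φ ψ hg x hx y hy hb hu
  obtain ⟨-, σ, hσ, hab, hS⟩ := h (ε₀ / 2) (by linarith) (by linarith)
  refine ⟨ε₀ / 2, by linarith, σ, hab, ?_, hS⟩
  rw [← hab]
  exact DFunLike.congr_fun hσ.1 (φ x)

lemma HasSwaps.symm {d : ℕ} {K L : Set X} (h : HasSwaps d K L) : HasSwaps d L K := by
  obtain ⟨δ, hδ, h⟩ := h
  refine ⟨δ, hδ, fun φ ψ hg x hx y hy hb hu => ?_⟩
  rw [hullUnion_comm] at hb hu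
  obtain ⟨ε, hε, σ, h1, h2, h3⟩ := h ψ φ ⟨hg.2.1, hg.1, fun hs => by
    rw [union_comm]; exact hg.2.2 hs⟩ y hy x hx hb hu.symm
  refine ⟨ε, hε, σ, h2, h1, ?_⟩
  rwa [hullUnion_comm, segCyl_comm]

section Transfer
open scoped RealInnerProductSpace
variable {k : ℝ} {E : Type*} [NormedAddCommGroup E] [InnerProductSpace ℝ E]

lemma exists_large_length {d : ℕ} (hs : IsSphereSpace X d ↔ k = 1)
    {R R' δ : ℝ} (hR0 : 0 < R) (hR'0 : 0 < R') (hδ : 0 < δ)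
    (hR : k = 1 → R < Real.pi / 2) (hR' : k = 1 → R' < Real.pi / 2) :
    ∃ l : ℝ, 2 * R < l ∧ 2 * R' < l ∧ (k = 1 → l < Real.pi) ∧
      (IsSphereSpace X d → Real.pi - δ < l) ∧ (¬ IsSphereSpace X d → 1 / δ < l) := by
  by_cases hk : k = 1
  · have h1 := hR hk
    have h2 := hR' hk
    obtain ⟨l, hl1, hl2⟩ := exists_between (show max (max (2 * R) (2 * R')) (Real.pi - δ) < Real.pi
      from max_lt (max_lt (by linarith) (by linarith)) (by linarith))
    simp only [max_lt_iff] at hl1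
    exact ⟨l, hl1.1.1, hl1.1.2, fun _ => hl2, fun _ => hl1.2, fun h => absurd (hs.2 hk) h⟩
  · refine ⟨2 * R + 2 * R' + 1 / δ + 1, ?_, ?_, fun h => absurd h hk,
      fun h => absurd (hs.1 h) hk, fun _ => ?_⟩ <;>
    · have : 0 < 1 / δ := by positivity
      linarith

/-- If the hulls of `K ∪ L` have enough swaps, the radius of a ball touching `K` at a boundary
point is inherited by local supporting balls of `L`. -/
lemma HasCharts.locSupp_of_hasSwaps (H : HasCharts k X E) {d : ℕ}
    (hs : IsSphereSpace X d ↔ k = 1) {K L : Set X} (hsw : HasSwaps d K L)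
    {p x q y : X} {R R' : ℝ} (hR0 : 0 < R) (hR'0 : 0 < R')
    (hR : k = 1 → R < Real.pi / 2) (hR' : k = 1 → R' < Real.pi / 2)
    (hK : K ⊆ closedBall p R) (hx : x ∈ K) (hxf : x ∈ frontier K) (hpx : dist p x = R)
    (hL : L ⊆ closedBall q R') (hy : y ∈ L) (hyf : y ∈ frontier L) (hqy : dist q y = R') :
    LocSupp L y R := by
  obtain ⟨δ, hδ, hsw⟩ := hsw
  obtain ⟨l, hl1, hl2, hlpi, hls, hle⟩ := exists_large_length hs hR0 hR'0 hδ hR hR'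
  obtain ⟨ξ, h⟩ := H.chartAt x
  obtain ⟨θ, hθ, hpθ⟩ := h.exists_dir H p
  obtain ⟨γ, -, hγ0, hγ1, hγ2, -, hγd⟩ := h.exists_geod H hθ
  have hD : ∀ s t, 0 ≤ s → s ≤ l → 0 ≤ t → t ≤ l → dist (γ s) (γ t) = |s - t| := by
    intro s t h1 h2 h3 h4
    refine hγd s t fun hk => ?_
    have := hlpi hk
    rw [abs_le]
    constructor <;> linarith
  have hxp : dist x p = R := by rw [dist_comm, hpx]
  have hγp : γ R = p := by
    refine h.ext H ?_ ?_
    · rw [hγ2, hpθ, hxp]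
    · rw [hγ1, vd, hxp]
  set q' := γ (l - R') with hq'
  set m := γ (l / 2) with hm
  set b := γ l with hb
  have dpq : dist p q' = l - R - R' := by
    rw [← hγp, hq', hD _ _ (by linarith) (by linarith) (by linarith) (by linarith), abs_sub_comm,
      abs_of_nonneg (by linarith)]
    ring
  have dxq : dist x q' = l - R' := by
    rw [← hγ0, hq', hD _ _ (by linarith) (by linarith) (by linarith) (by linarith), abs_sub_comm,
      abs_of_nonneg (by linarith)]
    ring
  have dxm : dist x m = l / 2 := by
    rw [← hγ0, hm, hD _ _ (by linarith) (by linarith) (by linarith) (by linarith), abs_sub_comm,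
      abs_of_nonneg (by linarith)]
    ring
  have dxb : dist x b = 2 * (l / 2) := by
    rw [← hγ0, hb, hD _ _ (by linarith) (by linarith) (by linarith) (by linarith), abs_sub_comm,
      abs_of_nonneg (by linarith)]
    ring
  have dmb : dist m b = l / 2 := by
    rw [hm, hb, hD _ _ (by linarith) (by linarith) (by linarith) (by linarith), abs_sub_comm,
      abs_of_nonneg (by linarith)]
    ring
  have dmp : dist m p = l / 2 - R := by
    rw [← hγp, hm, hD _ _ (by linarith) (by linarith) (by linarith) (by linarith),
      abs_of_nonneg (by linarith)]
  have dmq : dist m q' = l / 2 - R' := by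
    rw [hq', hm, hD _ _ (by linarith) (by linarith) (by linarith) (by linarith), abs_sub_comm,
      abs_of_nonneg (by linarith)]
    ring
  have dqb : dist q' b = R' := by
    rw [hq', hb, hD _ _ (by linarith) (by linarith) (by linarith) (by linarith), abs_sub_comm,
      abs_of_nonneg (by linarith)]
    ring
  obtain ⟨ψ, hψo, hψq, hψy⟩ := H.exists_motion (hqy.trans dqb.symm)
  set φ := IsometryEquiv.refl X with hφ
  have hψL : ⇑ψ '' L ⊆ closedBall q' R' := by
    rintro _ ⟨z, hz, rfl⟩
    rw [mem_closedBall, ← hψq, ψ.dist_eq]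
    exact hL hz
  have hφK : ⇑φ '' K ⊆ closedBall p R := by
    rintro _ ⟨z, hz, rfl⟩
    exact hK hz
  set Y := (⇑φ '' K) ∪ (⇑ψ '' L) with hY
  have hYsub : Y ⊆ closedBall p R ∪ closedBall q' R' := union_subset_union hφK hψL
  have hYm : Y ⊆ closedBall m (l / 2) := by
    intro z hz
    rw [mem_closedBall]
    rcases hYsub hz with h1 | h1
    · linarith [dist_triangle_right z m p, mem_closedBall.1 h1]
    · linarith [dist_triangle_right z m q', mem_closedBall.1 h1]
  have hl0 : 0 < l / 2 := by linarith
  have hlpi2 : k = 1 → l / 2 < Real.pi / 2 := fun hk => by linarith [hlpi hk]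
  have hlpi3 : k = 1 → l / 2 < Real.pi := fun hk => by linarith [hlpi hk, Real.pi_pos]
  have hxY : φ x ∈ Y := Or.inl (mem_image_of_mem _ hx)
  have hbY : ψ y ∈ Y := Or.inr (mem_image_of_mem _ hy)
  have hφx : φ x = x := rfl
  have hext : ∀ z ∈ Y, dist z m = l / 2 → z = x ∨ z = b := by
    intro z hz hzm
    rw [dist_comm] at hzm
    rcases hYsub hz with h1 | h1
    · left
      refine H.eq_of_btw_btw (m := m) (p := p) ?_ ?_ ?_ ?_ ?_
      · rw [Btw]
        rw [mem_closedBall, dist_comm] at h1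
        linarith [dist_triangle m p z]
      · rw [Btw, dmp, hpx, dist_comm m x, dxm]
        ring
      · rw [hzm, dist_comm, dxm]
      · rw [← dist_pos]
        linarith
      · rwa [dist_comm, dxm]
    · right
      refine H.eq_of_btw_btw (m := m) (p := q') ?_ ?_ ?_ ?_ ?_
      · rw [Btw]
        rw [mem_closedBall, dist_comm] at h1
        linarith [dist_triangle m q' z]
      · rw [Btw, dmq, dqb, dmb]
        ring
      · rw [hzm, dmb]
      · rw [← dist_pos]
        linarith
      · rwa [dmb]
  obtain ⟨hdiam, hud⟩ := H.uniqueDiametral_hull hl0 hlpi2 hYm (a := x) (b := b)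
    hxY (hψy ▸ hbY) dxb hext
  have hgood : GoodPair d K L φ ψ := by
    refine ⟨orientationPreserving_refl, hψo, fun hsp => ⟨m, fun z hz => ?_⟩⟩
    rw [mem_ball]
    exact lt_of_le_of_lt (hYm hz) (hlpi2 (hs.1 hsp))
  have hdiam' : diam (hullUnion K L φ ψ) = l := hdiam.trans (by ring)
  obtain ⟨ε, hε, σ, hσ1, hσ2, hσS⟩ := hsw φ ψ hgood x hxf y hyf
    ⟨fun h => by rw [hdiam']; exact hls h, fun h => by rw [hdiam']; exact hle h⟩
    (by rw [hψy]; exact hud)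
  rw [hψy, hφx] at hσ1 hσ2 hσS
  obtain ⟨Ua, hUa, hUaS⟩ := H.hull_near (a := x) (p := p) (q := q') (R := R) (c := l - R - R')
    (R' := R') (Y := Y) hR0 hR'0 hxp dpq (by rw [dxq]; ring) (by linarith)
    (by linarith) (fun hk => by linarith [hlpi hk]) hYsub
  obtain ⟨Ub, hUb, hUbS⟩ := H.ball_near_subset_segCyl hl0 hlpi2 dxm dmb dxb hε
  have hσn : ⇑σ ⁻¹' Ua ∈ nhds b := σ.continuous.continuousAt (by rwa [hσ2])
  have hVn : ⇑ψ ⁻¹' (Ub ∩ ⇑σ ⁻¹' Ua) ∈ nhds y :=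
    ψ.continuous.continuousAt (by rw [hψy]; exact inter_mem hUb hσn)
  refine ⟨_, hVn, ψ.symm (σ.symm p), ?_, ?_⟩
  · rintro v ⟨hv, hv1, hv2⟩
    have hvY : ψ v ∈ Y := Or.inr (mem_image_of_mem _ hv)
    have hvS : σ (ψ v) ∈ hullUnion K L φ ψ ∩ segCyl x b ε := by
      rw [← hσS]
      exact mem_image_of_mem _ ⟨subset_gconvexHull _ hvY, hUbS ⟨hYm hvY, hv1⟩⟩
    have := hUaS ⟨hvS.1, hv2⟩
    rw [mem_closedBall] at this ⊢
    rwa [← ψ.dist_eq, ← σ.dist_eq, ψ.apply_symm_apply, σ.apply_symm_apply]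
  · rw [← ψ.dist_eq, ← σ.dist_eq, ψ.apply_symm_apply, σ.apply_symm_apply, hψy, hσ2, hpx]

end Transfer

section Conclusion
open scoped RealInnerProductSpace
variable {k : ℝ} {E : Type*} [NormedAddCommGroup E] [InnerProductSpace ℝ E]

lemma HasCharts.locSupp_mono (H : HasCharts k X E) {L : Set X} {y : X} {R R' : ℝ}
    (hR0 : 0 < R) (hRR : R ≤ R') (hR' : k = 1 → R' < Real.pi / 2) (h : LocSupp L y R) :
    LocSupp L y R' := by
  obtain ⟨U, hU, q, hq, hd⟩ := h
  obtain ⟨ξ, hξ⟩ := H.chartAt y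
  obtain ⟨θ, hθ, hqθ⟩ := hξ.exists_dir H q
  obtain ⟨γ, -, hγ0, hγ1, hγ2, -, hγd⟩ := hξ.exists_geod H hθ
  have hγq : γ R = q := by
    refine hξ.ext H ?_ ?_
    · rw [hγ2, hqθ, dist_comm y q, hd]
    · rw [hγ1, vd, dist_comm, hd]
  have h1 : dist q (γ R') = R' - R := by
    rw [← hγq, hγd _ _ fun hk => ?_, abs_sub_comm, abs_of_nonneg (by linarith)]
    rw [abs_sub_comm, abs_of_nonneg (by linarith)]
    linarith [hR' hk, Real.pi_pos]
  have h2 : dist y (γ R') = R' := by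
    rw [← hγ0, hγd _ _ fun hk => ?_, zero_sub, abs_neg, abs_of_nonneg (by linarith)]
    rw [zero_sub, abs_neg, abs_of_nonneg (by linarith)]
    linarith [hR' hk, Real.pi_pos]
  refine ⟨U, hU, γ R', fun z hz => ?_, by rw [dist_comm, h2]⟩
  have := hq hz
  rw [mem_closedBall] at this ⊢
  linarith [dist_triangle z q (γ R')]

lemma HasCharts.not_locSupp_closedBall (H : HasCharts k X E) {o y : X} {R R' : ℝ}
    (hR0 : 0 < R) (hRR : R < R') (hR' : k = 1 → R' < Real.pi / 2) (hy : dist o y = R') :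
    ¬ LocSupp (closedBall o R') y R := by
  rintro ⟨U, hU, q, hq, hd⟩
  obtain ⟨ξ, hξ⟩ := H.chartAt y
  have hyo : dist y o = R' := by rw [dist_comm, hy]
  obtain ⟨n, hn, hon⟩ := hξ.exists_dir H o
  obtain ⟨τ, hτ, hnτ⟩ := H.exists_perp n
  rw [hyo] at hon
  obtain ⟨z, hzU, -, hzo, hzq⟩ := hξ.exists_inside_outside H hR0 hRR hR'
    (by rw [dist_comm, hd]) hyo hn hτ hnτ hon hU
  exact absurd (hq ⟨mem_closedBall.2 hzo.le, hzU⟩) (by rw [mem_closedBall]; linarith)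

lemma HasCharts.frontier_closedBall (H : HasCharts k X E) {o : X} {r : ℝ}
    (hr : k = 1 → r < Real.pi / 2) : frontier (closedBall o r) = sphere o r := by
  refine Subset.antisymm (frontier_closedBall_subset_sphere) fun z hz => ?_
  have hz' : dist o z = r := by rw [dist_comm]; exact hz
  exact H.mem_frontier_of_dist_eq hr Subset.rfl (sphere_subset_closedBall hz) hz'

lemma HasCharts.locallySpherical_closedBall (H : HasCharts k X E) (o : X) {r : ℝ}
    (hr : k = 1 → r < Real.pi / 2) : LocallySpherical (closedBall o r) r := fun x _ =>
  ⟨univ, isOpen_univ, mem_univ x, o, by rw [H.frontier_closedBall hr]⟩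

/-- A closed convex set which has local supporting balls of radius `R` not exceeding the
circumradius is a ball of radius `R`. -/
lemma HasCharts.eq_closedBall_of_locSupp [FiniteDimensional ℝ E] (H : HasCharts k X E)
    {L : Set X} {o : X} {R R' : ℝ} (hcl : IsClosed L) (hcv : GConvex L) (hne : L.Nonempty)
    (hR0 : 0 < R) (hRR : R ≤ R') (hR' : k = 1 → R' < Real.pi / 2) (hL : L ⊆ closedBall o R')
    (hmin : ∀ (q : X) (s : ℝ), L ⊆ closedBall q s → R' ≤ s)
    (hsupp : ∀ y ∈ frontier L, LocSupp L y R) : R = R' ∧ L = closedBall o R' := by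
  obtain ⟨ξ, h⟩ := H.chartAt o
  have hR'0 : 0 < R' := by linarith
  have h0 := H.zero_mem_convexHull hcl hne hR'0 hR' hL hmin h
  have hLeq := h.eq_closedBall H hcl hcv hR'0 hR'
    (fun y hy => H.locSupp_mono hR0 hRR hR' (hsupp y hy)) hL h0
  refine ⟨?_, hLeq⟩
  obtain ⟨_, y, ⟨hyL, hy⟩, -⟩ := convexHull_nonempty_iff.1 ⟨_, h0⟩
  have hy' : dist o y = R' := by rw [dist_comm]; exact hy
  have hs := hsupp y (H.mem_frontier_of_dist_eq hR' hL hyL hy')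
  by_contra hne
  rw [hLeq] at hs
  exact H.not_locSupp_closedBall hR0 (lt_of_le_of_ne hRR hne) hR' hy' hs

/-- A circumscribed ball of a body with supporting spheres, with a contact point. -/
lemma HasCharts.exists_circumball_contact [FiniteDimensional ℝ E] (H : HasCharts k X E)
    {d : ℕ} (hs : IsSphereSpace X d ↔ k = 1) {K : Set X} (hcl : IsClosed K)
    (hinner : (interior K).Nonempty) (hpr : K ≠ univ) (hsupp : SupportingSpheres d K) :
    ∃ (o : X) (R : ℝ), 0 < R ∧ (k = 1 → R < Real.pi / 2) ∧ K ⊆ closedBall o R ∧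
      (∀ (q : X) (s : ℝ), K ⊆ closedBall q s → R ≤ s) ∧
      ∃ x ∈ K, x ∈ frontier K ∧ dist o x = R := by
  have hne : K.Nonempty := hinner.mono interior_subset
  obtain ⟨x₀, hx₀⟩ := H.frontier_nonempty hne hpr
  obtain ⟨p, R₁, -, hp, -, hR₁⟩ := hsupp x₀ hx₀
  obtain ⟨o, R, hR0, hRR₁, hK, hmin⟩ := H.exists_circumball hinner hp
  have hR : k = 1 → R < Real.pi / 2 := fun hk => lt_of_le_of_lt hRR₁ (hR₁ (hs.2 hk))
  obtain ⟨ξ, h⟩ := H.chartAt o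
  obtain ⟨_, x, ⟨hxK, hx⟩, -⟩ :=
    convexHull_nonempty_iff.1 ⟨_, H.zero_mem_convexHull hcl hne hR0 hR hK hmin h⟩
  have hx' : dist o x = R := by rw [dist_comm]; exact hx
  exact ⟨o, R, hR0, hR, hK, hmin, x, hxK, H.mem_frontier_of_dist_eq hR hK hxK hx', hx'⟩

lemma HasCharts.locallySpherical_of_hasSwaps [FiniteDimensional ℝ E] (H : HasCharts k X E)
    {d : ℕ} (hs : IsSphereSpace X d ↔ k = 1) {K L : Set X} (hKcl : IsClosed K)
    (hLcl : IsClosed L) (hKcv : GConvex K) (hLcv : GConvex L) (hKint : (interior K).Nonempty)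
    (hLint : (interior L).Nonempty) (hKpr : K ≠ univ) (hLpr : L ≠ univ)
    (hKsupp : SupportingSpheres d K) (hLsupp : SupportingSpheres d L) (hsw : HasSwaps d K L) :
    ∃ r > (0 : ℝ), (IsSphereSpace X d → r < Real.pi / 2) ∧
      LocallySpherical K r ∧ LocallySpherical L r := by
  have key : ∀ {A B : Set X}, IsClosed B → SupportingSpheres d B → HasSwaps d A B →
      ∀ {o x : X} {R : ℝ}, 0 < R → (k = 1 → R < Real.pi / 2) → A ⊆ closedBall o R → x ∈ A →
      x ∈ frontier A → dist o x = R → ∀ y ∈ frontier B, LocSupp B y R := by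
    intro A B hB hBs hsw o x R h0 h1 h2 h3 h4 h5 y hy
    obtain ⟨q, R', hR'0, hBq, hqy, hR'⟩ := hBs y hy
    exact H.locSupp_of_hasSwaps hs hsw h0 hR'0 h1 (fun hk => hR' (hs.2 hk)) h2 h3 h4 h5 hBq
      (hB.frontier_subset hy) hy (by rw [dist_comm]; exact hqy)
  obtain ⟨o, R, hR0, hR, hK, hKmin, x, hxK, hxf, hox⟩ :=
    H.exists_circumball_contact hs hKcl hKint hKpr hKsupp
  obtain ⟨o', R', hR'0, hR', hL, hLmin, y, hyL, hyf, hoy⟩ :=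
    H.exists_circumball_contact hs hLcl hLint hLpr hLsupp
  have sL := key hLcl hLsupp hsw hR0 hR hK hxK hxf hox
  have sK := key hKcl hKsupp hsw.symm hR'0 hR' hL hyL hyf hoy
  have hKL : R ≤ R' → R = R' ∧ L = closedBall o' R' := fun hle =>
    H.eq_closedBall_of_locSupp hLcl hLcv ⟨y, hyL⟩ hR0 hle hR' hL hLmin sL
  have hLK : R' ≤ R → R' = R ∧ K = closedBall o R := fun hle =>
    H.eq_closedBall_of_locSupp hKcl hKcv ⟨x, hxK⟩ hR'0 hle hR hK hKmin sK
  have hRR : R = R' := (le_total R R').elim (fun h => (hKL h).1) fun h => (hLK h).1.symm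
  refine ⟨R, hR0, fun h => hR (hs.1 h), ?_, ?_⟩
  · rw [(hLK hRR.ge).2]
    exact H.locallySpherical_closedBall o hR
  · rw [(hKL hRR.le).2, ← hRR]
    exact H.locallySpherical_closedBall o' hR

end Conclusion

/-- **Lemma 7.6.** Under hypothesis (****) and the supporting-spheres hypothesis of
Theorem 7, each of conditions (5) and (6) of Theorem 7 implies that the boundaries of
both `K` and `L` are, at each of their points, locally relatively open subsets of
spherical surfaces of one fixed radius `r > 0` — hence of some fixed sectional
curvature `κ > 0` for `S^d` and `ℝ^d`, and `κ > 1` for `H^d` — where for `S^d` the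
radius `r` is less than `π/2`. -/
theorem lemma7_6
    (d : ℕ) (hd : 2 ≤ d)
    (X : Type*) [MetricSpace X] (hX : IsSpaceForm X d)
    (K L : Set X)
    (hKcl : IsClosed K) (hLcl : IsClosed L)
    (hKcv : GConvex K) (hLcv : GConvex L)
    (hKint : (interior K).Nonempty) (hLint : (interior L).Nonempty)
    (hKpr : K ≠ univ) (hLpr : L ≠ univ)
    (hKhemi : IsSphereSpace X d → ∃ p : X, K ⊆ ball p (Real.pi / 2))
    (hLhemi : IsSphereSpace X d → ∃ p : X, L ⊆ ball p (Real.pi / 2))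
    (hKsupp : SupportingSpheres d K) (hLsupp : SupportingSpheres d L) :
    (T7Cond5 d K L →
      ∃ r > (0 : ℝ), (IsSphereSpace X d → r < Real.pi / 2) ∧
        LocallySpherical K r ∧ LocallySpherical L r) ∧
    (T7Cond6 d K L →
      ∃ r > (0 : ℝ), (IsSphereSpace X d → r < Real.pi / 2) ∧
        LocallySpherical K r ∧ LocallySpherical L r) := by
  obtain ⟨k, H, hs⟩ := hX.exists_hasCharts hd
  have main := H.locallySpherical_of_hasSwaps hs hKcl hLcl hKcv hLcv hKint hLint hKpr hLpr
    hKsupp hLsupp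
  exact ⟨fun h => main h.hasSwaps, fun h => main h.hasSwaps⟩

end BallChar
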